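/- arXiv:2101.10217 — 2 statements merged into one kernel-verified Lean document; each statement's English description precedes it below -/
import Mathlib

section
/- Let K = F_2 be the field with two elements, let A = Q(3A)_2^2 be the algebra of quaternion type given by the stated quiver and relations, and let M = A ⊕ M_1 ⊕ M_2 ⊕ M_3 ⊕ M_4. Then the endomorphism algebra B = End_A(M) has global dimension equal to 4 and dominant dimension equal to 4. -/
open CategoryTheory

universe u

section HomologicalDefs

variable (R : Type u) [Ring R]

/-- The `i`-th Ext group of the `R`-modules `M` and `N`, computed in `ModuleCat R`. -/
noncomputable def extGrp (i : ℕ) (M N : ModuleCat.{u} R) : Type u :=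
  ((Ext ℤ (ModuleCat.{u} R) i).obj (Opposite.op M)).obj N

/-- `Ext^i_R(M, N) = 0`. -/
def ExtVanish (i : ℕ) (M N : ModuleCat.{u} R) : Prop :=
  Subsingleton (extGrp R i M N)

/-- `X` lies in `add M`: it is a direct summand of a finite direct sum of copies of `M`. -/
def MemAdd (M X : ModuleCat.{u} R) : Prop :=
  ∃ (k : ℕ) (f : X →ₗ[R] (Fin k → M)) (g : (Fin k → M) →ₗ[R] X),
    g.comp f = LinearMap.id

/-- `M` is an `n`-cluster tilting module for the ring `R`: `M` is a finite module and,
among the finite (= finite-dimensional) `R`-modules `X`, the members of `add M` are exactly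
those with `Ext^i(M, X) = 0` for `1 ≤ i ≤ n - 1`, and also exactly those with
`Ext^i(X, M) = 0` for `1 ≤ i ≤ n - 1`. -/
def IsNClusterTilting (n : ℕ) (M : ModuleCat.{u} R) : Prop :=
  Module.Finite R M ∧
  (∀ X : ModuleCat.{u} R, Module.Finite R X →
    (MemAdd R M X ↔ ∀ i, 1 ≤ i → i ≤ n - 1 → ExtVanish R i M X)) ∧
  (∀ X : ModuleCat.{u} R, Module.Finite R X →
    (MemAdd R M X ↔ ∀ i, 1 ≤ i → i ≤ n - 1 → ExtVanish R i X M))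

/-- `X` admits a projective resolution `0 → P_m → ⋯ → P_0 → X → 0` of length at most `m`. -/
def ProjDimLE (X : ModuleCat.{u} R) (m : ℕ) : Prop :=
  ∃ (P : ℕ → ModuleCat.{u} R) (d : ∀ i, P (i + 1) ⟶ P i) (ε : P 0 ⟶ X),
    (∀ i, i ≤ m → Module.Projective R (P i)) ∧
    (∀ i, m < i → Subsingleton (P i)) ∧
    Function.Surjective ε ∧ Function.Exact (d 0) ε ∧
    (∀ i, Function.Exact (d (i + 1)) (d i))

/-- The projective dimension of the `R`-module `X`, as an extended natural number. -/
noncomputable def projDim (X : ModuleCat.{u} R) : ℕ∞ :=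
  sInf {n : ℕ∞ | ∃ m : ℕ, n = (m : ℕ∞) ∧ ProjDimLE R X m}

/-- The global dimension of the ring `R`: the supremum of the projective dimensions of all
finite (= finite-dimensional) `R`-modules. -/
noncomputable def globalDim : ℕ∞ :=
  ⨆ (X : ModuleCat.{u} R) (_ : Module.Finite R X), projDim R X

/-- There is an exact sequence `0 → R → I_0 → ⋯ → I_{m-1}` of `R`-modules in which every
`I_j` is both projective and injective. -/
def DomDimGE (m : ℕ) : Prop :=
  ∃ (I : ℕ → ModuleCat.{u} R) (f : ModuleCat.of R R ⟶ I 0) (d : ∀ i, I i ⟶ I (i + 1)),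
    (∀ i, i < m → Module.Projective R (I i) ∧ Module.Injective R (I i)) ∧
    (1 ≤ m → Function.Injective f) ∧
    (2 ≤ m → Function.Exact f (d 0)) ∧
    (∀ i, i + 3 ≤ m → Function.Exact (d i) (d (i + 1)))

/-- The dominant dimension of the ring `R`: the supremum of the lengths `m` of exact sequences
`0 → R → I_0 → ⋯ → I_{m-1}` with all `I_j` projective and injective. -/
noncomputable def domDim : ℕ∞ :=
  sSup {n : ℕ∞ | ∃ m : ℕ, n = (m : ℕ∞) ∧ DomDimGE R m}

end HomologicalDefs

/-- The generators of the quiver of the algebra `Q(3A)₂²`: three vertex idempotents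
`v1, v2, v3` and four arrows `ab : 1 → 2`, `ay : 2 → 1`, `ad : 2 → 3`, `an : 3 → 2`
(named `b`, `y`, `d`, `n` in the informal description). -/
inductive QGen : Type
  | v1 | v2 | v3 | ab | ay | ad | an

open QGen FreeAlgebra in
/-- The defining relations presenting the algebra of quaternion type `Q(3A)₂²` as a quotient
of the free algebra on the vertices and arrows of the quiver: the vertex idempotents are
pairwise orthogonal idempotents summing to `1`, the arrows have the prescribed sources and
targets, and the relations `byb = bdnybdn`, `yby = dnybdny`, `ndn = nybdnyb`,
`dnd = ybdnybd`, `bybd = 0`, `ndny = 0` hold (paths are composed from left to right). -/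
inductive QuatRel (K : Type u) [CommRing K] : FreeAlgebra K QGen → FreeAlgebra K QGen → Prop
  | idem1 : QuatRel K (ι K v1 * ι K v1) (ι K v1)
  | idem2 : QuatRel K (ι K v2 * ι K v2) (ι K v2)
  | idem3 : QuatRel K (ι K v3 * ι K v3) (ι K v3)
  | orth12 : QuatRel K (ι K v1 * ι K v2) 0
  | orth21 : QuatRel K (ι K v2 * ι K v1) 0
  | orth13 : QuatRel K (ι K v1 * ι K v3) 0
  | orth31 : QuatRel K (ι K v3 * ι K v1) 0
  | orth23 : QuatRel K (ι K v2 * ι K v3) 0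
  | orth32 : QuatRel K (ι K v3 * ι K v2) 0
  | unit : QuatRel K (ι K v1 + ι K v2 + ι K v3) 1
  | src_b : QuatRel K (ι K v1 * ι K ab) (ι K ab)
  | tgt_b : QuatRel K (ι K ab * ι K v2) (ι K ab)
  | src_y : QuatRel K (ι K v2 * ι K ay) (ι K ay)
  | tgt_y : QuatRel K (ι K ay * ι K v1) (ι K ay)
  | src_d : QuatRel K (ι K v2 * ι K ad) (ι K ad)
  | tgt_d : QuatRel K (ι K ad * ι K v3) (ι K ad)
  | src_n : QuatRel K (ι K v3 * ι K an) (ι K an)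
  | tgt_n : QuatRel K (ι K an * ι K v2) (ι K an)
  | rel1 : QuatRel K (ι K ab * ι K ay * ι K ab)
      (ι K ab * ι K ad * ι K an * ι K ay * ι K ab * ι K ad * ι K an)
  | rel2 : QuatRel K (ι K ay * ι K ab * ι K ay)
      (ι K ad * ι K an * ι K ay * ι K ab * ι K ad * ι K an * ι K ay)
  | rel3 : QuatRel K (ι K an * ι K ad * ι K an)
      (ι K an * ι K ay * ι K ab * ι K ad * ι K an * ι K ay * ι K ab)
  | rel4 : QuatRel K (ι K ad * ι K an * ι K ad)
      (ι K ay * ι K ab * ι K ad * ι K an * ι K ay * ι K ab * ι K ad)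
  | rel5 : QuatRel K (ι K ab * ι K ay * ι K ab * ι K ad) 0
  | rel6 : QuatRel K (ι K an * ι K ad * ι K an * ι K ay) 0

/-- The algebra of quaternion type `Q(3A)₂²` over `K`: the path algebra of the quiver
modulo the admissible ideal, presented by generators and relations. -/
abbrev QuatAlg (K : Type u) [CommRing K] : Type u := RingQuot (QuatRel K)

/-- The images of the vertex idempotents and arrows in the algebra `Q(3A)₂²`. -/
noncomputable def qgen (K : Type u) [CommRing K] (x : QGen) : QuatAlg K :=
  RingQuot.mkAlgHom K (QuatRel K) (FreeAlgebra.ι K x)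

/-- For elements `g r` of the algebra `A = Q(3A)₂²`, the right `A`-module `gA/rA`
(realized as the image of the right ideal `gA` in the quotient of `A` by the
right ideal `rA`); right `A`-modules are left modules over `Aᵐᵒᵖ`. -/
noncomputable def cyclicQuot (K : Type u) [Field K] (g r : QuatAlg K) :
    Submodule (QuatAlg K)ᵐᵒᵖ
      ((QuatAlg K) ⧸ Submodule.span (QuatAlg K)ᵐᵒᵖ ({r} : Set (QuatAlg K))) :=
  (Submodule.span (QuatAlg K)ᵐᵒᵖ ({g} : Set (QuatAlg K))).map
    (Submodule.span (QuatAlg K)ᵐᵒᵖ ({r} : Set (QuatAlg K))).mkQ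

namespace QuatCode

open QGen

/-! ### Vectors over the field with two elements, coded as natural numbers -/

/-- The value at the code `x` of the linear map whose values at the basis codes `2 ^ q` are listed. -/
def app (T : List ℕ) : ℕ → ℕ :=
  T.rec (fun _ => 0) fun t _ f x =>
    (Nat.mod x 2).rec (f (Nat.div x 2)) fun _ _ => Nat.xor t (f (Nat.div x 2))

/-- Evaluates `x` before passing it on. -/
def forceNat {α : Type} (x : ℕ) (k : ℕ → α) : α :=
  x.rec (k 0) fun n _ => k (Nat.succ n)

/-- Evaluates the entries of a list before passing it on. -/
def forceList {α : Type} : List ℕ → (List ℕ → α) → α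
  | [], k => k []
  | x :: L, k => forceNat x fun y => forceList L fun ys => k (y :: ys)

/-- Evaluates the entries of a list of pairs before passing it on. -/
def forcePairs {α : Type} : List (ℕ × ℕ) → (List (ℕ × ℕ) → α) → α
  | [], k => k []
  | p :: L, k => forceNat p.1 fun u => forceNat p.2 fun y => forcePairs L fun ps => k ((u, y) :: ps)

/-- The function with the given values. -/
def ofValues (x₁ x₂ x₃ xb xy xd xn : List ℕ) : QGen → List ℕ
  | v1 => x₁
  | v2 => x₂
  | v3 => x₃
  | ab => xb
  | ay => xy
  | ad => xd
  | an => xn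

/-- Evaluates the tables of an action before passing it on. -/
def forceAct {α : Type} (A : QGen → List ℕ) (k : (QGen → List ℕ) → α) : α :=
  forceList (A v1) fun x₁ => forceList (A v2) fun x₂ => forceList (A v3) fun x₃ =>
  forceList (A ab) fun xb => forceList (A ay) fun xy => forceList (A ad) fun xd =>
  forceList (A an) fun xn => k (ofValues x₁ x₂ x₃ xb xy xd xn)

/-- The rows of the elimination step with pivot `u` in position `b`. -/
def reduceBy (b u y : ℕ) (p : ℕ × ℕ) : ℕ × ℕ :=
  bif p.1.testBit b then (p.1 ^^^ u, p.2 ^^^ y) else p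

/-- Applies `reduceBy` to a list of pairs, and evaluates the result before passing it on. -/
def reduceAll {α : Type} (b u y : ℕ) (L : List (ℕ × ℕ)) : (List (ℕ × ℕ) → α) → α :=
  L.rec (fun k => k []) fun p _ f k =>
    (Nat.mod (Nat.shiftRight p.1 b) 2).rec (f fun ps => k (p :: ps)) fun _ _ =>
      forceNat (Nat.xor p.1 u) fun u₁ => forceNat (Nat.xor p.2 y) fun y₁ =>
        f fun ps => k ((u₁, y₁) :: ps)

/-- Gaussian elimination: generators of the set of the `app ys x` with `app us x = 0`, where
`us` and `ys` list the first and the second components of the given pairs. -/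
def kerBasis : ℕ → List (ℕ × ℕ) → List ℕ
  | _, [] => []
  | 0, _ :: _ => []
  | k + 1, p :: L =>
    bif p.1 == 0 then p.2 :: kerBasis k L
    else forceNat p.1.log2 fun b => reduceAll b p.1 p.2 L (kerBasis k)

/-- One reduction step of a vector by a pivot row. -/
def reduceVec (b z v : ℕ) : ℕ := bif v.testBit b then v ^^^ z else v

/-- Decides by elimination whether the codes `ks` are in the span of `Z`. -/
def allInSpan : ℕ → List ℕ → List ℕ → Bool
  | _, [], ks => ks.all (· == 0)
  | 0, _ :: _, _ => false
  | k + 1, z :: Z, ks =>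
    forceNat z.log2 fun b => forceList (Z.map (reduceVec b z)) fun zs =>
      forceList (ks.map (reduceVec b z)) (allInSpan k zs)

/-- Basis words of the seven modules `P₁, P₂, P₃, M₁, M₂, M₃, M₄`, each generated by its first word. -/
def wordsOf (i : Fin 7) : List (List QGen) :=
  [[[v1], [v1, ab], [v1, ab, ay], [v1, ab, ad], [v1, ab, ad, an], [v1, ab, ad, an, ay], [v1, ab, ad, an, ay, ab], [v1, ab, ad, an, ay, ab, ad], [v1, ab, ad, an, ay, ab, ad, an], [v1, ab, ad, an, ay, ab, ad, an, ay]],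
   [[v2], [v2, ay], [v2, ad], [v2, ay, ab], [v2, ad, an], [v2, ay, ab, ad], [v2, ad, an, ay], [v2, ay, ab, ad, an], [v2, ad, an, ay, ab], [v2, ay, ab, ad, an, ay], [v2, ad, an, ay, ab, ad], [v2, ay, ab, ad, an, ay, ab], [v2, ad, an, ay, ab, ad, an], [v2, ad, an, ay, ab, ad, an, ay], [v2, ay, ab, ad, an, ay, ab, ad], [v2, ad, an, ay, ab, ad, an, ay, ab]],
   [[v3], [v3, an], [v3, an, ay], [v3, an, ad], [v3, an, ay, ab], [v3, an, ay, ab, ad], [v3, an, ay, ab, ad, an], [v3, an, ay, ab, ad, an, ay], [v3, an, ay, ab, ad, an, ay, ab], [v3, an, ay, ab, ad, an, ay, ab, ad]],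
   [[v3]],
   [[v3], [v3, an], [v3, an, ay], [v3, an, ad], [v3, an, ay, ab], [v3, an, ay, ab, ad], [v3, an, ay, ab, ad, an]],
   [[v3], [v3, an], [v3, an, ad]],
   [[v2], [v2, ad], [v2, ad, an], [v2, ad, an, ay], [v2, ad, an, ay, ab], [v2, ad, an, ay, ab, ad], [v2, ad, an, ay, ab, ad, an]]].getD i []

/-- The end vertices of the basis words. -/
def endsOf (i : Fin 7) : List ℕ :=
  [[1, 2, 1, 3, 2, 1, 2, 3, 2, 1],
   [2, 1, 3, 2, 2, 3, 1, 2, 2, 1, 3, 2, 2, 1, 3, 2],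
   [3, 2, 1, 3, 2, 3, 2, 1, 2, 3],
   [3],
   [3, 2, 1, 3, 2, 3, 2],
   [3, 2, 3],
   [2, 3, 2, 1, 2, 3, 2]].getD i []

/-- The word `r` such that the `i`-th module is `e A / r A`. -/
def relOf (i : Fin 7) : List QGen :=
  [[v2], [v1], [v1], [an], [an, ay, ab, ad, an, ay], [an, ay], [ay]].getD i []

/-- The vertex at the start of the `i`-th module. -/
def topOf (i : Fin 7) : QGen := [v1, v2, v3, v3, v3, v3, v2].getD i v1

/-- The right action of the generators of the algebra on the basis of the `i`-th module. -/
def act (i : Fin 7) : QGen → List ℕ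
  | v1 => (endsOf i).mapIdx fun q t => if t = 1 then 2 ^ q else 0
  | v2 => (endsOf i).mapIdx fun q t => if t = 2 then 2 ^ q else 0
  | v3 => (endsOf i).mapIdx fun q t => if t = 3 then 2 ^ q else 0
  | ab => [[2, 0, 256, 0, 0, 64, 0, 0, 0, 0], [0, 8, 0, 0, 0, 0, 256, 0, 0, 2048, 0, 0, 0, 32768, 0, 0], [0, 0, 16, 0, 0, 0, 0, 256, 0, 0], [0], [0, 0, 16, 0, 0, 0, 0], [0, 0, 0], [0, 0, 0, 16, 0, 0, 0]].getD i []
  | ay => [[0, 4, 0, 0, 32, 0, 0, 0, 512, 0], [2, 0, 0, 8192, 64, 0, 0, 512, 0, 0, 0, 0, 8192, 0, 0, 0], [0, 4, 0, 0, 0, 0, 128, 0, 0, 0], [0], [0, 4, 0, 0, 0, 0, 0], [0, 0, 0], [0, 0, 8, 0, 0, 0, 0]].getD i []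
  | ad => [[0, 8, 0, 0, 0, 0, 128, 0, 0, 0], [4, 0, 0, 32, 16384, 0, 0, 0, 1024, 0, 0, 16384, 0, 0, 0, 0], [0, 8, 0, 0, 32, 0, 0, 0, 512, 0], [0], [0, 8, 0, 0, 32, 0, 0], [0, 4, 0], [2, 0, 0, 0, 32, 0, 0]].getD i []
  | an => [[0, 0, 0, 16, 0, 0, 0, 256, 0, 0], [0, 0, 16, 0, 0, 128, 0, 0, 0, 0, 4096, 0, 0, 0, 32768, 0], [2, 0, 0, 256, 0, 64, 0, 0, 0, 0], [0], [2, 0, 0, 0, 0, 64, 0], [2, 0, 0], [0, 4, 0, 0, 0, 64, 0]].getD i []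

/-- Projective resolutions of the simple tops. -/
def resolutionOf (i : Fin 7) : List (List (Fin 7) × List ℕ) :=
  [[([0], []), ([1], [2]), ([6], [4104]), ([], []), ([], []), ([], [])],
   [([1], []), ([0, 2, 6], [2, 4, 4104]), ([1, 5], [1114114, 33562624]), ([6], [135176]), ([], []), ([], [])],
   [([2], []), ([1, 5], [2, 8]), ([2, 6], [65540, 133120]), ([4], [2056]), ([], []), ([], [])],
   [([3], []), ([5], [1]), ([3, 6], [4, 2]), ([4], [5]), ([3], [8]), ([], [])],
   [([4], []), ([2, 3, 5], [1, 8, 32]), ([4, 5], [2080, 1032]), ([5, 6], [544, 272]), ([4], [17]), ([], [])],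
   [([5], []), ([4, 6], [1, 2]), ([1, 4, 5], [130, 264, 32]), ([2, 3, 4], [65540, 524288, 8388640]), ([5], [66568]), ([], [])],
   [([6], []), ([1, 4], [1, 2]), ([0, 2, 3, 6], [2, 65540, 524288, 4198408]), ([1, 5], [2162690, 68165632]), ([6], [135176]), ([], [])]].getD i []

/-- Coresolutions, listed from right to left. -/
def coresolutionOf (i : Fin 7) : List (List (Fin 7) × List ℕ) :=
  [[([], []), ([], []), ([], []), ([0], [0]), ([0], [1]), ([], [])],
   [([], []), ([], []), ([], []), ([1], [0]), ([1], [1]), ([], [])],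
   [([], []), ([], []), ([], []), ([2], [0]), ([2], [1]), ([], [])],
   [([2], [0]), ([1], [2]), ([1], [2064]), ([2], [4]), ([3], [512]), ([], [])],
   [([2], [0]), ([0], [128]), ([0, 1], [4, 16]), ([1, 2], [131074, 4096]), ([4], [524320]), ([], [])],
   [([2], [0]), ([0], [4]), ([0], [4]), ([2], [8]), ([5], [8]), ([], [])],
   [([1], [0]), ([0], [2]), ([0], [512]), ([1], [2]), ([6], [4104]), ([], [])]].getD i []

/-- The dimension of the `i`-th module. -/
def dim (i : Fin 7) : ℕ := (endsOf i).length

/-- The dimension of a direct sum. -/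
def dimL : List (Fin 7) → ℕ
  | [] => 0
  | j :: l => dim j + dimL l

/-- The action of a generator on a direct sum. -/
def actL : List (Fin 7) → QGen → List ℕ
  | [], _ => []
  | j :: l, g => act j g ++ (actL l g).map (2 ^ dim j * ·)

/-- The action of a word. -/
def actWord (A : QGen → List ℕ) (z : ℕ) (w : List QGen) : ℕ := w.foldl (fun x g => app (A g) x) z

/-- The linear map on a direct sum which sends the generators of the summands to the codes `zs`. -/
def table (A : QGen → List ℕ) : List (Fin 7) → List ℕ → List ℕ
  | [], _ => []
  | _ :: _, [] => []
  | j :: l, z :: zs => (wordsOf j).map (actWord A z) ++ table A l zs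

/-- The code `z` is the image of the generator under a homomorphism from the `j`-th module. -/
def isTest (n : ℕ) (A : QGen → List ℕ) (j : Fin 7) (z : ℕ) : Bool :=
  decide (z < 2 ^ n) && app (A (topOf j)) z == z && actWord A z (relOf j) == 0

/-- The conditions imposed by `isTest` and by the kernel of a map. -/
def testRow (n m : ℕ) (A : QGen → List ℕ) (j : Fin 7) (T : List ℕ) (q : ℕ) : ℕ :=
  (app (A (topOf j)) (2 ^ q) ^^^ 2 ^ q) ^^^
    (2 ^ n * actWord A (2 ^ q) (relOf j) ^^^ 2 ^ n * (2 ^ n * (app T (2 ^ q) % 2 ^ m)))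

/-- Generators of the space of those codes in the kernel of `T` which are `isTest`. -/
def testKer (n m : ℕ) (A : QGen → List ℕ) (j : Fin 7) (T : List ℕ) : List ℕ :=
  forcePairs ((List.range n).map fun q => (testRow n m A j T q, 2 ^ q)) (kerBasis n)

/-- Validity of a map between direct sums. -/
def validMap (n : ℕ) (A : QGen → List ℕ) (l : List (Fin 7)) (zs : List ℕ) : Bool :=
  zs.length == l.length && (l.zip zs).all fun p => isTest n A p.1 p.2

/-- Exactness after applying the functor represented by the `j`-th module, where `n₂, A₂` and
`n₁, A₁` are the dimensions and actions of the source and the middle term and `T₂, T₁` are the tables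
of the maps. -/
def exactAt (n₂ n₁ n₀ : ℕ) (A₂ A₁ : QGen → List ℕ) (T₂ T₁ : List ℕ) (j : Fin 7) : Bool :=
  forceList (testKer n₂ 0 A₂ j []) fun ts =>
  forceList (testKer n₁ n₀ A₁ j T₁) fun ks =>
  forceList (ts.map (app T₂)) fun zs =>
    ts.all (isTest n₂ A₂ j) && allInSpan n₂ zs ks

/-- Validity and exactness of a complex of direct sums. -/
def complexOK (c : List (List (Fin 7) × List ℕ)) (k : ℕ) : Bool :=
  let a := c.getD k ([], [])
  let b := c.getD (k + 1) ([], [])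
  let d := c.getD (k + 2) ([], [])
  forceNat (dimL a.1) fun n₀ => forceNat (dimL b.1) fun n₁ => forceNat (dimL d.1) fun n₂ =>
  forceAct (actL a.1) fun A₀ => forceAct (actL b.1) fun A₁ => forceAct (actL d.1) fun A₂ =>
  forceList (table A₀ b.1 b.2) fun T₁ => forceList (table A₁ d.1 d.2) fun T₂ =>
  validMap n₀ A₀ b.1 b.2 && validMap n₁ A₁ d.1 d.2 && T₂.all (fun z => app T₁ z == 0) &&
   (List.finRange 7).all fun j => exactAt n₂ n₁ n₀ A₂ A₁ T₂ T₁ j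

/-! ### Rewriting of words -/

/-- The code of a generator. -/
def genIdx : QGen → ℕ
  | v1 => 1
  | v2 => 2
  | v3 => 3
  | ab => 4
  | ay => 5
  | ad => 6
  | an => 7

theorem genIdx_injective : Function.Injective genIdx := by
  intro a b h
  cases a <;> cases b <;> first | rfl | simp [genIdx] at h

instance : DecidableEq QGen := fun a b => decidable_of_iff (genIdx a = genIdx b) genIdx_injective.eq_iff

/-- The source of a generator. -/
def srcOf : QGen → QGen
  | v1 | ab => v1
  | v2 | ay | ad => v2
  | v3 | an => v3

/-- The target of a generator. -/
def tgtOf : QGen → QGen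
  | v1 | ay => v1
  | v2 | ab | an => v2
  | v3 | ad => v3

/-- The product of two generators, if it simplifies: `some none` stands for zero. -/
def mulGen (a b : QGen) : Option (Option (List QGen)) :=
  if tgtOf a = srcOf b then
    if b = srcOf b then some (some [a]) else if a = srcOf a then some (some [b]) else none
  else some none

/-- Rewriting rules for words; the right hand side `none` stands for zero. -/
def rules : List (List QGen × Option (List QGen)) :=
  [([ab, ay, ab, ad], none), ([an, ad, an, ay], none),
   ([ab, ad, an, ad], none), ([an, ay, ab, ay], none),
   ([ab, ad, an, ay, ab, ad, an, ay, ab], none), ([an, ay, ab, ad, an, ay, ab, ad, an], none),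
   ([ad, an, ay, ab, ad, an, ay, ab, ad], none),
   ([ay, ab, ad, an, ay, ab, ad, an], some [ad, an, ay, ab, ad, an, ay, ab]),
   ([ab, ay, ab], some [ab, ad, an, ay, ab, ad, an]),
   ([ay, ab, ay], some [ad, an, ay, ab, ad, an, ay]),
   ([an, ad, an], some [an, ay, ab, ad, an, ay, ab]),
   ([ad, an, ad], some [ay, ab, ad, an, ay, ab, ad])]

/-- Rewrites at the start of a word. -/
def rewriteHead (w : List QGen) : Option (Option (List QGen)) :=
  match rules.find? (fun r => r.1.isPrefixOf w) with
  | some r => some (r.2.map (· ++ w.drop r.1.length))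
  | none =>
    match w with
    | a :: b :: t => (mulGen a b).map fun o => o.map (· ++ t)
    | _ => none

/-- Rewrites at the first possible position of a word. -/
def rewriteOnce : List QGen → Option (Option (List QGen))
  | [] => none
  | a :: t =>
    match rewriteHead (a :: t) with
    | some o => some o
    | none => (rewriteOnce t).map fun o => o.map (a :: ·)

/-- The normal form of a word. -/
def normalForm : ℕ → List QGen → Option (List QGen)
  | 0, w => some w
  | k + 1, w =>
    match rewriteOnce w with
    | none => some w
    | some none => none
    | some (some u) => normalForm k u

/-- Checks that the action of the generator `g` on the `q`-th basis word of the `i`-th module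
follows from the relations. -/
def actCheck (i : Fin 7) (g : QGen) (q : ℕ) : Bool :=
  let w := normalForm 30 ((wordsOf i).getD q [] ++ [g])
  let t := (act i g).getD q 0
  (t == 0 && (w == none || (wordsOf 0 ++ wordsOf 1 ++ wordsOf 2).any fun c =>
    w == normalForm 30 (relOf i ++ c))) ||
  (List.range (dim i)).any fun p => t == 2 ^ p && w == normalForm 30 ((wordsOf i).getD p [])

/-- The list of all generators. -/
def allGens : List QGen := [v1, v2, v3, ab, ay, ad, an]

/-! ### Properties of the coded linear maps -/

theorem app_nil (x : ℕ) : app [] x = 0 := rfl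

theorem app_cons (t : ℕ) (T : List ℕ) (x : ℕ) :
    app (t :: T) x = (if x % 2 = 1 then t else 0) ^^^ app T (x / 2) := by
  rcases Nat.mod_two_eq_zero_or_one x with h | h
  · have : Nat.mod x 2 = 0 := h
    simp only [app, this, h]
    simp
    rfl
  · have : Nat.mod x 2 = 1 := h
    simp only [app, this, h]
    simp
    rfl

/-- The linear map with the given values at the basis codes. -/
def comb {G : Type*} [AddCommGroup G] : List G → ℕ → G
  | [], _ => 0
  | t :: T, x => (if x % 2 = 1 then t else 0) + comb T (x / 2)

section Comb

variable {G : Type*} [AddCommGroup G] (h2 : ∀ x : G, x + x = 0)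

include h2 in
theorem comb_xor (T : List G) (x y : ℕ) : comb T (x ^^^ y) = comb T x + comb T y := by
  induction T generalizing x y with
  | nil => simp [comb]
  | cons t T ih =>
    have e : (x ^^^ y) / 2 = x / 2 ^^^ y / 2 := by
      simpa using Nat.xor_div_two_pow (a := x) (b := y) (n := 1)
    have e' : (x ^^^ y) % 2 = x % 2 ^^^ y % 2 := by
      simpa using Nat.xor_mod_two_pow (a := x) (b := y) (n := 1)
    simp only [comb, e, ih, e']
    rcases Nat.mod_two_eq_zero_or_one x with hx | hx <;>
      rcases Nat.mod_two_eq_zero_or_one y with hy | hy <;> simp [hx, hy]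
    · abel
    · abel
    · rw [add_add_add_comm, h2, zero_add]

theorem comb_zero (T : List G) : comb T 0 = 0 := by
  induction T with
  | nil => rfl
  | cons t T ih => simp [comb, ih]

theorem comb_two_pow (T : List G) (q : ℕ) : comb T (2 ^ q) = T.getD q 0 := by
  induction T generalizing q with
  | nil => simp [comb]
  | cons t T ih =>
    cases q with
    | zero => simp [comb, comb_zero]
    | succ q =>
      have : 2 ^ (q + 1) / 2 = 2 ^ q := by omega
      simp [comb, ih, pow_succ]

theorem map_app (f : ℕ → G) (f0 : f 0 = 0) (hf : ∀ x y, f (x ^^^ y) = f x + f y)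
    (T : List ℕ) (x : ℕ) : f (app T x) = comb (T.map f) x := by
  induction T generalizing x with
  | nil => simp [app_nil, comb, f0]
  | cons t T ih =>
    rw [app_cons, hf, List.map_cons, comb, ih]
    split_ifs <;> simp [f0]

end Comb

theorem div_two_xor (x y : ℕ) : (x ^^^ y) / 2 = x / 2 ^^^ y / 2 := by
  simpa using Nat.xor_div_two_pow (a := x) (b := y) (n := 1)

theorem mod_two_xor (x y : ℕ) : (x ^^^ y) % 2 = x % 2 ^^^ y % 2 := by
  simpa using Nat.xor_mod_two_pow (a := x) (b := y) (n := 1)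

theorem xor_xor_xor_comm' (a b c d : ℕ) : (a ^^^ b) ^^^ (c ^^^ d) = (a ^^^ c) ^^^ (b ^^^ d) := by
  ac_rfl

theorem app_xor (T : List ℕ) (x y : ℕ) : app T (x ^^^ y) = app T x ^^^ app T y := by
  induction T generalizing x y with
  | nil => simp [app_nil]
  | cons t T ih =>
    simp only [app_cons, div_two_xor, ih, mod_two_xor]
    rcases Nat.mod_two_eq_zero_or_one x with hx | hx <;>
      rcases Nat.mod_two_eq_zero_or_one y with hy | hy <;> simp [hx, hy]
    · ac_rfl
    · ac_rfl
    · rw [← Nat.xor_assoc, Nat.xor_assoc t, Nat.xor_comm _ t, ← Nat.xor_assoc t, Nat.xor_self,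
        Nat.zero_xor]

theorem app_zero (T : List ℕ) : app T 0 = 0 := by
  have := app_xor T 0 0
  simpa using this

theorem app_two_pow (T : List ℕ) (q : ℕ) : app T (2 ^ q) = T.getD q 0 := by
  induction T generalizing q with
  | nil => simp [app_nil]
  | cons t T ih =>
    cases q with
    | zero => simp [app_cons, app_zero]
    | succ q =>
      have : 2 ^ (q + 1) / 2 = 2 ^ q := by omega
      simp [app_cons, ih, pow_succ]

/-- Induction over the codes of vectors. -/
theorem code_induction {P : ℕ → Prop} {n : ℕ} (h0 : P 0)
    (hx : ∀ x y, P x → P y → P (x ^^^ y)) (h : ∀ q < n, P (2 ^ q)) {x : ℕ} (hn : x < 2 ^ n) :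
    P x := by
  induction n generalizing x with
  | zero =>
    obtain rfl : x = 0 := by simpa using hn
    exact h0
  | succ n ih =>
    by_cases hb : x < 2 ^ n
    · exact ih (fun q hq => h q (by omega)) hb
    · have e : x = (x ^^^ 2 ^ n) ^^^ 2 ^ n := by simp
      rw [e]
      refine hx _ _ (ih (fun q hq => h q (by omega)) ?_) (h n (by omega))
      refine Nat.lt_pow_two_of_testBit _ fun i hi => ?_
      rw [Nat.testBit_xor, Nat.testBit_two_pow]
      rcases hi.eq_or_lt with rfl | hi
      · have : x.testBit n = true := by
          rw [Nat.testBit_eq_decide_div_mod_eq]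
          have : x / 2 ^ n = 1 := by
            rw [Nat.div_eq_iff (by positivity)]
            constructor <;> omega
          simp [this]
        simp [this]
      · have : x.testBit i = false := Nat.testBit_lt_two_pow
          (hn.trans_le (Nat.pow_le_pow_right (by norm_num) hi))
        simp [this]
        omega

theorem app_lt {T : List ℕ} {n : ℕ} (h : ∀ t ∈ T, t < 2 ^ n) (x : ℕ) : app T x < 2 ^ n := by
  induction T generalizing x with
  | nil => simp [app_nil]
  | cons t T ih =>
    rw [app_cons]
    refine Nat.xor_lt_two_pow ?_ (ih (fun t ht => h t (by simp [ht])) _)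
    split_ifs
    · exact h t (by simp)
    · positivity

/-! ### Soundness of the elimination procedure -/

theorem forceNat_eq {α : Type} (x : ℕ) (k : ℕ → α) : forceNat x k = k x := by
  cases x <;> rfl

theorem forceList_eq {α : Type} (L : List ℕ) (k : List ℕ → α) : forceList L k = k L := by
  induction L generalizing k with
  | nil => rfl
  | cons x L ih => simp [forceList, forceNat_eq, ih]

theorem forcePairs_eq {α : Type} (L : List (ℕ × ℕ)) (k : List (ℕ × ℕ) → α) :
    forcePairs L k = k L := by
  induction L generalizing k with
  | nil => rfl
  | cons x L ih => simp [forcePairs, forceNat_eq, ih]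

theorem forceAct_eq {α : Type} (A : QGen → List ℕ) (k : (QGen → List ℕ) → α) :
    forceAct A k = k A := by
  have : ofValues (A v1) (A v2) (A v3) (A ab) (A ay) (A ad) (A an) = A := by
    funext g
    cases g <;> rfl
  simp [forceAct, forceList_eq, this]

theorem reduceAll_eq {α : Type} (b u y : ℕ) (L : List (ℕ × ℕ)) (k : List (ℕ × ℕ) → α) :
    reduceAll b u y L k = k (L.map (reduceBy b u y)) := by
  induction L generalizing k with
  | nil => rfl
  | cons p L ih =>
    have e : Nat.mod (Nat.shiftRight p.1 b) 2 = if p.1.testBit b then 1 else 0 := by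
      rw [Nat.testBit_eq_decide_div_mod_eq, ← Nat.shiftRight_eq_div_pow]
      change (p.1 >>> b) % 2 = _
      rcases Nat.mod_two_eq_zero_or_one (p.1 >>> b) with h | h <;> simp [h]
    have e1 : reduceAll b u y (p :: L) k = (Nat.mod (Nat.shiftRight p.1 b) 2).rec
        (reduceAll b u y L fun L' => k (p :: L')) fun _ _ =>
      forceNat (Nat.xor p.1 u) fun u' => forceNat (Nat.xor p.2 y) fun y' =>
        reduceAll b u y L fun L' => k ((u', y') :: L') := rfl
    rw [e1, e]
    cases h : p.1.testBit b
    · simp [ih, reduceBy, h]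
    · simp [ih, reduceBy, h, forceNat_eq]

theorem app_map_reduceBy {b u : ℕ} (y : ℕ) (L : List (ℕ × ℕ)) (x : ℕ) :
    app ((L.map (reduceBy b u y)).map Prod.fst) x = app (L.map Prod.fst) x ^^^
        (if (app (L.map Prod.fst) x).testBit b then u else 0) ∧
      app ((L.map (reduceBy b u y)).map Prod.snd) x = app (L.map Prod.snd) x ^^^
        (if (app (L.map Prod.fst) x).testBit b then y else 0) := by
  induction L generalizing x with
  | nil => simp [app_nil]
  | cons p L ih =>
    obtain ⟨h1, h2⟩ := ih (x / 2)
    simp only [List.map_cons, app_cons, h1, h2, Nat.testBit_xor]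
    rcases Nat.mod_two_eq_zero_or_one x with hx | hx
    · simp [hx]
    · cases hp : p.1.testBit b <;>
        cases ha : (app (L.map Prod.fst) (x / 2)).testBit b <;>
        simp [hx, reduceBy, hp, Nat.xor_assoc] <;> (constructor <;> ac_rfl)

theorem kerBasis_sound {P : ℕ → Prop} (h0 : P 0) (hx : ∀ x y, P x → P y → P (x ^^^ y))
    (k : ℕ) (L : List (ℕ × ℕ)) (hk : L.length ≤ k) (hP : ∀ y ∈ kerBasis k L, P y) (x : ℕ)
    (h : app (L.map Prod.fst) x = 0) : P (app (L.map Prod.snd) x) := by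
  induction k generalizing L x with
  | zero =>
    obtain rfl : L = [] := by simpa using hk
    simpa [app_nil] using h0
  | succ k ih =>
    cases L with
    | nil => simpa [app_nil] using h0
    | cons p L =>
      simp only [List.length_cons, Nat.add_le_add_iff_right] at hk
      simp only [List.map_cons, app_cons] at h ⊢
      by_cases hp : p.1 = 0
      · simp only [kerBasis, hp, beq_self_eq_true, cond_true, List.mem_cons] at hP
        refine hx _ _ ?_ (ih L hk (fun y hy => hP y (Or.inr hy)) _ (by simpa [hp] using h))
        split_ifs
        · exact hP _ (Or.inl rfl)
        · exact h0
      · have hp' : (p.1 == 0) = false := by simpa using hp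
        simp only [kerBasis, hp', cond_false, forceNat_eq, reduceAll_eq] at hP
        have hb : p.1.testBit p.1.log2 = true := Nat.testBit_log2 hp
        obtain ⟨e1, e2⟩ := app_map_reduceBy p.2 L (x / 2)
        have hbit : (app (L.map Prod.fst) (x / 2)).testBit p.1.log2 = decide (x % 2 = 1) := by
          have := congrArg (fun z => z.testBit p.1.log2) h
          simp only [Nat.testBit_xor, Nat.zero_testBit] at this
          split_ifs at this with h' <;> simp_all
        have hr := ih (L.map (reduceBy p.1.log2 p.1 p.2)) (by simpa using hk) hP (x / 2) (by
          rw [e1, hbit, Nat.xor_comm]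
          simpa using h)
        rw [e2, hbit, Nat.xor_comm] at hr
        simpa using hr

theorem allInSpan_sound {P : ℕ → Prop} (h0 : P 0) (hx : ∀ x y, P x → P y → P (x ^^^ y))
    (k : ℕ) (Z ks : List ℕ) (h : allInSpan k Z ks = true) (hZ : ∀ z ∈ Z, P z) :
    ∀ z ∈ ks, P z := by
  induction k generalizing Z ks with
  | zero =>
    cases Z with
    | nil =>
      simp only [allInSpan, List.all_eq_true, beq_iff_eq] at h
      intro z hz
      rw [h z hz]
      exact h0
    | cons z Z => simp [allInSpan] at h
  | succ k ih =>
    cases Z with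
    | nil =>
      simp only [allInSpan, List.all_eq_true, beq_iff_eq] at h
      intro z hz
      rw [h z hz]
      exact h0
    | cons z Z =>
      simp only [allInSpan, forceNat_eq, forceList_eq] at h
      have hz : P z := hZ z (by simp)
      have h1 := ih _ _ h (by
        intro y hy
        obtain ⟨v, hv, rfl⟩ := List.mem_map.1 hy
        have := hZ v (by simp [hv])
        cases hb : v.testBit z.log2
        · simpa [reduceVec, hb] using this
        · simpa [reduceVec, hb] using hx _ _ this hz)
      intro y hy
      have h2 := h1 _ (List.mem_map_of_mem hy)
      cases hb : y.testBit z.log2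
      · simpa [reduceVec, hb] using h2
      · have := hx _ _ h2 hz
        simpa [reduceVec, hb, Nat.xor_assoc] using this

/-! ### The modules of bit vectors -/

/-- Bit vectors of length `n`. -/
def XorVec (n : ℕ) : Type := {x : ℕ // x < 2 ^ n}

namespace XorVec

variable {n : ℕ}

instance : Add (XorVec n) := ⟨fun x y => ⟨x.1 ^^^ y.1, Nat.xor_lt_two_pow x.2 y.2⟩⟩
instance : Zero (XorVec n) := ⟨⟨0, by positivity⟩⟩
instance : Neg (XorVec n) := ⟨fun x => x⟩

@[ext] theorem ext {x y : XorVec n} (h : x.1 = y.1) : x = y := Subtype.ext h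

instance : AddCommGroup (XorVec n) where
  add_assoc x y z := ext (Nat.xor_assoc _ _ _)
  zero_add x := ext (Nat.zero_xor _)
  add_zero x := ext (Nat.xor_zero _)
  add_comm x y := ext (Nat.xor_comm _ _)
  neg_add_cancel x := ext (Nat.xor_self _)
  nsmul := nsmulRec
  zsmul := zsmulRec

theorem add_self (x : XorVec n) : x + x = 0 := ext (Nat.xor_self _)

instance : Finite (XorVec n) := (Set.finite_lt_nat (2 ^ n)).to_subtype

instance : Module (ZMod 2) (XorVec n) :=
  AddCommGroup.zmodModule fun x => by rw [two_nsmul, add_self]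

end XorVec

theorem act_lt (i : Fin 7) (g : QGen) : ∀ t ∈ act i g, t < 2 ^ dim i := by
  revert i
  cases g <;> decide +kernel

/-- The action of a generator on the `i`-th module. -/
def actHom (i : Fin 7) (g : QGen) : XorVec (dim i) →+ XorVec (dim i) where
  toFun x := ⟨app (act i g) x.1, app_lt (act_lt i g) _⟩
  map_zero' := XorVec.ext (app_zero _)
  map_add' _ _ := XorVec.ext (app_xor _ _ _)

theorem actWord_zero (A : QGen → List ℕ) (w : List QGen) : actWord A 0 w = 0 := by
  induction w with
  | nil => rfl
  | cons g w ih =>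
    change actWord A (app (A g) 0) w = 0
    rwa [app_zero]

theorem actWord_xor (A : QGen → List ℕ) (w : List QGen) (x y : ℕ) :
    actWord A (x ^^^ y) w = actWord A x w ^^^ actWord A y w := by
  induction w generalizing x y with
  | nil => rfl
  | cons g w ih =>
    change actWord A (app (A g) (x ^^^ y)) w = _
    rw [app_xor, ih]
    rfl

/-- The pairs of words which are equal in the algebra by definition. -/
def wordRels : List (List QGen × List QGen) :=
  [([v1, v1], [v1]), ([v2, v2], [v2]), ([v3, v3], [v3]), ([v1, ab], [ab]), ([ab, v2], [ab]),
   ([v2, ay], [ay]), ([ay, v1], [ay]), ([v2, ad], [ad]), ([ad, v3], [ad]), ([v3, an], [an]),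
   ([an, v2], [an]), ([ab, ay, ab], [ab, ad, an, ay, ab, ad, an]),
   ([ay, ab, ay], [ad, an, ay, ab, ad, an, ay]), ([an, ad, an], [an, ay, ab, ad, an, ay, ab]),
   ([ad, an, ad], [ay, ab, ad, an, ay, ab, ad])]

/-- The words which are zero in the algebra by definition. -/
def zeroRels : List (List QGen) :=
  [[v1, v2], [v2, v1], [v1, v3], [v3, v1], [v2, v3], [v3, v2], [ab, ay, ab, ad], [an, ad, an, ay]]

theorem wordRels_act : ∀ i : Fin 7, ∀ r ∈ wordRels, ∀ q < dim i,
    actWord (act i) (2 ^ q) r.1 = actWord (act i) (2 ^ q) r.2 := by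
  decide +kernel

theorem zeroRels_act : ∀ i : Fin 7, ∀ r ∈ zeroRels, ∀ q < dim i,
    actWord (act i) (2 ^ q) r = 0 := by
  decide +kernel

theorem unit_act : ∀ i : Fin 7, ∀ q < dim i,
    (app (act i v1) (2 ^ q) ^^^ app (act i v2) (2 ^ q)) ^^^ app (act i v3) (2 ^ q) = 2 ^ q := by
  decide +kernel

theorem wordRels_actWord (i : Fin 7) {u v : List QGen} (h : (u, v) ∈ wordRels)
    (x : XorVec (dim i)) : actWord (act i) x.1 u = actWord (act i) x.1 v :=
  code_induction (P := fun z => actWord (act i) z u = actWord (act i) z v)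
    (by simp [actWord_zero]) (fun x y hx hy => by simp [actWord_xor, hx, hy])
    (fun q hq => wordRels_act i _ h q hq) x.2

theorem zeroRels_actWord (i : Fin 7) {u : List QGen} (h : u ∈ zeroRels)
    (x : XorVec (dim i)) : actWord (act i) x.1 u = 0 :=
  code_induction (P := fun z => actWord (act i) z u = 0)
    (actWord_zero _ _) (fun x y hx hy => by simp [actWord_xor, hx, hy])
    (fun q hq => zeroRels_act i _ h q hq) x.2

theorem unit_app (i : Fin 7) (x : XorVec (dim i)) :
    (app (act i v1) x.1 ^^^ app (act i v2) x.1) ^^^ app (act i v3) x.1 = x.1 :=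
  code_induction (P := fun z => (app (act i v1) z ^^^ app (act i v2) z) ^^^ app (act i v3) z = z)
    (by simp [app_zero]) (fun x y hx hy => by
      rw [app_xor, app_xor, app_xor, xor_xor_xor_comm' (app (act i v1) x), xor_xor_xor_comm', hx, hy])
    (fun q hq => unit_act i q hq) x.2

/-- The algebra of the problem. -/
abbrev Alg : Type := QuatAlg (ZMod 2)

/-- The images of the generators in the algebra. -/
noncomputable abbrev gen (g : QGen) : Alg := qgen (ZMod 2) g

/-- Right modules are modules over the opposite algebra. -/
abbrev AlgOp : Type := Algᵐᵒᵖ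

/-- The right action of the free algebra on the `i`-th module. -/
noncomputable def freeAct (i : Fin 7) :
    FreeAlgebra (ZMod 2) QGen →ₐ[ZMod 2] (Module.End (ZMod 2) (XorVec (dim i)))ᵐᵒᵖ :=
  FreeAlgebra.lift (ZMod 2) fun g => MulOpposite.op ((actHom i g).toZModLinearMap 2)

theorem freeAct_rel (i : Fin 7) ⦃a b : FreeAlgebra (ZMod 2) QGen⦄ (h : QuatRel (ZMod 2) a b) :
    freeAct i a = freeAct i b := by
  have hw {u v : List QGen} (h : (u, v) ∈ wordRels) (x : XorVec (dim i)) := wordRels_actWord i h x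
  have hz {u : List QGen} (h : u ∈ zeroRels) (x : XorVec (dim i)) := zeroRels_actWord i h x
  cases h
  case unit =>
    simp only [freeAct, map_add, FreeAlgebra.lift_ι_apply, map_one]
    refine MulOpposite.unop_injective (LinearMap.ext fun x => XorVec.ext ?_)
    exact unit_app i x
  all_goals
    simp only [freeAct, map_mul, FreeAlgebra.lift_ι_apply, map_zero]
    refine MulOpposite.unop_injective (LinearMap.ext fun x => XorVec.ext ?_)
  case idem1 => exact hw (u := [v1, v1]) (v := [v1]) (by decide) x
  case idem2 => exact hw (u := [v2, v2]) (v := [v2]) (by decide) x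
  case idem3 => exact hw (u := [v3, v3]) (v := [v3]) (by decide) x
  case orth12 => exact hz (u := [v1, v2]) (by decide) x
  case orth21 => exact hz (u := [v2, v1]) (by decide) x
  case orth13 => exact hz (u := [v1, v3]) (by decide) x
  case orth31 => exact hz (u := [v3, v1]) (by decide) x
  case orth23 => exact hz (u := [v2, v3]) (by decide) x
  case orth32 => exact hz (u := [v3, v2]) (by decide) x
  case src_b => exact hw (u := [v1, ab]) (v := [ab]) (by decide) x
  case tgt_b => exact hw (u := [ab, v2]) (v := [ab]) (by decide) x
  case src_y => exact hw (u := [v2, ay]) (v := [ay]) (by decide) x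
  case tgt_y => exact hw (u := [ay, v1]) (v := [ay]) (by decide) x
  case src_d => exact hw (u := [v2, ad]) (v := [ad]) (by decide) x
  case tgt_d => exact hw (u := [ad, v3]) (v := [ad]) (by decide) x
  case src_n => exact hw (u := [v3, an]) (v := [an]) (by decide) x
  case tgt_n => exact hw (u := [an, v2]) (v := [an]) (by decide) x
  case rel1 =>
    exact hw (u := [ab, ay, ab]) (v := [ab, ad, an, ay, ab, ad, an]) (by decide) x
  case rel2 =>
    exact hw (u := [ay, ab, ay]) (v := [ad, an, ay, ab, ad, an, ay]) (by decide) x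
  case rel3 =>
    exact hw (u := [an, ad, an]) (v := [an, ay, ab, ad, an, ay, ab]) (by decide) x
  case rel4 =>
    exact hw (u := [ad, an, ad]) (v := [ay, ab, ad, an, ay, ab, ad]) (by decide) x
  case rel5 => exact hz (u := [ab, ay, ab, ad]) (by decide) x
  case rel6 => exact hz (u := [an, ad, an, ay]) (by decide) x

/-- The right action of the algebra on the `i`-th module. -/
noncomputable def algAct (i : Fin 7) :
    AlgOp →ₐ[ZMod 2] Module.End (ZMod 2) (XorVec (dim i)) :=
  AlgHom.opComm (RingQuot.liftAlgHom (ZMod 2) ⟨freeAct i, freeAct_rel i⟩)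

/-- The `i`-th module. -/
def X (i : Fin 7) : Type := XorVec (dim i)

noncomputable instance (i : Fin 7) : AddCommGroup (X i) := inferInstanceAs (AddCommGroup (XorVec _))

instance (i : Fin 7) : Finite (X i) := inferInstanceAs (Finite (XorVec _))

noncomputable instance (i : Fin 7) : Module AlgOp (X i) :=
  Module.compHom (XorVec (dim i)) (algAct i : AlgOp →+* Module.End (ZMod 2) (XorVec (dim i)))

theorem gen_smul (i : Fin 7) (g : QGen) (x : X i) :
    MulOpposite.op (gen g) • x = (⟨app (act i g) x.1, app_lt (act_lt i g) _⟩ : XorVec (dim i)) := by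
  change algAct i (MulOpposite.op (gen g)) x = _
  have : algAct i (MulOpposite.op (gen g)) = (actHom i g).toZModLinearMap 2 := by
    simp [algAct, gen, qgen, AlgHom.opComm, freeAct]
  rw [this]
  rfl

/-! ### Words in the algebra -/

theorem alg_induction {P : Alg → Prop} (h0 : P 0) (hg : ∀ g, P (gen g))
    (ha : ∀ a b, P a → P b → P (a + b)) (hm : ∀ a b, P a → P b → P (a * b)) (a : Alg) : P a := by
  have h1 : P 1 := by
    have : gen v1 + gen v2 + gen v3 = 1 := by
      have := RingQuot.mkAlgHom_rel (ZMod 2) (QuatRel.unit (K := ZMod 2))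
      rw [map_add, map_add, map_one] at this
      exact this
    rw [← this]
    exact ha _ _ (ha _ _ (hg _) (hg _)) (hg _)
  obtain ⟨z, rfl⟩ := RingQuot.mkAlgHom_surjective (ZMod 2) (QuatRel (ZMod 2)) a
  induction z using FreeAlgebra.induction with
  | grade0 r =>
    rw [AlgHom.commutes]
    fin_cases r
    · exact (map_zero (algebraMap (ZMod 2) Alg)).symm ▸ h0
    · exact (map_one (algebraMap (ZMod 2) Alg)).symm ▸ h1
  | grade1 g => exact hg g
  | mul a b iha ihb =>
    rw [map_mul]
    exact hm _ _ iha ihb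
  | add a b iha ihb =>
    rw [map_add]
    exact ha _ _ iha ihb

/-- An additive map which commutes with the action of the generators is linear. -/
def linearOfGens {Y Z : Type*} [AddCommGroup Y] [AddCommGroup Z] [Module AlgOp Y] [Module AlgOp Z]
    (f : Y →+ Z)
    (hf : ∀ g y, f (MulOpposite.op (gen g) • y) = MulOpposite.op (gen g) • f y) :
    Y →ₗ[AlgOp] Z where
  toFun := f
  map_add' := map_add f
  map_smul' a y := by
    induction a using MulOpposite.rec' with | _ a =>
    revert y
    refine alg_induction (P := fun a => ∀ y, f (MulOpposite.op a • y) = MulOpposite.op a • f y)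
      (by simp) hf (fun a b ha hb y => ?_) (fun a b ha hb y => ?_) a
    · rw [MulOpposite.op_add, add_smul, map_add, ha, hb, add_smul]
    · rw [MulOpposite.op_mul, mul_smul, hb, ha, mul_smul]

/-- The element of the algebra given by a word. -/
noncomputable def wordA (w : List QGen) : Alg := (w.map gen).prod

theorem wordA_append (u v : List QGen) : wordA (u ++ v) = wordA u * wordA v := by
  simp [wordA]

theorem wordA_cons (g : QGen) (v : List QGen) : wordA (g :: v) = gen g * wordA v := by
  simp [wordA]

theorem op_wordA_cons {Y : Type*} [AddCommGroup Y] [Module AlgOp Y] (g : QGen) (v : List QGen)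
    (y : Y) : MulOpposite.op (wordA (g :: v)) • y =
      MulOpposite.op (wordA v) • MulOpposite.op (gen g) • y := by
  rw [wordA_cons, MulOpposite.op_mul, mul_smul]

theorem op_wordA_append {Y : Type*} [AddCommGroup Y] [Module AlgOp Y] (u v : List QGen)
    (y : Y) : MulOpposite.op (wordA (u ++ v)) • y =
      MulOpposite.op (wordA v) • MulOpposite.op (wordA u) • y := by
  rw [wordA_append, MulOpposite.op_mul, mul_smul]

theorem wordA_smul (i : Fin 7) (w : List QGen) (x : X i) :
    (MulOpposite.op (wordA w) • x : X i).1 = actWord (act i) x.1 w := by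
  induction w generalizing x with
  | nil => simp [wordA, actWord]
  | cons g w ih =>
    rw [op_wordA_cons, ih, gen_smul]
    rfl

/-- The element of the algebra given by a word or zero. -/
noncomputable def valA : Option (List QGen) → Alg
  | none => 0
  | some w => wordA w

theorem valA_map_append (o : Option (List QGen)) (t : List QGen) :
    valA (o.map (· ++ t)) = valA o * wordA t := by
  cases o <;> simp [valA, wordA_append]

theorem valA_map_cons (o : Option (List QGen)) (a : QGen) :
    valA (o.map (a :: ·)) = gen a * valA o := by
  cases o <;> simp [valA, wordA_cons]

theorem gen_rel {a b : FreeAlgebra (ZMod 2) QGen} (h : QuatRel (ZMod 2) a b) :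
    RingQuot.mkAlgHom (ZMod 2) (QuatRel (ZMod 2)) a = RingQuot.mkAlgHom (ZMod 2) (QuatRel (ZMod 2)) b :=
  RingQuot.mkAlgHom_rel _ h

theorem gen_mul_tgt (a : QGen) : gen a * gen (tgtOf a) = gen a := by
  simp only [gen, qgen, ← map_mul]
  apply gen_rel
  cases a <;> constructor

theorem src_mul_gen (a : QGen) : gen (srcOf a) * gen a = gen a := by
  simp only [gen, qgen, ← map_mul]
  apply gen_rel
  cases a <;> constructor

theorem gen_mul_eq_zero {a b : QGen} (h : tgtOf a ≠ srcOf b) : gen a * gen b = 0 := by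
  have : gen (tgtOf a) * gen (srcOf b) = 0 := by
    rw [← map_zero (RingQuot.mkAlgHom (ZMod 2) (QuatRel (ZMod 2)))]
    simp only [gen, qgen, ← map_mul]
    apply gen_rel
    cases a <;> cases b <;> first | exact absurd rfl h | constructor
  rw [← gen_mul_tgt a, ← src_mul_gen b, mul_assoc, ← mul_assoc (gen (tgtOf a)), this]
  simp

theorem mulGen_sound {a b : QGen} {o : Option (List QGen)} (h : mulGen a b = some o) :
    gen a * gen b = valA o := by
  unfold mulGen at h
  split_ifs at h with h1 h2 h3
  · obtain rfl : some [a] = o := by simpa using h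
    rw [h2, ← h1, gen_mul_tgt]
    simp [valA, wordA]
  · obtain rfl : some [b] = o := by simpa using h
    have : a = srcOf b := by
      rw [← h1]
      generalize hs : srcOf a = s at h3
      subst h3
      revert hs
      cases a <;> decide
    rw [this, src_mul_gen]
    simp [valA, wordA]
  · obtain rfl : none = o := by simpa using h
    exact gen_mul_eq_zero h1

theorem rules_sound : ∀ r ∈ rules, wordA r.1 = valA r.2 := by
  have h1 : gen ab * gen ay * gen ab =
      gen ab * gen ad * gen an * gen ay * gen ab * gen ad * gen an := by
    simp only [gen, qgen, ← map_mul]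
    exact gen_rel .rel1
  have h2 : gen ay * gen ab * gen ay =
      gen ad * gen an * gen ay * gen ab * gen ad * gen an * gen ay := by
    simp only [gen, qgen, ← map_mul]
    exact gen_rel .rel2
  have h3 : gen an * gen ad * gen an =
      gen an * gen ay * gen ab * gen ad * gen an * gen ay * gen ab := by
    simp only [gen, qgen, ← map_mul]
    exact gen_rel .rel3
  have h4 : gen ad * gen an * gen ad =
      gen ay * gen ab * gen ad * gen an * gen ay * gen ab * gen ad := by
    simp only [gen, qgen, ← map_mul]
    exact gen_rel .rel4
  have h5 : gen ab * gen ay * gen ab * gen ad = 0 := by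
    rw [← map_zero (RingQuot.mkAlgHom (ZMod 2) (QuatRel (ZMod 2)))]
    simp only [gen, qgen, ← map_mul]
    exact gen_rel .rel5
  have h6 : gen an * gen ad * gen an * gen ay = 0 := by
    rw [← map_zero (RingQuot.mkAlgHom (ZMod 2) (QuatRel (ZMod 2)))]
    simp only [gen, qgen, ← map_mul]
    exact gen_rel .rel6
  simp only [rules, List.forall_mem_cons, List.not_mem_nil, false_imp_iff, implies_true, and_true,
    valA, wordA, List.map_cons, List.map_nil, List.prod_cons, List.prod_nil, mul_one]
  generalize gen ab = b at *
  generalize gen ay = y at *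
  generalize gen ad = d at *
  generalize gen an = n at *
  refine ⟨?_, ?_, ?_, ?_, ?_, ?_, ?_, ?_, ?_, ?_, ?_, ?_⟩
  · simpa only [mul_assoc] using h5
  · simpa only [mul_assoc] using h6
  · calc b * (d * (n * d)) = b * (d * n * d) := by simp only [mul_assoc]
      _ = (b * y * b * d) * (n * y * b * d) := by rw [h4]; simp only [mul_assoc]
      _ = 0 := by rw [h5, zero_mul]
  · calc n * (y * (b * y)) = n * (y * b * y) := by simp only [mul_assoc]
      _ = (n * d * n * y) * (b * d * n * y) := by rw [h2]; simp only [mul_assoc]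
      _ = 0 := by rw [h6, zero_mul]
  · calc _ = (b * d * n * y * b * d * n) * (y * b) := by simp only [mul_assoc]
      _ = b * y * (b * y * b) := by rw [← h1]; simp only [mul_assoc]
      _ = (b * y * b * d) * (n * y * b * d * n) := by
        conv_lhs => rw [h1]
        simp only [mul_assoc]
      _ = 0 := by rw [h5, zero_mul]
  · calc _ = (n * y * b * d * n * y * b) * (d * n) := by simp only [mul_assoc]
      _ = n * d * (n * d * n) := by rw [← h3]; simp only [mul_assoc]
      _ = (n * d * n * y) * (b * d * n * y * b) := by
        conv_lhs => rw [h3]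
        simp only [mul_assoc]
      _ = 0 := by rw [h6, zero_mul]
  · calc _ = (d * n * y * b * d * n * y) * (b * d) := by simp only [mul_assoc]
      _ = y * (b * y * b * d) := by rw [← h2]; simp only [mul_assoc]
      _ = 0 := by rw [h5, mul_zero]
  · calc _ = y * (b * d * n * y * b * d * n) := by simp only [mul_assoc]
      _ = (y * b * y) * b := by rw [← h1]; simp only [mul_assoc]
      _ = _ := by rw [h2]; simp only [mul_assoc]
  · simpa only [mul_assoc] using h1
  · simpa only [mul_assoc] using h2
  · simpa only [mul_assoc] using h3
  · simpa only [mul_assoc] using h4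

theorem rewriteHead_sound {w : List QGen} {o : Option (List QGen)} (h : rewriteHead w = some o) :
    wordA w = valA o := by
  unfold rewriteHead at h
  split at h
  · next r hr =>
    obtain rfl := Option.some.inj h
    have hp : r.1 <+: w := by
      simpa using List.find?_some hr
    obtain ⟨t, rfl⟩ := hp
    rw [valA_map_append, ← rules_sound r (List.mem_of_find?_eq_some hr), wordA_append]
    simp
  · split at h
    · next a b t _ =>
      obtain ⟨o', ho, rfl⟩ := Option.map_eq_some_iff.1 h
      rw [valA_map_append, ← mulGen_sound ho, wordA_cons, wordA_cons, mul_assoc]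
    · simp at h

theorem rewriteOnce_sound {w : List QGen} {o : Option (List QGen)} (h : rewriteOnce w = some o) :
    wordA w = valA o := by
  induction w generalizing o with
  | nil => simp [rewriteOnce] at h
  | cons a t ih =>
    rw [rewriteOnce] at h
    split at h
    · next o' ho =>
      obtain rfl := Option.some.inj h
      exact rewriteHead_sound ho
    · obtain ⟨o', ho, rfl⟩ := Option.map_eq_some_iff.1 h
      rw [valA_map_cons, ← ih ho, wordA_cons]

theorem normalForm_sound (k : ℕ) (w : List QGen) : valA (normalForm k w) = wordA w := by
  induction k generalizing w with
  | zero => rfl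
  | succ k ih =>
    rw [normalForm]
    split
    · rfl
    · next h => rw [rewriteOnce_sound h]
    · next w' h => rw [rewriteOnce_sound h, ih]; rfl

/-! ### Results of the computations -/

theorem complexOK_resolutionOf : ∀ i : Fin 7, (List.range 4).all (complexOK (resolutionOf i)) = true := by
  decide +kernel

theorem complexOK_coresolutionOf :
    ∀ i : Fin 7, (List.range 4).all (complexOK (coresolutionOf i)) = true := by
  decide +kernel

theorem actCheck_all :
    ∀ i : Fin 7, (allGens.all fun g => (List.range (dim i)).all (actCheck i g)) = true := by
  decide +kernel

/-! ### Homomorphisms from the modules -/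

theorem zero_lt_dim : ∀ i : Fin 7, 0 < dim i := by decide +kernel

/-- The generator of the `i`-th module. -/
def gX (i : Fin 7) : X i := (⟨1, Nat.one_lt_two_pow (zero_lt_dim i).ne'⟩ : XorVec (dim i))

section TwoTorsion

variable {Y : Type*} [AddCommGroup Y] [Module AlgOp Y]

variable (Y) in
theorem add_self_eq_zero (y : Y) : y + y = 0 := by
  have h : (1 : AlgOp) + 1 = 0 := by
    have : algebraMap (ZMod 2) AlgOp (1 + 1) = algebraMap (ZMod 2) AlgOp 0 := rfl
    simpa only [map_add, map_one, map_zero] using this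
  have : ((1 : AlgOp) + 1) • y = 0 := by rw [h, zero_smul]
  simpa only [add_smul, one_smul] using this

/-- The conditions on an element to be the image of the generator of the `i`-th module. -/
def IsTestElt (i : Fin 7) (y : Y) : Prop :=
  MulOpposite.op (gen (topOf i)) • y = y ∧ MulOpposite.op (wordA (relOf i)) • y = 0

/-- The list of the multiples of an element by the basis words of the `i`-th module. -/
noncomputable def wordMultiples (i : Fin 7) (y : Y) : List Y :=
  (wordsOf i).map fun w => MulOpposite.op (wordA w) • y

theorem length_wordsOf : ∀ i : Fin 7, (wordsOf i).length = dim i := by decide +kernel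

theorem getD_wordMultiples (i : Fin 7) (y : Y) {q : ℕ} (hq : q < dim i) :
    (wordMultiples i y).getD q 0 = MulOpposite.op (wordA ((wordsOf i).getD q [])) • y := by
  rw [← length_wordsOf] at hq
  simp [wordMultiples, hq]

theorem comb_wordMultiples_act (i : Fin 7) (g : QGen) {y : Y} (hy : IsTestElt i y) {x : ℕ}
    (hx : x < 2 ^ dim i) :
    comb (wordMultiples i y) (app (act i g) x) =
      MulOpposite.op (gen g) • comb (wordMultiples i y) x := by
  refine code_induction (P := fun x => comb (wordMultiples i y) (app (act i g) x) =
      MulOpposite.op (gen g) • comb (wordMultiples i y) x) (by simp [app_zero, comb_zero])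
      (fun x y hx hy => ?_) (fun q hq => ?_) hx
  · rw [app_xor, comb_xor (add_self_eq_zero Y), comb_xor (add_self_eq_zero Y), hx, hy, smul_add]
  · rw [app_two_pow, comb_two_pow, getD_wordMultiples i y hq, ← mul_smul, ← MulOpposite.op_mul]
    have h : actCheck i g q = true := by
      have := List.all_eq_true.1 (actCheck_all i) g (by cases g <;> decide)
      exact List.all_eq_true.1 this q (List.mem_range.2 hq)
    have hw : wordA ((wordsOf i).getD q []) * gen g =
        valA (normalForm 30 ((wordsOf i).getD q [] ++ [g])) := by
      rw [normalForm_sound, wordA_append]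
      simp [wordA]
    rw [hw]
    simp only [actCheck, Bool.or_eq_true, Bool.and_eq_true, beq_iff_eq, List.any_eq_true] at h
    rcases h with ⟨ht, h | ⟨c, -, h⟩⟩ | ⟨p, hp, ht, h⟩
    · rw [ht, h, comb_zero]
      simp [valA]
    · rw [ht, h, comb_zero, normalForm_sound, op_wordA_append, hy.2, smul_zero]
    · rw [ht, h, normalForm_sound, comb_two_pow, getD_wordMultiples i y (List.mem_range.1 hp)]

theorem wordsOf_zero : ∀ i : Fin 7, (wordsOf i).getD 0 [] = [topOf i] := by decide +kernel

/-- The homomorphism from the `i`-th module which sends the generator to a given element. -/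
noncomputable def liftX (i : Fin 7) (y : Y) (hy : IsTestElt i y) : X i →ₗ[AlgOp] Y :=
  linearOfGens
    { toFun := fun x => comb (wordMultiples i y) x.1
      map_zero' := comb_zero _
      map_add' := fun _ _ => comb_xor (add_self_eq_zero Y) _ _ _ } fun g x => by
    change comb _ (MulOpposite.op (gen g) • x : X i).1 = _
    rw [gen_smul]
    exact comb_wordMultiples_act i g hy x.2

theorem liftX_apply (i : Fin 7) (y : Y) (hy : IsTestElt i y) (x : X i) :
    liftX i y hy x = comb (wordMultiples i y) x.1 := rfl

theorem liftX_gX (i : Fin 7) (y : Y) (hy : IsTestElt i y) : liftX i y hy (gX i) = y := by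
  rw [liftX_apply]
  have : (gX i).1 = 2 ^ 0 := rfl
  rw [this, comb_two_pow, getD_wordMultiples i y (zero_lt_dim i), wordsOf_zero]
  simpa [wordA] using hy.1

theorem actWord_wordsOf : ∀ i : Fin 7, ∀ q < dim i,
    actWord (act i) 1 ((wordsOf i).getD q []) = 2 ^ q := by decide +kernel

theorem hom_apply {i : Fin 7} (f : X i →ₗ[AlgOp] Y) (x : X i) :
    f x = comb (wordMultiples i (f (gX i))) x.1 := by
  obtain ⟨x, hx⟩ := x
  have := code_induction (P := fun z => ∃ h : z < 2 ^ dim i,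
    f (⟨z, h⟩ : XorVec (dim i)) = comb (wordMultiples i (f (gX i))) z) (n := dim i) ?_ ?_ ?_ hx
  · exact this.2
  · exact ⟨by positivity, by rw [comb_zero]; exact map_zero f⟩
  · rintro x y ⟨h1, hx⟩ ⟨h2, hy⟩
    refine ⟨Nat.xor_lt_two_pow h1 h2, ?_⟩
    rw [comb_xor (add_self_eq_zero Y), ← hx, ← hy]
    exact f.map_add (⟨x, h1⟩ : X i) (⟨y, h2⟩ : X i)
  · intro q hq
    refine ⟨Nat.pow_lt_pow_right (by norm_num) hq, ?_⟩
    rw [comb_two_pow, getD_wordMultiples i _ hq, ← map_smul]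
    congr 1
    refine XorVec.ext ?_
    rw [wordA_smul]
    exact (actWord_wordsOf i q hq).symm

theorem hom_ext {i : Fin 7} {f g : X i →ₗ[AlgOp] Y} (h : f (gX i) = g (gX i)) : f = g :=
  LinearMap.ext fun x => by rw [hom_apply f, hom_apply g, h]

theorem gX_top : ∀ i : Fin 7, app (act i (topOf i)) 1 = 1 := by decide +kernel

theorem gX_rel : ∀ i : Fin 7, actWord (act i) 1 (relOf i) = 0 := by decide +kernel

theorem isTestElt_gX (i : Fin 7) : IsTestElt i (gX i) := by
  refine ⟨?_, XorVec.ext ?_⟩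
  · rw [gen_smul]
    exact XorVec.ext (gX_top i)
  · rw [wordA_smul]
    exact gX_rel i

theorem IsTestElt.map {Z : Type*} [AddCommGroup Z] [Module AlgOp Z] {i : Fin 7} {y : Y}
    (hy : IsTestElt i y) (f : Y →ₗ[AlgOp] Z) : IsTestElt i (f y) :=
  ⟨by rw [← map_smul, hy.1], by rw [← map_smul, hy.2, map_zero]⟩

end TwoTorsion

/-! ### Direct sums of the modules -/

/-- The direct sum of the modules indexed by a list. -/
def Obj : List (Fin 7) → Type
  | [] => PUnit
  | j :: l => X j × Obj l

noncomputable instance : ∀ l, AddCommGroup (Obj l)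
  | [] => inferInstanceAs (AddCommGroup PUnit)
  | j :: l =>
    let : AddCommGroup (Obj l) := instAddCommGroupObj l
    inferInstanceAs (AddCommGroup (X j × Obj l))

noncomputable instance : ∀ l, Module AlgOp (Obj l)
  | [] => inferInstanceAs (Module AlgOp PUnit)
  | j :: l =>
    let : Module AlgOp (Obj l) := instModuleAlgOpObj l
    inferInstanceAs (Module AlgOp (X j × Obj l))

/-- The vector in a direct sum with a given code. -/
def dec : ∀ l : List (Fin 7), ℕ → Obj l
  | [], _ => PUnit.unit
  | j :: l, x => ((⟨x % 2 ^ dim j, Nat.mod_lt _ (by positivity)⟩ : XorVec (dim j)), dec l (x / 2 ^ dim j))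

theorem dec_xor (l : List (Fin 7)) (x y : ℕ) : dec l (x ^^^ y) = dec l x + dec l y := by
  induction l generalizing x y with
  | nil => rfl
  | cons j l ih =>
    refine Prod.ext (XorVec.ext ?_) ?_
    · exact Nat.xor_mod_two_pow
    · change dec l ((x ^^^ y) / 2 ^ dim j) = dec l (x / 2 ^ dim j) + dec l (y / 2 ^ dim j)
      rw [Nat.xor_div_two_pow, ih]

theorem dec_zero (l : List (Fin 7)) : dec l 0 = 0 := by
  induction l with
  | nil => rfl
  | cons j l ih =>
    refine Prod.ext (XorVec.ext ?_) ?_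
    · exact Nat.zero_mod _
    · change dec l (0 / 2 ^ dim j) = 0
      rw [Nat.zero_div, ih]

theorem exists_dec {l : List (Fin 7)} (y : Obj l) : ∃ x < 2 ^ dimL l, dec l x = y := by
  induction l with
  | nil => exact ⟨0, by simp, rfl⟩
  | cons j l ih =>
    obtain ⟨u, v⟩ := y
    obtain ⟨x, hx, rfl⟩ := ih v
    have hu : u.1 < 2 ^ dim j := u.2
    refine ⟨u.1 + 2 ^ dim j * x, ?_, Prod.ext (XorVec.ext ?_) ?_⟩
    · rw [dimL, pow_add]
      nlinarith
    · change (u.1 + 2 ^ dim j * x) % 2 ^ dim j = u.1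
      rw [Nat.add_mul_mod_self_left, Nat.mod_eq_of_lt hu]
    · change dec l ((u.1 + 2 ^ dim j * x) / 2 ^ dim j) = dec l x
      rw [Nat.add_mul_div_left _ _ (by positivity), Nat.div_eq_of_lt hu, zero_add]

theorem mod_eq_zero_of_dec {l : List (Fin 7)} {x : ℕ} (h : dec l x = 0) : x % 2 ^ dimL l = 0 := by
  induction l generalizing x with
  | nil => simp [dimL, Nat.mod_one]
  | cons j l ih =>
    have h1 : x % 2 ^ dim j = 0 := congrArg (fun p : X j × Obj l => p.1.1) h
    have h2 : dec l (x / 2 ^ dim j) = 0 := congrArg (fun p : X j × Obj l => p.2) h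
    rw [dimL, pow_add, Nat.mod_mul, h1, ih h2]
    simp

theorem eq_of_dec_eq {l : List (Fin 7)} {x y : ℕ} (hx : x < 2 ^ dimL l) (hy : y < 2 ^ dimL l)
    (h : dec l x = dec l y) : x ^^^ y = 0 := by
  have : dec l (x ^^^ y) = 0 := by rw [dec_xor, h, add_self_eq_zero]
  rw [← Nat.mod_eq_of_lt (Nat.xor_lt_two_pow hx hy)]
  exact mod_eq_zero_of_dec this

theorem app_append (S T : List ℕ) (x : ℕ) :
    app (S ++ T) x = app S x ^^^ app T (x / 2 ^ S.length) := by
  induction S generalizing x with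
  | nil => simp [app_nil]
  | cons s S ih =>
    rw [List.cons_append, app_cons, app_cons, ih, Nat.div_div_eq_div_mul, List.length_cons,
      pow_succ', Nat.xor_assoc]

theorem app_mod (S : List ℕ) (x : ℕ) : app S (x % 2 ^ S.length) = app S x := by
  induction S generalizing x with
  | nil => rfl
  | cons s S ih =>
    rw [app_cons, app_cons, List.length_cons, pow_succ']
    rw [Nat.mod_mul_right_mod, Nat.mod_mul_right_div_self, ih]

theorem comb_mod {G : Type*} [AddCommGroup G] (S : List G) (x : ℕ) :
    comb S (x % 2 ^ S.length) = comb S x := by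
  induction S generalizing x with
  | nil => rfl
  | cons s S ih =>
    rw [comb, comb, List.length_cons, pow_succ']
    rw [Nat.mod_mul_right_mod, Nat.mod_mul_right_div_self, ih]

theorem two_pow_mul_xor (k a b : ℕ) : 2 ^ k * (a ^^^ b) = 2 ^ k * a ^^^ 2 ^ k * b := by
  simp only [mul_comm (2 ^ k), ← Nat.shiftLeft_eq, Nat.shiftLeft_xor_distrib]

theorem app_map_mul (k : ℕ) (T : List ℕ) (x : ℕ) :
    app (T.map (2 ^ k * ·)) x = 2 ^ k * app T x := by
  induction T generalizing x with
  | nil => simp [app_nil]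
  | cons t T ih =>
    rw [List.map_cons, app_cons, app_cons, ih, two_pow_mul_xor]
    split_ifs <;> simp

theorem length_act (j : Fin 7) (g : QGen) : (act j g).length = dim j := by
  revert j
  cases g <;> decide +kernel

theorem actL_lt (l : List (Fin 7)) (g : QGen) : ∀ t ∈ actL l g, t < 2 ^ dimL l := by
  induction l with
  | nil => simp [actL]
  | cons j l ih =>
    intro t ht
    rw [actL, List.mem_append, List.mem_map] at ht
    rw [dimL, pow_add]
    rcases ht with ht | ⟨t, ht, rfl⟩
    · exact (act_lt j g t ht).trans_le (Nat.le_mul_of_pos_right _ (by positivity))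
    · exact Nat.mul_lt_mul_of_pos_left (ih t ht) (by positivity)

theorem dec_act (l : List (Fin 7)) (g : QGen) (x : ℕ) :
    dec l (app (actL l g) x) = MulOpposite.op (gen g) • dec l x := by
  induction l generalizing x with
  | nil => rfl
  | cons j l ih =>
    have h1 : app (act j g) x < 2 ^ dim j := app_lt (act_lt j g) x
    have e : app (actL (j :: l) g) x =
        app (act j g) x ^^^ 2 ^ dim j * app (actL l g) (x / 2 ^ dim j) := by
      rw [actL, app_append, length_act, app_map_mul]
    rw [e]
    refine Prod.ext ?_ ?_
    · refine XorVec.ext ?_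
      change (app (act j g) x ^^^ 2 ^ dim j * app (actL l g) (x / 2 ^ dim j)) % 2 ^ dim j =
        (MulOpposite.op (gen g) • (dec (j :: l) x).1 : X j).1
      rw [gen_smul, Nat.xor_mod_two_pow, Nat.mul_mod_right, Nat.xor_zero, Nat.mod_eq_of_lt h1]
      change _ = app (act j g) (x % 2 ^ dim j)
      rw [← length_act j g, app_mod]
    · change dec l ((app (act j g) x ^^^ 2 ^ dim j * app (actL l g) (x / 2 ^ dim j)) / 2 ^ dim j) =
        MulOpposite.op (gen g) • dec l (x / 2 ^ dim j)
      rw [Nat.xor_div_two_pow, Nat.div_eq_of_lt h1, Nat.mul_div_cancel_left _ (by positivity),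
        Nat.zero_xor, ih]

theorem dec_actWord (l : List (Fin 7)) (w : List QGen) (x : ℕ) :
    dec l (actWord (actL l) x w) = MulOpposite.op (wordA w) • dec l x := by
  induction w generalizing x with
  | nil => simp [actWord, wordA]
  | cons g w ih =>
    rw [op_wordA_cons, ← dec_act, ← ih]
    rfl

theorem actWord_lt (l : List (Fin 7)) (w : List QGen) {x : ℕ} (hx : x < 2 ^ dimL l) :
    actWord (actL l) x w < 2 ^ dimL l := by
  induction w generalizing x with
  | nil => exact hx
  | cons g w ih => exact ih (app_lt (actL_lt l g) x)

theorem isTestElt_dec {l : List (Fin 7)} {j : Fin 7} {z : ℕ}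
    (h : isTest (dimL l) (actL l) j z = true) : IsTestElt j (dec l z) := by
  simp only [isTest, Bool.and_eq_true, beq_iff_eq] at h
  refine ⟨?_, ?_⟩
  · rw [← dec_act, h.1.2]
  · rw [← dec_actWord, h.2, dec_zero]

theorem exists_homL (l' l : List (Fin 7)) (zs : List ℕ)
    (h : validMap (dimL l') (actL l') l zs = true) :
    ∃ f : Obj l →ₗ[AlgOp] Obj l', ∀ x, f (dec l x) = dec l' (app (table (actL l') l zs) x) := by
  induction l generalizing zs with
  | nil => exact ⟨0, fun x => by simp [table, app_nil, dec_zero]⟩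
  | cons j l ih =>
    cases zs with
    | nil => simp [validMap] at h
    | cons z zs =>
      simp only [validMap, List.length_cons, Bool.and_eq_true, beq_iff_eq, List.zip_cons_cons,
        List.all_cons, Nat.add_right_cancel_iff] at h
      obtain ⟨f, hf⟩ := ih zs (by simp [validMap, h.1, h.2.2])
      let g : Obj (j :: l) →ₗ[AlgOp] Obj l' :=
        LinearMap.coprod (liftX j (dec l' z) (isTestElt_dec h.2.1)) f
      refine ⟨g, fun x => ?_⟩
      have hl : ((wordsOf j).map (actWord (actL l') z)).length = dim j := by
        rw [List.length_map, length_wordsOf]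
      rw [table, app_append, hl, dec_xor, ← hf,
        map_app (dec l') (dec_zero l') (dec_xor l')]
      change comb (wordMultiples j (dec l' z)) (x % 2 ^ dim j) + f (dec l (x / 2 ^ dim j)) = _
      congr 1
      have : wordMultiples j (dec l' z) = ((wordsOf j).map (actWord (actL l') z)).map (dec l') := by
        simp [wordMultiples, dec_actWord]
      rw [← this]
      conv_rhs => rw [← comb_mod]
      rw [wordMultiples, List.length_map, length_wordsOf]

open Classical in
/-- The homomorphism which sends the generators of the summands to the elements with the codes
`zs`. -/
noncomputable def homL (l' l : List (Fin 7)) (zs : List ℕ) : Obj l →ₗ[AlgOp] Obj l' :=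
  if h : validMap (dimL l') (actL l') l zs = true then (exists_homL l' l zs h).choose else 0

theorem homL_dec {l' l : List (Fin 7)} {zs : List ℕ}
    (h : validMap (dimL l') (actL l') l zs = true) (x : ℕ) :
    homL l' l zs (dec l x) = dec l' (app (table (actL l') l zs) x) := by
  rw [homL, dif_pos h]
  exact (exists_homL l' l zs h).choose_spec x

theorem app_range {F : ℕ → ℕ} (h0 : F 0 = 0) (hF : ∀ x y, F (x ^^^ y) = F x ^^^ F y) {n x : ℕ}
    (hx : x < 2 ^ n) : app ((List.range n).map fun q => F (2 ^ q)) x = F x := by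
  refine code_induction (P := fun x => app ((List.range n).map fun q => F (2 ^ q)) x = F x)
    (by rw [app_zero, h0]) (fun x y hx hy => by rw [app_xor, hx, hy, hF]) (fun q hq => ?_) hx
  rw [app_two_pow]
  simp [hq]

theorem app_mem {P : ℕ → Prop} (h0 : P 0) (hx : ∀ x y, P x → P y → P (x ^^^ y)) {T : List ℕ}
    (hT : ∀ t ∈ T, P t) (x : ℕ) : P (app T x) := by
  induction T generalizing x with
  | nil => exact h0
  | cons t T ih =>
    rw [app_cons]
    refine hx _ _ ?_ (ih (fun t ht => hT t (by simp [ht])) _)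
    split_ifs
    · exact hT t (by simp)
    · exact h0

theorem mem_of_testKer {l l' : List (Fin 7)} {j : Fin 7} {T : List ℕ} {P : ℕ → Prop} (h0 : P 0)
    (hx : ∀ x y, P x → P y → P (x ^^^ y))
    (hP : ∀ z ∈ testKer (dimL l) (dimL l') (actL l) j T, P z) {x : ℕ} (hn : x < 2 ^ dimL l)
    (ht : IsTestElt j (dec l x)) (hT : dec l' (app T x) = 0) : P x := by
  rw [testKer, forcePairs_eq] at hP
  have := kerBasis_sound h0 hx _ _ (by simp) hP x ?_
  · rw [List.map_map] at this
    have e := app_range (F := id) rfl (fun _ _ => rfl) hn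
    exact (congrArg P e).mp this
  · rw [List.map_map]
    refine (app_range (F := fun z => (app (actL l (topOf j)) z ^^^ z) ^^^
      (2 ^ dimL l * actWord (actL l) z (relOf j) ^^^
        2 ^ dimL l * (2 ^ dimL l * (app T z % 2 ^ dimL l')))) ?_ (fun x y => ?_) hn).trans ?_
    · simp [app_zero, actWord_zero]
    · simp only [app_xor, actWord_xor, Nat.xor_mod_two_pow, two_pow_mul_xor]
      ac_rfl
    · have e1 : app (actL l (topOf j)) x ^^^ x = 0 :=
        eq_of_dec_eq (app_lt (actL_lt l _) x) hn (by rw [dec_act, ht.1])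
      have e2 : actWord (actL l) x (relOf j) = 0 := by
        rw [← Nat.mod_eq_of_lt (actWord_lt l (relOf j) hn)]
        refine mod_eq_zero_of_dec ?_
        rw [dec_actWord, ht.2]
      simp only [e1, e2, mod_eq_zero_of_dec hT]
      simp

section Complexes

variable (c : List (List (Fin 7) × List ℕ))

/-- The direct sum at the `k`-th position of a complex. -/
abbrev cObj (k : ℕ) : Type := Obj (c.getD k ([], [])).1

/-- The differential of a complex. -/
noncomputable def diff (k : ℕ) : cObj c (k + 1) →ₗ[AlgOp] cObj c k :=
  homL _ _ (c.getD (k + 1) ([], [])).2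

variable {c} {k : ℕ} (h : complexOK c k = true)

include h

theorem diff_dec (x : ℕ) : diff c k (dec _ x) = dec _ (app (table (actL (c.getD k ([], [])).1)
    (c.getD (k + 1) ([], [])).1 (c.getD (k + 1) ([], [])).2) x) := by
  simp only [complexOK, forceNat_eq, forceList_eq, forceAct_eq, Bool.and_eq_true] at h
  exact homL_dec h.1.1.1 x

theorem diff_succ_dec (x : ℕ) : diff c (k + 1) (dec _ x) =
    dec _ (app (table (actL (c.getD (k + 1) ([], [])).1)
    (c.getD (k + 2) ([], [])).1 (c.getD (k + 2) ([], [])).2) x) := by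
  simp only [complexOK, forceNat_eq, forceList_eq, forceAct_eq, Bool.and_eq_true] at h
  exact homL_dec h.1.1.2 x

theorem diff_diff (y : cObj c (k + 2)) : diff c k (diff c (k + 1) y) = 0 := by
  obtain ⟨x, -, rfl⟩ := exists_dec y
  rw [diff_succ_dec h, diff_dec h]
  simp only [complexOK, forceNat_eq, forceList_eq, forceAct_eq, Bool.and_eq_true,
    List.all_eq_true, beq_iff_eq] at h
  rw [app_mem (P := fun z => app (table (actL (c.getD k ([], [])).1)
    (c.getD (k + 1) ([], [])).1 (c.getD (k + 1) ([], [])).2) z = 0) (app_zero _)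
    (fun x y hx hy => by rw [app_xor, hx, hy, Nat.xor_self]) h.1.2, dec_zero]

theorem exists_of_diff_eq_zero {j : Fin 7} {y : cObj c (k + 1)} (hy : IsTestElt j y)
    (hd : diff c k y = 0) : ∃ z : cObj c (k + 2), IsTestElt j z ∧ diff c (k + 1) z = y := by
  obtain ⟨x, hx, rfl⟩ := exists_dec y
  rw [diff_dec h] at hd
  have hs := diff_succ_dec h
  simp only [complexOK, exactAt, forceNat_eq, forceList_eq, forceAct_eq, Bool.and_eq_true,
    List.all_eq_true] at h
  have hj := h.2 j (List.mem_finRange j)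
  let P : ℕ → Prop := fun x => ∃ z : cObj c (k + 2), IsTestElt j z ∧ diff c (k + 1) z = dec _ x
  have h0 : P 0 := ⟨0, ⟨by simp, by simp⟩, by simp [dec_zero]⟩
  have hx' : ∀ x y, P x → P y → P (x ^^^ y) := by
    rintro x y ⟨u, hu, hx⟩ ⟨v, hv, hy⟩
    exact ⟨u + v, ⟨by rw [smul_add, hu.1, hv.1], by rw [smul_add, hu.2, hv.2, add_zero]⟩,
      by rw [map_add, hx, hy, dec_xor]⟩
  refine mem_of_testKer h0 hx' (allInSpan_sound h0 hx' _ _ _ hj.2 ?_) hx hy hd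
  intro z hz
  obtain ⟨t, ht, rfl⟩ := List.mem_map.1 hz
  exact ⟨dec _ t, isTestElt_dec (hj.1 t ht), hs t⟩

end Complexes

/-! ### The functor represented by a module -/

/-- Homomorphisms out of `M`, as a right module over the endomorphism ring of `M`. -/
def HomFrom (M Y : Type) [AddCommGroup M] [Module AlgOp M] [AddCommGroup Y] [Module AlgOp Y] : Type :=
  M →ₗ[AlgOp] Y

namespace HomFrom

variable {M : Type} [AddCommGroup M] [Module AlgOp M] {Y Z W : Type} [AddCommGroup Y]
  [Module AlgOp Y] [AddCommGroup Z] [Module AlgOp Z] [AddCommGroup W] [Module AlgOp W]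

noncomputable instance : AddCommGroup (HomFrom M Y) := inferInstanceAs (AddCommGroup (M →ₗ[AlgOp] Y))

instance : FunLike (HomFrom M Y) M Y := inferInstanceAs (FunLike (M →ₗ[AlgOp] Y) M Y)

instance : AddMonoidHomClass (HomFrom M Y) M Y :=
  inferInstanceAs (AddMonoidHomClass (M →ₗ[AlgOp] Y) M Y)

instance [Finite M] [Finite Y] : Finite (HomFrom M Y) := DFunLike.finite _

/-- The opposite of the endomorphism ring of `M`. -/
abbrev EndOp (M : Type) [AddCommGroup M] [Module AlgOp M] : Type := (Module.End AlgOp M)ᵐᵒᵖ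

noncomputable instance : Module (EndOp M) (HomFrom M Y) where
  smul b φ := LinearMap.comp φ b.unop
  one_smul φ := LinearMap.comp_id (M₂ := M) φ
  mul_smul a b φ := (LinearMap.comp_assoc a.unop b.unop (φ : M →ₗ[AlgOp] Y)).symm
  smul_zero _ := LinearMap.zero_comp (M := M) _
  smul_add _ _ _ := LinearMap.add_comp (M := M) _ _ _
  add_smul _ _ _ := LinearMap.comp_add (M := M) _ _ _
  zero_smul _ := LinearMap.comp_zero (M := M) _

/-- Composition with a homomorphism. -/
noncomputable def map (f : Y →ₗ[AlgOp] Z) : HomFrom M Y →ₗ[EndOp M] HomFrom M Z where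
  toFun φ := f.comp φ
  map_add' _ _ := LinearMap.comp_add (M := M) _ _ _
  map_smul' _ _ := rfl

theorem map_apply (f : Y →ₗ[AlgOp] Z) (φ : HomFrom M Y) (m : M) : map f φ m = f (φ m) := rfl

theorem add_apply (φ ψ : HomFrom M Y) (m : M) : (φ + ψ) m = φ m + ψ m := rfl

@[ext] theorem ext {φ ψ : HomFrom M Y} (h : ∀ m, φ m = ψ m) : φ = ψ := LinearMap.ext h

theorem map_smul_apply (φ : HomFrom M Y) (a : AlgOp) (m : M) : φ (a • m) = a • φ m :=
  LinearMap.map_smul φ a m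

variable (M) in
/-- The regular module is represented by `M` itself. -/
noncomputable def selfEquiv : EndOp M ≃ₗ[EndOp M] HomFrom M M where
  toFun b := b.unop
  invFun φ := MulOpposite.op φ
  map_add' _ _ := rfl
  map_smul' _ _ := rfl

/-- An additive splitting of a product. -/
noncomputable def prodEquiv : HomFrom M (Y × Z) ≃ₗ[EndOp M] HomFrom M Y × HomFrom M Z where
  toFun φ := (map (LinearMap.fst AlgOp Y Z) φ, map (LinearMap.snd AlgOp Y Z) φ)
  invFun p := LinearMap.prod p.1 p.2
  map_add' _ _ := rfl
  map_smul' _ _ := rfl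

theorem projective_of_retract {R P Q : Type} [Ring R] [AddCommGroup P] [Module R P]
    [AddCommGroup Q] [Module R Q] [Module.Projective R P] (i : Q →ₗ[R] P) (r : P →ₗ[R] Q)
    (h : ∀ x, r (i x) = x) : Module.Projective R Q :=
  Module.Projective.of_split i r (LinearMap.ext h)

end HomFrom

open HomFrom

section Decomposition

variable {M : Type} [AddCommGroup M] [Module AlgOp M] (e : M ≃ₗ[AlgOp] ∀ i, X i)

/-- The projection to a summand. -/
noncomputable def prX (i : Fin 7) : M →ₗ[AlgOp] X i := (LinearMap.proj i).comp e.toLinearMap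

/-- The inclusion of a summand. -/
noncomputable def inX (i : Fin 7) : X i →ₗ[AlgOp] M :=
  e.symm.toLinearMap.comp (LinearMap.single AlgOp X i)

theorem prX_inX (i : Fin 7) (x : X i) : prX e i (inX e i x) = x := by
  simp [prX, inX]

theorem prX_inX_of_ne {i j : Fin 7} (h : i ≠ j) (x : X j) : prX e i (inX e j x) = 0 := by
  simp [prX, inX, h]

theorem sum_inX_prX (m : M) : ∑ i, inX e i (prX e i m) = m := by
  have : e.symm (∑ i, Pi.single i (e m i)) = m := by
    rw [Finset.univ_sum_single]
    exact e.symm_apply_apply m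
  rw [map_sum] at this
  exact this

/-- The element of `M` given by the generator of a summand. -/
noncomputable def gM (i : Fin 7) : M := inX e i (gX i)

theorem isTestElt_gM (i : Fin 7) : IsTestElt i (gM e i) := (isTestElt_gX i).map _

section

variable {Y Z W : Type} [AddCommGroup Y]
  [Module AlgOp Y] [AddCommGroup Z] [Module AlgOp Z] [AddCommGroup W] [Module AlgOp W]

theorem homFrom_ext {φ ψ : HomFrom M Y} (h : ∀ i, φ (gM e i) = ψ (gM e i)) : φ = ψ := by
  have (i : Fin 7) : (φ : M →ₗ[AlgOp] Y).comp (inX e i) = (ψ : M →ₗ[AlgOp] Y).comp (inX e i) :=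
    hom_ext (h i)
  refine HomFrom.ext fun m => ?_
  rw [← sum_inX_prX e m, map_sum, map_sum]
  exact Finset.sum_congr rfl fun i _ => LinearMap.congr_fun (this i) _

/-- The homomorphism with given values at the generators of the summands. -/
noncomputable def assemble (y : Fin 7 → Y) (hy : ∀ i, IsTestElt i (y i)) : HomFrom M Y :=
  ∑ i, (liftX i (y i) (hy i)).comp (prX e i)

theorem assemble_gM (y : Fin 7 → Y) (hy : ∀ i, IsTestElt i (y i)) (j : Fin 7) :
    assemble e y hy (gM e j) = y j := by
  change (∑ i, (liftX i (y i) (hy i)).comp (prX e i)) (inX e j (gX j)) = y j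
  rw [LinearMap.sum_apply, Finset.sum_eq_single j]
  · rw [LinearMap.comp_apply, prX_inX, liftX_gX]
  · intro i _ hi
    rw [LinearMap.comp_apply, prX_inX_of_ne e hi, map_zero]
  · simp

theorem isTestElt_apply (φ : HomFrom M Y) (i : Fin 7) : IsTestElt i (φ (gM e i)) :=
  (isTestElt_gM e i).map φ

include e in
theorem map_exact {f : Y →ₗ[AlgOp] Z} {g : W →ₗ[AlgOp] Y} (h0 : ∀ w, f (g w) = 0)
    (h : ∀ j y, IsTestElt j y → f y = 0 → ∃ w, IsTestElt j w ∧ g w = y) :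
    Function.Exact (map (M := M) g) (map (M := M) f) := by
  intro φ
  constructor
  · intro hφ
    choose w hw hg using fun j => h j (φ (gM e j)) (isTestElt_apply e φ j)
      (congrArg (fun ψ : HomFrom M Z => ψ (gM e j)) hφ)
    refine ⟨assemble e w hw, homFrom_ext e fun j => ?_⟩
    rw [map_apply, assemble_gM, hg]
  · rintro ⟨ψ, rfl⟩
    exact HomFrom.ext fun m => h0 _

include e in
theorem projective_homFrom_X (i : Fin 7) : Module.Projective (EndOp M) (HomFrom M (X i)) := by
  have : Module.Projective (EndOp M) (HomFrom M M) := Module.Projective.of_equiv (selfEquiv M)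
  exact projective_of_retract (map (inX e i)) (map (prX e i)) fun φ =>
    HomFrom.ext fun m => prX_inX e i _

include e in
theorem projective_homFrom_Obj (l : List (Fin 7)) :
    Module.Projective (EndOp M) (HomFrom M (Obj l)) := by
  induction l with
  | nil =>
    have : Subsingleton (HomFrom M (Obj [])) :=
      ⟨fun φ ψ => HomFrom.ext fun m => Subsingleton.elim (α := PUnit) _ _⟩
    infer_instance
  | cons j l ih =>
    have := projective_homFrom_X e j
    exact Module.Projective.of_equiv (prodEquiv (M := M) (Y := X j) (Z := Obj l)).symm

end

end Decomposition

/-! ### Radicals of the indecomposable projectives over the endomorphism ring -/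

/-- Checks that at the `j`-th object the image of the first differential of the resolution of the
`i`-th module has index at most two, and consists of even codes for `j = i`. -/
def topCheck (i j : Fin 7) : Bool :=
  let a := (resolutionOf i).getD 0 ([], [])
  let b := (resolutionOf i).getD 1 ([], [])
  forceNat (dimL a.1) fun n₀ => forceNat (dimL b.1) fun n₁ =>
  forceAct (actL a.1) fun A₀ => forceAct (actL b.1) fun A₁ =>
  forceList (table A₀ b.1 b.2) fun T =>
  forceList (testKer n₁ 0 A₁ j []) fun ts => forceList (testKer n₀ 0 A₀ j []) fun ks =>
  forceList (ts.map (app T)) fun zs =>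
    ts.all (isTest n₁ A₁ j) && allInSpan (zs.length + 1) (zs ++ if j = i then [1] else []) ks &&
    (decide (j ≠ i) || zs.all (· % 2 == 0))

theorem topCheck_all : ∀ i j : Fin 7, topCheck i j = true := by decide +kernel

theorem resolutionOf_zero : ∀ i : Fin 7, ((resolutionOf i).getD 0 ([], [])).1 = [i] := by decide +kernel

theorem exists_equiv_Obj {i : Fin 7} {l : List (Fin 7)} (h : l = [i]) :
    ∃ u : X i ≃ₗ[AlgOp] Obj l, ∀ x : X i, u x = dec l x.1 := by
  subst h
  refine ⟨(LinearEquiv.prodUnique (R := AlgOp) (M := X i) (M₂ := PUnit)).symm, fun x => ?_⟩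
  refine Prod.ext (XorVec.ext ?_) rfl
  exact (Nat.mod_eq_of_lt x.2).symm

/-- The identification of the `i`-th module with the start of its resolution. -/
noncomputable def startEquiv (i : Fin 7) : X i ≃ₗ[AlgOp] cObj (resolutionOf i) 0 :=
  (exists_equiv_Obj (resolutionOf_zero i)).choose

theorem startEquiv_apply (i : Fin 7) (x : X i) : startEquiv i x = dec _ x.1 :=
  (exists_equiv_Obj (resolutionOf_zero i)).choose_spec x

theorem complexOK_resolution (i : Fin 7) {k : ℕ} (hk : k < 4) : complexOK (resolutionOf i) k = true :=
  List.all_eq_true.1 (complexOK_resolutionOf i) k (List.mem_range.2 hk)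

theorem exists_of_isTestElt_start (i j : Fin 7) {y : cObj (resolutionOf i) 0} (hy : IsTestElt j y) :
    ∃ w : cObj (resolutionOf i) 1, IsTestElt j w ∧ (diff (resolutionOf i) 0 w = y ∨
      j = i ∧ diff (resolutionOf i) 0 w + dec _ 1 = y) := by
  have hd := diff_dec (complexOK_resolution i (k := 0) (by norm_num))
  have h := topCheck_all i j
  obtain ⟨x, hx, rfl⟩ := exists_dec y
  simp only [topCheck, forceNat_eq, forceList_eq, forceAct_eq, Bool.and_eq_true] at h
  let P : ℕ → Prop := fun x => ∃ w : cObj (resolutionOf i) 1, IsTestElt j w ∧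
    (diff (resolutionOf i) 0 w = dec _ x ∨ j = i ∧ diff (resolutionOf i) 0 w + dec _ 1 = dec _ x)
  have h0 : P 0 := ⟨0, ⟨by simp, by simp⟩, Or.inl (by simp [dec_zero])⟩
  have hx' : ∀ x y, P x → P y → P (x ^^^ y) := by
    rintro x y ⟨u, hu, hx⟩ ⟨v, hv, hy⟩
    refine ⟨u + v, ⟨by rw [smul_add, hu.1, hv.1], by rw [smul_add, hu.2, hv.2, add_zero]⟩, ?_⟩
    rw [map_add, dec_xor]
    rcases hx with hx | ⟨hi, hx⟩ <;> rcases hy with hy | ⟨hi, hy⟩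
    · exact Or.inl (by rw [hx, hy])
    · exact Or.inr ⟨hi, by rw [hx, ← hy, add_assoc]⟩
    · exact Or.inr ⟨hi, by rw [hy, ← hx, add_right_comm]⟩
    · exact Or.inl (by rw [← hx, ← hy, add_add_add_comm, add_self_eq_zero, add_zero])
  refine mem_of_testKer (l' := []) (T := []) h0 hx' (allInSpan_sound h0 hx' _ _ _ h.1.2 ?_) hx hy rfl
  intro z hz
  rcases List.mem_append.1 hz with hz | hz
  · obtain ⟨t, ht, rfl⟩ := List.mem_map.1 hz
    exact ⟨dec _ t, isTestElt_dec (List.all_eq_true.1 h.1.1 t ht), Or.inl (hd t)⟩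
  · split_ifs at hz with hi
    · obtain rfl := List.mem_singleton.1 hz
      exact ⟨0, ⟨by simp, by simp⟩, Or.inr ⟨hi, by simp⟩⟩
    · simp at hz

theorem diff_even (i : Fin 7) {w : cObj (resolutionOf i) 1} (hw : IsTestElt i w) :
    ∃ x, x % 2 = 0 ∧ diff (resolutionOf i) 0 w = dec _ x := by
  have hd := diff_dec (complexOK_resolution i (k := 0) (by norm_num))
  have h := topCheck_all i i
  obtain ⟨x, hx, rfl⟩ := exists_dec w
  simp only [topCheck, forceNat_eq, forceList_eq, forceAct_eq, Bool.and_eq_true] at h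
  refine ⟨_, ?_, hd x⟩
  have hz := h.2
  simp only [ne_eq, not_true_eq_false, decide_false, Bool.false_or] at hz
  refine mem_of_testKer (l' := []) (j := i) (T := []) (P := fun x => app (table
    (actL ((resolutionOf i).getD 0 ([], [])).1) ((resolutionOf i).getD 1 ([], [])).1
      ((resolutionOf i).getD 1 ([], [])).2) x % 2 = 0) (by simp [app_zero])
    (fun x y hx hy => by rw [app_xor, mod_two_xor, hx, hy]; rfl) (fun z hzk => ?_) hx hw rfl
  exact eq_of_beq (List.all_eq_true.1 hz _ (List.mem_map_of_mem hzk))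

/-- The first differential of the resolution of the `i`-th module. -/
noncomputable def radX (i : Fin 7) : cObj (resolutionOf i) 1 →ₗ[AlgOp] X i :=
  (startEquiv i).symm.toLinearMap.comp (diff (resolutionOf i) 0)

theorem startEquiv_radX (i : Fin 7) (w : cObj (resolutionOf i) 1) :
    startEquiv i (radX i w) = diff (resolutionOf i) 0 w := by
  simp [radX]

theorem radX_even (i : Fin 7) {w : cObj (resolutionOf i) 1} (hw : IsTestElt i w) :
    (radX i w).1 % 2 = 0 := by
  obtain ⟨x, hx, he⟩ := diff_even i hw
  rw [← startEquiv_radX, startEquiv_apply] at he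
  have h0 : dec ((resolutionOf i).getD 0 ([], [])).1 ((radX i w).1 ^^^ x) = 0 := by
    rw [dec_xor, he, add_self_eq_zero]
  have h1 := mod_eq_zero_of_dec h0
  have h2 : ((radX i w).1 ^^^ x) % 2 = 0 := by
    have : 0 < dimL ((resolutionOf i).getD 0 ([], [])).1 := by
      rw [resolutionOf_zero]
      exact (zero_lt_dim i).trans_le (Nat.le_add_right _ _)
    exact Nat.mod_eq_zero_of_dvd ((dvd_pow_self 2 this.ne').trans (Nat.dvd_of_mod_eq_zero h1))
  have h3 : (radX i w).1 = ((radX i w).1 ^^^ x) ^^^ x := by simp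
  rw [h3, mod_two_xor, h2, hx]
  rfl

theorem actWord_mod : ∀ i : Fin 7, ∀ p < dim i, 1 ≤ p → ∀ q < dim i,
    actWord (act i) (2 ^ p) ((wordsOf i).getD q []) % 2 ^ (q + 1) = 0 := by decide +kernel

theorem actWord_even_mod (i : Fin 7) {q : ℕ} (hq : q < dim i) (x : X i) (hx : x.1 % 2 = 0) :
    actWord (act i) x.1 ((wordsOf i).getD q []) % 2 ^ (q + 1) = 0 := by
  obtain ⟨k, hk⟩ : ∃ k, dim i = k + 1 := ⟨dim i - 1, by have := zero_lt_dim i; omega⟩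
  have e : x.1 = 2 ^ 1 * (x.1 / 2) := by omega
  rw [e]
  refine code_induction (n := k)
    (P := fun z => actWord (act i) (2 ^ 1 * z) ((wordsOf i).getD q []) % 2 ^ (q + 1) = 0)
    (by simp [actWord_zero]) (fun x y hx hy => ?_) (fun p hp => ?_) ?_
  · rw [two_pow_mul_xor, actWord_xor, Nat.xor_mod_two_pow, hx, hy, Nat.xor_self]
  · rw [← pow_add]
    exact actWord_mod i _ (by omega) (by omega) q hq
  · have h1 : x.1 < 2 ^ dim i := x.2
    have h2 : 2 ^ dim i = 2 * 2 ^ k := by rw [hk, pow_succ, mul_comm]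
    omega

theorem app_mod_two_pow {T : List ℕ} (hT : ∀ q, T.getD q 0 % 2 ^ (q + 1) = 0) {q x : ℕ}
    (hx : x % 2 ^ q = 0) : app T x % 2 ^ (q + 1) = 0 := by
  obtain ⟨z, rfl⟩ := Nat.dvd_of_mod_eq_zero hx
  refine code_induction (n := z) (P := fun z => app T (2 ^ q * z) % 2 ^ (q + 1) = 0)
    (by simp [app_zero]) (fun x y hx hy => ?_) (fun p hp => ?_) Nat.lt_two_pow_self
  · rw [two_pow_mul_xor, app_xor, Nat.xor_mod_two_pow, hx, hy, Nat.xor_self]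
  · rw [← pow_add, app_two_pow]
    exact Nat.mod_eq_zero_of_dvd ((pow_dvd_pow 2 (by omega)).trans (Nat.dvd_of_mod_eq_zero (hT _)))

theorem eq_zero_of_fixed (i : Fin 7) (f : X i →ₗ[AlgOp] X i) (hf : (f (gX i)).1 % 2 = 0) {x : X i}
    (hx : f x = x) : x = 0 := by
  have key (q : ℕ) : x.1 % 2 ^ q = 0 := by
    induction q with
    | zero => simp [Nat.mod_one]
    | succ q ih =>
      have e : (f x).1 = app ((wordsOf i).map (actWord (act i) (f (gX i)).1)) x.1 := by
        rw [hom_apply f x]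
        have hv : ∀ (T : List (X i)) (z : ℕ), (comb T z).1 = app (T.map fun x => x.1) z := by
          intro T
          induction T with
          | nil => intro z; rfl
          | cons t T ih =>
            intro z
            rw [List.map_cons, app_cons, ← ih, comb]
            split_ifs <;> rfl
        rw [hv, wordMultiples, List.map_map]
        congr 1
        exact List.map_congr_left fun w _ => wordA_smul i w _
      rw [← hx, e]
      refine app_mod_two_pow (fun p => ?_) ih
      by_cases hp : p < dim i
      · have : p < (wordsOf i).length := by rwa [length_wordsOf]
        have h1 := actWord_even_mod i hp _ hf
        simpa [this] using h1
      · have : ¬ p < (wordsOf i).length := by rwa [length_wordsOf]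
        simp [this]
  have h1 := key (dim i)
  rw [Nat.mod_eq_of_lt x.2] at h1
  exact XorVec.ext h1

/-! ### Projective dimension -/

section ProjectiveDimension

variable {R : Type} [Ring R]

/-- The module `Y` has projective dimension less than `n`. -/
def PDLT (R Y : Type) [Ring R] [AddCommGroup Y] [Module R Y] (n : ℕ) : Prop :=
  HasProjectiveDimensionLT (ModuleCat.of R Y) n

variable {P Y Z : Type} [AddCommGroup P] [Module R P] [AddCommGroup Y] [Module R Y]
  [AddCommGroup Z] [Module R Z]

theorem PDLT.of_equiv {n : ℕ} (h : PDLT R Y n) (e : Y ≃ₗ[R] Z) : PDLT R Z n :=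
  have : HasProjectiveDimensionLT (ModuleCat.of R Y) n := h
  hasProjectiveDimensionLT_of_iso e.toModuleIso n

theorem PDLT.mono {m n : ℕ} (h : PDLT R Y m) (hmn : m ≤ n) : PDLT R Y n :=
  have : HasProjectiveDimensionLT (ModuleCat.of R Y) m := h
  hasProjectiveDimensionLT_of_ge _ m n hmn

theorem pdlt_one_iff : PDLT R Y 1 ↔ Module.Projective R Y := by
  rw [PDLT, ← projective_iff_hasProjectiveDimensionLT_one, IsProjective.iff_projective]

theorem pdlt_of_subsingleton [Subsingleton Y] (n : ℕ) : PDLT R Y n :=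
  PDLT.mono (m := 0) (ModuleCat.isZero_of_subsingleton (ModuleCat.of R Y)).hasProjectiveDimensionLT_zero
    (Nat.zero_le n)

theorem pdlt_succ_iff [Module.Projective R P] {f : P →ₗ[R] Y} (hf : Function.Surjective f)
    (n : ℕ) : PDLT R Y (n + 2) ↔ PDLT R (LinearMap.ker f) (n + 1) :=
  (LinearMap.shortExact_shortComplexKer hf).hasProjectiveDimensionLT_X₃_iff n
    ((IsProjective.iff_projective P).1 ‹_›)

theorem PDLT.extension {n : ℕ} (N : Submodule R Y) (h : PDLT R N n) (h' : PDLT R (Y ⧸ N) n) :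
    PDLT R Y n := by
  refine (LinearMap.shortExact_shortComplexKer N.mkQ_surjective).hasProjectiveDimensionLT_X₂ n ?_ h'
  exact PDLT.of_equiv h (LinearEquiv.ofEq _ _ N.ker_mkQ.symm)

theorem pdlt_range_iff [Module.Projective R P] {f : P →ₗ[R] Y} (n : ℕ) :
    PDLT R (LinearMap.range f) (n + 2) ↔ PDLT R (LinearMap.ker f) (n + 1) := by
  rw [pdlt_succ_iff f.surjective_rangeRestrict, LinearMap.ker_rangeRestrict]

theorem projDimLE_iff (X : ModuleCat.{0} R) (m : ℕ) : ProjDimLE R X m ↔ PDLT R X (m + 1) := by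
  induction m generalizing X with
  | zero =>
    rw [pdlt_one_iff]
    constructor
    · rintro ⟨P, d, ε, hP, h0, hs, he, -⟩
      have := hP 0 le_rfl
      have := h0 1 one_pos
      have hi : Function.Injective ε := by
        refine (injective_iff_map_eq_zero ε.hom).2 fun x hx => ?_
        obtain ⟨y, rfl⟩ := (he x).1 hx
        rw [Subsingleton.elim y 0]
        exact map_zero (d 0).hom
      exact Module.Projective.of_equiv (LinearEquiv.ofBijective ε.hom ⟨hi, hs⟩)
    · intro h
      refine ⟨fun i => i.casesOn X fun _ => ModuleCat.of R PUnit, fun _ => 0, 𝟙 X, ?_, ?_,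
        fun x => ⟨x, rfl⟩, ?_, ?_⟩
      · intro i hi
        obtain rfl := Nat.le_zero.1 hi
        exact h
      · rintro (_ | i) hi
        · exact absurd hi (lt_irrefl _)
        · exact inferInstanceAs (Subsingleton PUnit)
      · intro x
        exact ⟨fun hx => ⟨0, hx.symm⟩, fun ⟨y, hy⟩ => hy.symm⟩
      · exact fun i x => ⟨fun _ => ⟨0, rfl⟩, fun _ => rfl⟩
  | succ m ih =>
    constructor
    · rintro ⟨P, d, ε, hP, h0, hs, he, hd⟩
      have := hP 0 (Nat.zero_le _)
      refine (pdlt_succ_iff (f := ε.hom) hs m).2 ?_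
      have hr (y : P 1) : (d 0) y ∈ LinearMap.ker ε.hom := (he _).2 ⟨y, rfl⟩
      refine (ih (ModuleCat.of R (LinearMap.ker ε.hom))).1 ⟨fun i => P (i + 1), fun i => d (i + 1),
        ModuleCat.ofHom (LinearMap.codRestrict _ (d 0).hom hr), fun i hi => hP _ (by omega),
        fun i hi => h0 _ (by omega), ?_, ?_, fun i => hd (i + 1)⟩
      · rintro ⟨x, hx⟩
        obtain ⟨y, rfl⟩ := (he x).1 hx
        exact ⟨y, rfl⟩
      · intro y
        refine Iff.trans ⟨fun h => ?_, fun h => ?_⟩ (hd 0 y)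
        · exact congrArg Subtype.val h
        · exact Subtype.ext h
    · intro h
      let F := X →₀ R
      let f : F →ₗ[R] X := Finsupp.linearCombination R id
      have hf : Function.Surjective f := Finsupp.linearCombination_id_surjective R X
      obtain ⟨P, d, ε, hP, h0, hs, he, hd⟩ :=
        (ih (ModuleCat.of R (LinearMap.ker f))).2 ((pdlt_succ_iff hf m).1 h)
      refine ⟨fun i => i.casesOn (ModuleCat.of R F) P,
        fun i => i.casesOn (ε ≫ ModuleCat.ofHom (LinearMap.ker f).subtype) d, ModuleCat.ofHom f, ?_, ?_,
        hf, ?_, ?_⟩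
      · rintro (_ | i) hi
        · exact inferInstanceAs (Module.Projective R F)
        · exact hP i (by omega)
      · rintro (_ | i) hi
        · exact absurd hi (Nat.not_lt_zero _)
        · exact h0 i (by omega)
      · intro x
        constructor
        · intro hx
          obtain ⟨y, hy⟩ := hs ⟨x, hx⟩
          exact ⟨y, congrArg Subtype.val hy⟩
        · rintro ⟨y, rfl⟩
          exact (ε y).2
      · rintro (_ | i)
        · intro y
          refine Iff.trans ⟨fun h => ?_, fun h => ?_⟩ (he y)
          · exact Subtype.ext h
          · exact congrArg Subtype.val h
        · exact hd i

end ProjectiveDimension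

/-! ### Upper bound for the projective dimensions -/

theorem exists_radX (i j : Fin 7) {y : X i} (hy : IsTestElt j y) :
    ∃ w : cObj (resolutionOf i) 1, IsTestElt j w ∧
      (radX i w = y ∨ j = i ∧ radX i w + gX i = y) := by
  obtain ⟨w, hw, h⟩ := exists_of_isTestElt_start i j (hy.map (startEquiv i).toLinearMap)
  refine ⟨w, hw, h.imp (fun h => (startEquiv i).injective ?_)
    fun h => ⟨h.1, (startEquiv i).injective ?_⟩⟩
  · rw [startEquiv_radX, h]
    rfl
  · rw [map_add, startEquiv_radX, startEquiv_apply i (gX i)]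
    exact h.2

section UpperBound

variable {M : Type} [AddCommGroup M] [Module AlgOp M] (e : M ≃ₗ[AlgOp] ∀ i, X i)

/-- The projection to a summand, as an element of the functor represented by `M`. -/
noncomputable def homPr (i : Fin 7) : HomFrom M (X i) := prX e i

theorem exists_map_radX (i : Fin 7) (φ : HomFrom M (X i)) :
    ∃ ψ : HomFrom M (cObj (resolutionOf i) 1), map (radX i) ψ = φ ∨
      map (radX i) ψ + homPr e i = φ := by
  choose w hw h using fun j => exists_radX i j (isTestElt_apply e φ j)
  have hpr (j : Fin 7) (hj : j ≠ i) : prX e i (gM e j) = 0 := prX_inX_of_ne e hj.symm _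
  refine ⟨assemble e w hw, (h i).imp (fun hi => ?_) fun hi => ?_⟩
  · refine homFrom_ext e fun j => ?_
    rw [map_apply, assemble_gM]
    by_cases hj : j = i
    · rw [hj, hi]
    · exact (h j).resolve_right fun h => hj h.1
  · refine homFrom_ext e fun j => ?_
    rw [HomFrom.add_apply, map_apply, assemble_gM]
    by_cases hj : j = i
    · subst hj
      refine Eq.trans ?_ hi.2
      congr 1
      exact prX_inX e _ _
    · refine Eq.trans ?_ ((h j).resolve_right fun h => hj h.1)
      refine (congrArg _ (hpr j hj)).trans (add_zero _)

theorem resolutionOf_five : ∀ i : Fin 7, ((resolutionOf i).getD 5 ([], [])).1 = [] := by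
  decide +kernel

theorem subsingleton_homFrom {l : List (Fin 7)} (hl : l = []) : Subsingleton (HomFrom M (Obj l)) := by
  subst hl
  exact ⟨fun φ ψ => HomFrom.ext fun m => Subsingleton.elim (α := PUnit) _ _⟩

include e in
theorem ker_map_diff (i : Fin 7) {k : ℕ} (hk : k < 4) :
    LinearMap.ker (map (M := M) (diff (resolutionOf i) k)) =
      LinearMap.range (map (M := M) (diff (resolutionOf i) (k + 1))) :=
  LinearMap.exact_iff.1 (map_exact e (diff_diff (complexOK_resolution i hk))
    fun _ _ => exists_of_diff_eq_zero (complexOK_resolution i hk))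

theorem ker_map_radX (i : Fin 7) :
    LinearMap.ker (map (M := M) (radX i)) = LinearMap.ker (map (diff (resolutionOf i) 0)) := by
  ext ψ
  rw [LinearMap.mem_ker, LinearMap.mem_ker]
  constructor
  · intro h
    refine HomFrom.ext fun m => ?_
    rw [map_apply, ← startEquiv_radX, ← map_apply (radX i), h]
    exact map_zero (startEquiv i)
  · intro h
    refine HomFrom.ext fun m => (startEquiv i).injective ?_
    rw [map_apply, startEquiv_radX, ← map_apply, h]
    exact (map_zero (startEquiv i)).symm

include e in
theorem pdlt_range_map_diff_three (i : Fin 7) :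
    PDLT (EndOp M) (LinearMap.range (map (M := M) (diff (resolutionOf i) 3))) 1 := by
  have h : LinearMap.ker (map (M := M) (diff (resolutionOf i) 3)) = ⊥ := by
    rw [ker_map_diff e i (by norm_num), LinearMap.range_eq_bot]
    have := subsingleton_homFrom (M := M) (resolutionOf_five i)
    exact LinearMap.ext fun x => by rw [this.elim x 0, map_zero, map_zero]
  have := projective_homFrom_Obj e ((resolutionOf i).getD 4 ([], [])).1
  exact PDLT.of_equiv (pdlt_one_iff.2 this) (LinearEquiv.ofInjective _ (LinearMap.ker_eq_bot.1 h))

include e in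
theorem pdlt_range_map_diff_one (i : Fin 7) :
    PDLT (EndOp M) (LinearMap.range (map (M := M) (diff (resolutionOf i) 1))) 3 := by
  have := projective_homFrom_Obj e ((resolutionOf i).getD 2 ([], [])).1
  have := projective_homFrom_Obj e ((resolutionOf i).getD 3 ([], [])).1
  refine (pdlt_range_iff 1).2 ?_
  rw [ker_map_diff e i (by norm_num)]
  refine (pdlt_range_iff 0).2 ?_
  rw [ker_map_diff e i (by norm_num)]
  exact pdlt_range_map_diff_three e i

include e in
theorem pdlt_range_map_radX (i : Fin 7) :
    PDLT (EndOp M) (LinearMap.range (map (M := M) (radX i))) 4 := by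
  have := projective_homFrom_Obj e ((resolutionOf i).getD 1 ([], [])).1
  refine (pdlt_range_iff 2).2 ?_
  rw [ker_map_radX, ker_map_diff e i (by norm_num)]
  exact pdlt_range_map_diff_one e i

/-- An endomorphism of `X i` which maps the generator into the radical differs from the identity by
an automorphism. -/
theorem exists_sub_comp_eq (i : Fin 7) (ψ : HomFrom M (cObj (resolutionOf i) 1)) :
    ∃ b : EndOp M, b • (homPr e i - map (radX i) ψ) = homPr e i := by
  let f : X i →ₗ[AlgOp] X i := (radX i).comp (LinearMap.comp ψ (inX e i))
  have hf : (f (gX i)).1 % 2 = 0 := radX_even i (isTestElt_apply e ψ i)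
  have hinj : Function.Injective (LinearMap.id - f : X i →ₗ[AlgOp] X i) :=
    (injective_iff_map_eq_zero (LinearMap.id - f)).2 fun x hx =>
      eq_zero_of_fixed i f hf (sub_eq_zero.1 hx).symm
  let u := LinearEquiv.ofBijective (LinearMap.id - f : X i →ₗ[AlgOp] X i) ⟨hinj, Finite.injective_iff_surjective.1 hinj⟩
  refine ⟨MulOpposite.op ((inX e i).comp (u.symm.toLinearMap.comp (prX e i))), HomFrom.ext fun m => ?_⟩
  have h : (LinearMap.id - f : X i →ₗ[AlgOp] X i) (u.symm (prX e i m)) = prX e i m := u.apply_symm_apply _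
  refine Eq.trans ?_ h
  refine congrArg₂ (· - ·) (prX_inX e i _) rfl

variable {T : Type} [AddCommGroup T] [Module (EndOp M) T]

/-- The homomorphism to a module given by an element of the component at `i`. -/
noncomputable def evalAt (i : Fin 7) (t : T) : HomFrom M (X i) →ₗ[EndOp M] T where
  toFun φ := MulOpposite.op ((inX e i).comp (φ : M →ₗ[AlgOp] X i)) • t
  map_add' φ ψ := by
    rw [← add_smul, ← MulOpposite.op_add]
    congr 2
    exact LinearMap.comp_add (M := M) _ _ _
  map_smul' b φ := by
    rw [RingHom.id_apply, ← mul_smul]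
    rfl

include e in
theorem exists_evalAt_ne_zero {t : T} (ht : t ≠ 0) :
    ∃ i, evalAt e i t (homPr e i) ≠ 0 := by
  by_contra! h
  refine ht ?_
  have h1 : ∑ i, (MulOpposite.op ((inX e i).comp (prX e i)) : EndOp M) = 1 := by
    refine MulOpposite.unop_injective (LinearMap.ext fun m => ?_)
    rw [Finset.unop_sum, LinearMap.sum_apply]
    exact sum_inX_prX e m
  rw [← one_smul (EndOp M) t, ← h1, Finset.sum_smul]
  exact Finset.sum_eq_zero fun i _ => h i

include e in
theorem pdlt_of_isSimpleModule [IsSimpleModule (EndOp M) T] : PDLT (EndOp M) T 5 := by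
  have := IsSimpleModule.nontrivial (EndOp M) T
  obtain ⟨t, ht⟩ := exists_ne (0 : T)
  obtain ⟨i, hi⟩ := exists_evalAt_ne_zero e ht
  have hs : Function.Surjective (evalAt e i t) :=
    LinearMap.surjective_of_ne_zero fun h => hi (by rw [h]; rfl)
  have := projective_homFrom_X e i
  have h0 (ψ : HomFrom M (cObj (resolutionOf i) 1)) : evalAt e i t (map (radX i) ψ) = 0 := by
    by_contra hne
    obtain ⟨b, hb⟩ := IsSimpleModule.toSpanSingleton_surjective (EndOp M) hne
      (evalAt e i t (homPr e i))
    rw [LinearMap.toSpanSingleton_apply] at hb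
    obtain ⟨c, hc⟩ := exists_sub_comp_eq e i (b • ψ)
    refine hi ?_
    rw [← hc, map_smul, map_sub, map_smul (map (radX i)), map_smul, sub_eq_zero.2 hb.symm, smul_zero]
  have hk : LinearMap.ker (evalAt e i t) = LinearMap.range (map (radX i)) := by
    refine le_antisymm (fun φ hφ => ?_) ?_
    · obtain ⟨ψ, hψ | hψ⟩ := exists_map_radX e i φ
      · exact ⟨ψ, hψ⟩
      · rw [LinearMap.mem_ker, ← hψ, map_add, h0, zero_add] at hφ
        exact absurd hφ hi
    · rintro _ ⟨ψ, rfl⟩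
      exact h0 ψ
  refine (pdlt_succ_iff hs 3).2 ?_
  rw [hk]
  exact pdlt_range_map_radX e i

include e in
theorem pdlt_of_finite (Y : Type) [AddCommGroup Y] [Module (EndOp M) Y] [Finite Y] :
    PDLT (EndOp M) Y 5 := by
  induction hn : Nat.card Y using Nat.strong_induction_on generalizing Y with
  | _ n ih =>
    rcases subsingleton_or_nontrivial Y with h | h
    · exact pdlt_of_subsingleton 5
    obtain ⟨N, hN, -⟩ := (eq_bot_or_exists_atom_le (⊤ : Submodule (EndOp M) Y)).resolve_left top_ne_bot
    have : IsSimpleModule (EndOp M) N := isSimpleModule_iff_isAtom.2 hN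
    have : Nontrivial N := Submodule.nontrivial_iff_ne_bot.2 hN.1
    have : Finite (Y ⧸ N) := Finite.of_surjective _ N.mkQ_surjective
    refine PDLT.extension N (pdlt_of_isSimpleModule e) (ih _ ?_ _ rfl)
    rw [← hn, Submodule.card_eq_card_quotient_mul_card N]
    exact lt_mul_of_one_lt_left (Nat.card_pos (α := Y ⧸ N)) (Finite.one_lt_card (α := N))

end UpperBound

/-! ### The global dimension -/

theorem exists_retraction {R P Q Z : Type} [Ring R] [AddCommGroup P] [Module R P] [AddCommGroup Q]
    [Module R Q] [AddCommGroup Z] [Module R Z] {f : P →ₗ[R] Q} {g : Q →ₗ[R] Z}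
    (hf : Function.Injective f) (h : LinearMap.ker g = LinearMap.range f)
    [Module.Projective R (LinearMap.range g)] : ∃ ρ : Q →ₗ[R] P, ∀ x, ρ (f x) = x := by
  obtain ⟨s, hs⟩ := Module.projective_lifting_property g.rangeRestrict LinearMap.id
    g.surjective_rangeRestrict
  have hg (y : LinearMap.range g) : g (s y) = y := congrArg Subtype.val (LinearMap.congr_fun hs y)
  have hr (y : Q) : (LinearMap.id - s.comp g.rangeRestrict : Q →ₗ[R] Q) y ∈ LinearMap.range f := by
    rw [← h, LinearMap.mem_ker, LinearMap.sub_apply, map_sub, LinearMap.comp_apply, hg]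
    exact sub_self _
  refine ⟨(LinearEquiv.ofInjective f hf).symm.toLinearMap.comp (LinearMap.codRestrict _ _ hr),
    fun x => (LinearEquiv.ofInjective f hf).injective (Subtype.ext ?_)⟩
  have hx : g.rangeRestrict (f x) = 0 := by
    refine Subtype.ext ?_
    have : f x ∈ LinearMap.ker g := h ▸ ⟨x, rfl⟩
    exact this
  rw [LinearMap.comp_apply, LinearEquiv.coe_coe, LinearEquiv.apply_symm_apply]
  change f x - s (g.rangeRestrict (f x)) = f x
  rw [hx, map_zero, sub_zero]

section GlobalDimension

variable {M : Type} [AddCommGroup M] [Module AlgOp M] (e : M ≃ₗ[AlgOp] ∀ i, X i)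

theorem wordA_an_ad_smul (x : X 3) : MulOpposite.op (wordA [an, ad]) • x = 0 := by
  have h : ∀ x < 2 ^ dim 3, actWord (act 3) x [an, ad] = 0 := by decide +kernel
  exact XorVec.ext ((wordA_smul 3 _ x).trans (h x.1 x.2))

theorem wordA_an_ad_gX :
    MulOpposite.op (wordA [an, ad]) • gX 4 = (⟨8, by decide +kernel⟩ : XorVec (dim 4)) := by
  refine XorVec.ext ?_
  rw [wordA_smul]
  decide +kernel

theorem resolutionOf_three_four : ((resolutionOf 3).getD 4 ([], [])).1 = [3] := rfl

theorem resolutionOf_three_three : ((resolutionOf 3).getD 3 ([], [])).1 = [4] := rfl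

theorem table_resolutionOf_three : table (actL ((resolutionOf 3).getD 3 ([], [])).1)
    ((resolutionOf 3).getD 4 ([], [])).1 ((resolutionOf 3).getD 4 ([], [])).2 = [8] := by
  decide +kernel

include e in
theorem not_exists_retraction
    (ρ : HomFrom M (cObj (resolutionOf 3) 3) →ₗ[EndOp M] HomFrom M (cObj (resolutionOf 3) 4))
    (h : ∀ φ, ρ (map (diff (resolutionOf 3) 3) φ) = φ) : False := by
  obtain ⟨u, hu⟩ := exists_equiv_Obj resolutionOf_three_four
  obtain ⟨v, hv⟩ := exists_equiv_Obj resolutionOf_three_three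
  let p : HomFrom M (cObj (resolutionOf 3) 4) := u.toLinearMap.comp (prX e 3)
  let q : HomFrom M (cObj (resolutionOf 3) 3) := v.toLinearMap.comp (prX e 4)
  let d : cObj (resolutionOf 3) 4 →ₗ[AlgOp] cObj (resolutionOf 3) 3 := diff (resolutionOf 3) 3
  let b : EndOp M := MulOpposite.op ((inX e 4).comp (v.symm.toLinearMap.comp (d.comp p)))
  have hb : map d p = b • q := HomFrom.ext fun m => by
    have : prX e 4 (inX e 4 (v.symm (d (p m)))) = v.symm (d (p m)) := prX_inX e 4 _
    exact ((congrArg v this).trans (v.apply_symm_apply _)).symm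
  have hp : p (gM e 3) = u (gX 3) := congrArg u (prX_inX e 3 _)
  have hd : d (u (gX 3)) = v (MulOpposite.op (wordA [an, ad]) • gX 4) := by
    rw [hu, wordA_an_ad_gX]
    refine Eq.trans ?_ (hv _).symm
    refine (diff_dec (complexOK_resolution 3 (by norm_num)) _).trans ?_
    rw [table_resolutionOf_three]
    rfl
  have h1 : p (gM e 3) = ρ q (inX e 4 (v.symm (d (p (gM e 3))))) := by
    have := congrArg (fun φ : HomFrom M (cObj (resolutionOf 3) 4) => φ (gM e 3)) (h p)
    refine this.symm.trans ?_
    change ρ (map d p) (gM e 3) = _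
    rw [hb, map_smul]
    rfl
  rw [hp, hd, v.symm_apply_apply, map_smul, map_smul_apply] at h1
  have h2 : gX 3 = 0 := by
    refine u.injective (h1.trans ?_)
    rw [map_zero, ← u.apply_symm_apply (ρ q _), ← map_smul, wordA_an_ad_smul, map_zero]
  exact absurd (congrArg (fun x : X 3 => x.1) h2) one_ne_zero

include e in
theorem injective_map_diff_three (i : Fin 7) :
    Function.Injective (map (M := M) (diff (resolutionOf i) 3)) := by
  refine LinearMap.ker_eq_bot.1 ?_
  rw [ker_map_diff e i (by norm_num), LinearMap.range_eq_bot]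
  have := subsingleton_homFrom (M := M) (resolutionOf_five i)
  exact LinearMap.ext fun x => by rw [this.elim x 0, map_zero, map_zero]

variable (M) in
/-- The simple module of projective dimension four. -/
abbrev TopModule : Type :=
  HomFrom M (cObj (resolutionOf 3) 0) ⧸ LinearMap.range (map (M := M) (diff (resolutionOf 3) 0))

include e in
theorem not_pdlt_four : ¬ PDLT (EndOp M) (TopModule M) 4 := by
  intro h
  have h0 := projective_homFrom_Obj e ((resolutionOf 3).getD 0 ([], [])).1
  have h1 := projective_homFrom_Obj e ((resolutionOf 3).getD 1 ([], [])).1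
  have h2 := projective_homFrom_Obj e ((resolutionOf 3).getD 2 ([], [])).1
  have h := (pdlt_succ_iff (Submodule.mkQ_surjective _) 2).1 h
  rw [Submodule.ker_mkQ] at h
  have h := (pdlt_range_iff 1).1 h
  rw [ker_map_diff e 3 (by norm_num)] at h
  have h := (pdlt_range_iff 0).1 h
  rw [ker_map_diff e 3 (by norm_num)] at h
  have := pdlt_one_iff.1 h
  obtain ⟨ρ, hρ⟩ := exists_retraction (injective_map_diff_three e 3) (ker_map_diff e 3 (k := 2) (by norm_num))
  exact not_exists_retraction e ρ hρ

theorem finite_obj (l : List (Fin 7)) : Finite (Obj l) :=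
  Finite.of_surjective (fun x : Fin (2 ^ dimL l) => dec l x.1) fun y => by
    obtain ⟨x, hx, rfl⟩ := exists_dec y
    exact ⟨⟨x, hx⟩, rfl⟩

include e in
theorem globalDim_eq_four : globalDim (EndOp M) = 4 := by
  have : Finite M := Finite.of_equiv _ e.symm.toEquiv
  refine le_antisymm (iSup₂_le fun Y hY => ?_) ?_
  · have : Finite (EndOp M) := Finite.of_equiv _ (selfEquiv M).symm.toEquiv
    have : Finite Y := Module.finite_of_finite (EndOp M)
    exact sInf_le ⟨4, rfl, (projDimLE_iff _ 4).2 (pdlt_of_finite e Y)⟩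
  · have : Finite (cObj (resolutionOf 3) 0) := finite_obj _
    have : Finite (TopModule M) := Finite.of_surjective _ (Submodule.mkQ_surjective _)
    have hf : Module.Finite (EndOp M) (ModuleCat.of (EndOp M) (TopModule M)) :=
      inferInstanceAs (Module.Finite (EndOp M) (TopModule M))
    refine le_trans ?_ (le_iSup₂ (f := fun (Y : ModuleCat.{0} (EndOp M))
      (_ : Module.Finite (EndOp M) Y) => projDim (EndOp M) Y) _ hf)
    refine le_sInf ?_
    rintro _ ⟨m, rfl, hm⟩
    by_contra hlt
    have hlt : m < 4 := by exact_mod_cast not_le.1 hlt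
    exact not_pdlt_four e (((projDimLE_iff _ m).1 hm).mono hlt)

end GlobalDimension

/-! ### The modules of the problem as sums of the modules of bit vectors -/

theorem unit_gen : gen v1 + gen v2 + gen v3 = 1 := by
  have := gen_rel .unit
  rw [map_add, map_add, map_one] at this
  exact this

theorem gen_mul_self (g : QGen) (hg : srcOf g = g) : gen g * gen g = gen g := by
  have := src_mul_gen g
  rwa [hg] at this

theorem isTestElt_gen {i : Fin 7} {g : QGen} (ht : srcOf (topOf i) = topOf i)
    (hr : relOf i = [g]) (hg : tgtOf (topOf i) ≠ srcOf g) : IsTestElt i (gen (topOf i)) := by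
  refine ⟨gen_mul_self _ ht, ?_⟩
  rw [hr, wordA, List.map_singleton, List.prod_singleton]
  exact gen_mul_eq_zero hg

/-- The decomposition of the regular module. -/
noncomputable def algEquiv : Alg ≃ₗ[AlgOp] X 0 × X 1 × X 2 :=
  let f (i : Fin 7) : Alg →ₗ[AlgOp] X i :=
    { toFun := fun a => MulOpposite.op a • gX i
      map_add' := fun a b => add_smul (MulOpposite.op a) (MulOpposite.op b) _
      map_smul' := fun a b => mul_smul a (MulOpposite.op b) _ }
  have h0 : IsTestElt 0 (gen v1) := isTestElt_gen (i := 0) (g := v2) rfl rfl (by decide)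
  have h1 : IsTestElt 1 (gen v2) := isTestElt_gen (i := 1) (g := v1) rfl rfl (by decide)
  have h2 : IsTestElt 2 (gen v3) := isTestElt_gen (i := 2) (g := v1) rfl rfl (by decide)
  have hz (i : Fin 7) (g : QGen) (h : app (act i g) 1 = 0) : MulOpposite.op (gen g) • gX i = 0 :=
    (gen_smul i g _).trans (XorVec.ext h)
  LinearEquiv.ofLinearMap ((f 0).prod ((f 1).prod (f 2)))
    ((liftX 0 _ h0).coprod ((liftX 1 _ h1).coprod (liftX 2 _ h2)))
    (by
      refine LinearMap.prod_ext (hom_ext ?_) (LinearMap.prod_ext (hom_ext ?_) (hom_ext ?_)) <;>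
        simp only [LinearMap.comp_apply, LinearMap.coprod_apply, LinearMap.inl_apply,
          LinearMap.inr_apply, map_zero, add_zero, zero_add, liftX_gX, LinearMap.id_apply]
      · exact Prod.ext (isTestElt_gX 0).1 (Prod.ext (hz 1 v1 rfl) (hz 2 v1 rfl))
      · exact Prod.ext (hz 0 v2 rfl) (Prod.ext (isTestElt_gX 1).1 (hz 2 v2 rfl))
      · exact Prod.ext (hz 0 v3 rfl) (Prod.ext (hz 1 v3 rfl) (isTestElt_gX 2).1))
    (by
      refine LinearMap.ext fun a => ?_
      change liftX 0 _ h0 (MulOpposite.op a • gX 0) + (liftX 1 _ h1 (MulOpposite.op a • gX 1) +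
        liftX 2 _ h2 (MulOpposite.op a • gX 2)) = a
      rw [map_smul, map_smul, map_smul, liftX_gX, liftX_gX, liftX_gX, ← add_assoc, ← smul_add,
        ← smul_add, unit_gen]
      exact one_mul a)

/-- The quotients of the indecomposable projectives. -/
noncomputable def cyclicEquiv (i : Fin 7) {g r : Alg} (hg : g = gen (topOf i))
    (hr : r = wordA (relOf i)) (ht : g * g = g) (hgr : g * r = r) :
    cyclicQuot (ZMod 2) g r ≃ₗ[AlgOp] X i :=
  let N : Submodule AlgOp Alg := Submodule.span AlgOp {r}
  let f : Alg →ₗ[AlgOp] X i :=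
    { toFun := fun a => MulOpposite.op a • gX i
      map_add' := fun a b => add_smul (MulOpposite.op a) (MulOpposite.op b) _
      map_smul' := fun a b => mul_smul a (MulOpposite.op b) _ }
  have hf : N ≤ LinearMap.ker f := by
    refine Submodule.span_le.2 (Set.singleton_subset_iff.2 ?_)
    rw [hr]
    exact (isTestElt_gX i).2
  have hc : N.mkQ g ∈ cyclicQuot (ZMod 2) g r :=
    Submodule.mem_map_of_mem (Submodule.mem_span_singleton_self g)
  have hy : IsTestElt i (⟨N.mkQ g, hc⟩ : cyclicQuot (ZMod 2) g r) := by
    refine ⟨Subtype.ext ?_, Subtype.ext ?_⟩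
    · change MulOpposite.op (gen (topOf i)) • N.mkQ g = N.mkQ g
      rw [← hg, ← map_smul]
      exact congrArg N.mkQ ht
    · change MulOpposite.op (wordA (relOf i)) • N.mkQ g = 0
      rw [← hr, ← map_smul]
      refine (Submodule.Quotient.mk_eq_zero N).2 ?_
      change g * r ∈ N
      rw [hgr]
      exact Submodule.mem_span_singleton_self r
  LinearEquiv.ofLinearMap ((N.liftQ f hf).comp (cyclicQuot (ZMod 2) g r).subtype) (liftX i _ hy)
    (by
      refine hom_ext ?_
      rw [LinearMap.comp_apply, liftX_gX]
      change MulOpposite.op g • gX i = gX i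
      rw [hg]
      exact (isTestElt_gX i).1)
    (by
      refine LinearMap.ext ?_
      rintro ⟨_, a, ha, rfl⟩
      obtain ⟨b, rfl⟩ := Submodule.mem_span_singleton.1 ha
      have : (N.liftQ f hf) (N.mkQ (b • g)) = b • gX i := by
        rw [map_smul, map_smul]
        change b • MulOpposite.op g • gX i = _
        rw [hg, (isTestElt_gX i).1]
      change liftX i _ hy ((N.liftQ f hf) (N.mkQ (b • g))) = _
      rw [this, map_smul, liftX_gX]
      exact Subtype.ext (map_smul N.mkQ b g).symm)

/-- A product of the seven modules. -/
noncomputable def piEquiv : (∀ i, X i) ≃ₗ[AlgOp] (X 0 × X 1 × X 2) × X 3 × X 4 × X 5 × X 6 :=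
  LinearEquiv.ofBijective
    { toFun := fun x => ((x 0, x 1, x 2), x 3, x 4, x 5, x 6)
      map_add' := fun _ _ => rfl
      map_smul' := fun _ _ => rfl } (by
    constructor
    · intro x y h
      simp only [LinearMap.coe_mk, AddHom.coe_mk, Prod.mk.injEq] at h
      obtain ⟨⟨h0, h1, h2⟩, h3, h4, h5, h6⟩ := h
      funext i
      fin_cases i <;> assumption
    · rintro ⟨⟨x0, x1, x2⟩, x3, x4, x5, x6⟩
      exact ⟨fun | 0 => x0 | 1 => x1 | 2 => x2 | 3 => x3 | 4 => x4 | 5 => x5 | 6 => x6, rfl⟩)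

/-- The decomposition of the module of the problem. -/
noncomputable def moduleEquiv :
    (Alg × cyclicQuot (ZMod 2) (gen v3) (gen an) ×
      cyclicQuot (ZMod 2) (gen v3) (gen an * gen ay * gen ab * gen ad * gen an * gen ay) ×
      cyclicQuot (ZMod 2) (gen v3) (gen an * gen ay) ×
      cyclicQuot (ZMod 2) (gen v2) (gen ay)) ≃ₗ[AlgOp] ∀ i, X i :=
  have h3 : gen v3 * gen v3 = gen v3 := gen_mul_self v3 rfl
  have hn : gen v3 * gen an = gen an := src_mul_gen an
  (algEquiv.prodCongr ((cyclicEquiv 3 rfl (by simp [wordA, relOf]) h3 hn).prodCongr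
    ((cyclicEquiv (g := gen v3) 4 rfl (by simp [wordA, relOf, mul_assoc]) h3
      (by simp only [← mul_assoc, hn])).prodCongr
    ((cyclicEquiv (g := gen v3) 5 rfl (by simp [wordA, relOf]) h3 (by simp only [← mul_assoc, hn])).prodCongr
    (cyclicEquiv 6 rfl (by simp [wordA, relOf]) (gen_mul_self v2 rfl) (src_mul_gen ay)))))).trans
    piEquiv.symm

/-! ### A symmetrizing form -/

/-- The coefficient of the last basis element. -/
def socleBit (i : Fin 7) (x : ℕ) : ℕ := (x.testBit (dim i - 1)).toNat

/-- The code of the list of the last coefficients of multiples of a vector. -/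
def socleRow (i : Fin 7) (x : ℕ) : List (List QGen) → ℕ
  | [] => 0
  | w :: W => 2 ^ 1 * socleRow i x W ^^^ socleBit i (actWord (act i) x (w ++ [topOf i]))

/-- Basis words of the algebra. -/
def algWords : List (List QGen) := wordsOf 0 ++ wordsOf 1 ++ wordsOf 2

theorem socleRow_ker : ∀ i : Fin 7, i < 3 → (forcePairs ((List.range (dim i)).map fun q =>
    (socleRow i (2 ^ q) algWords, 2 ^ q)) (kerBasis (dim i))).all (· == 0) = true := by
  decide +kernel

theorem socleBit_act : ∀ i : Fin 7, i < 3 → ∀ j : Fin 7, j < 3 → j ≠ i → ∀ q < dim j,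
    socleBit j (app (act j (topOf i)) (2 ^ q)) = 0 := by
  decide +kernel

theorem socleBit_xor (i : Fin 7) (x y : ℕ) :
    socleBit i (x ^^^ y) = socleBit i x ^^^ socleBit i y := by
  unfold socleBit
  rw [Nat.testBit_xor]
  cases x.testBit (dim i - 1) <;> cases y.testBit (dim i - 1) <;> rfl

theorem socleBit_zero (i : Fin 7) : socleBit i 0 = 0 := by simp [socleBit]

theorem socleRow_xor (i : Fin 7) (W : List (List QGen)) (x y : ℕ) :
    socleRow i (x ^^^ y) W = socleRow i x W ^^^ socleRow i y W := by
  induction W with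
  | nil => exact (Nat.xor_self 0).symm
  | cons w W ih =>
    simp only [socleRow, ih, actWord_xor, socleBit_xor, two_pow_mul_xor]
    ac_rfl

theorem socleRow_eq_zero (i : Fin 7) {W : List (List QGen)} {x : ℕ}
    (h : ∀ w ∈ W, socleBit i (actWord (act i) x (w ++ [topOf i])) = 0) : socleRow i x W = 0 := by
  induction W with
  | nil => rfl
  | cons w W ih =>
    rw [socleRow, ih fun u hu => h u (List.mem_cons_of_mem _ hu), h w List.mem_cons_self]
    rfl

theorem eq_zero_of_socleBit {i : Fin 7} (hi : i < 3) {x : ℕ} (hx : x < 2 ^ dim i)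
    (h : ∀ w, socleBit i (actWord (act i) x (w ++ [topOf i])) = 0) : x = 0 := by
  have hk := socleRow_ker i hi
  rw [forcePairs_eq] at hk
  have := kerBasis_sound (P := (· = 0)) rfl (by rintro x y rfl rfl; rfl) _ _ (by simp)
    (fun y hy => beq_iff_eq.1 (List.all_eq_true.1 hk y hy)) x ?_
  · rw [List.map_map] at this
    have e := app_range (F := id) rfl (fun _ _ => rfl) hx
    exact e.symm.trans this
  · rw [List.map_map]
    refine (app_range (F := fun z => socleRow i z algWords) ?_ (fun x y => ?_) hx).trans ?_
    · exact socleRow_eq_zero i fun w _ => by rw [actWord_zero, socleBit_zero]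
    · exact socleRow_xor i _ x y
    · exact socleRow_eq_zero i fun w _ => h w

/-- The last coefficient of the action on the generator of the `i`-th module. -/
noncomputable def socleHom (i : Fin 7) : Alg →+ ZMod 2 where
  toFun a := socleBit i (MulOpposite.op a • gX i).1
  map_zero' := by
    have : (MulOpposite.op (0 : Alg) • gX i).1 = 0 := congrArg Subtype.val (zero_smul AlgOp (gX i))
    rw [this, socleBit_zero, Nat.cast_zero]
  map_add' a b := by
    have : (MulOpposite.op (a + b) • gX i).1 =
        (MulOpposite.op a • gX i).1 ^^^ (MulOpposite.op b • gX i).1 :=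
      congrArg Subtype.val (add_smul (MulOpposite.op a) (MulOpposite.op b) (gX i))
    rw [this, socleBit_xor]
    unfold socleBit
    generalize Nat.testBit _ _ = x
    generalize Nat.testBit _ _ = y
    revert x y
    decide

/-- The symmetrizing form. -/
noncomputable def traceForm : Alg →+ ZMod 2 := socleHom 0 + socleHom 1 + socleHom 2

theorem socleHom_mul_wordA (i : Fin 7) (a : Alg) (w : List QGen) :
    socleHom i (a * wordA w) = socleBit i (actWord (act i) (MulOpposite.op a • gX i).1 w) := by
  rw [← wordA_smul]
  change ((socleBit i (MulOpposite.op (a * wordA w) • gX i).1 : ℕ) : ZMod 2) = _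
  rw [MulOpposite.op_mul, mul_smul]

theorem socleHom_of_ne {i j : Fin 7} (hi : i < 3) (hj : j < 3) (h : j ≠ i) (a : Alg)
    (w : List QGen) : socleHom j (a * wordA (w ++ [topOf i])) = 0 := by
  rw [wordA_append, ← mul_assoc, socleHom_mul_wordA]
  have := code_induction (P := fun x => socleBit j (app (act j (topOf i)) x) = 0) (n := dim j)
    (by rw [app_zero, socleBit_zero])
    (fun x y hx hy => by rw [app_xor, socleBit_xor, hx, hy]; rfl) (socleBit_act i hi j hj h)
    (MulOpposite.op (a * wordA w) • gX j).2
  exact congrArg Nat.cast this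

theorem eq_zero_of_traceForm {a : Alg} (h : ∀ c, traceForm (a * c) = 0) : a = 0 := by
  have hs (i : Fin 7) (hi : i < 3) (hw : ∀ w, socleHom i (a * wordA (w ++ [topOf i])) = 0) :
      MulOpposite.op a • gX i = 0 := by
    refine XorVec.ext (eq_zero_of_socleBit hi (MulOpposite.op a • gX i).2 fun w => ?_)
    have := hw w
    rw [socleHom_mul_wordA] at this
    unfold socleBit at this ⊢
    revert this
    generalize Nat.testBit _ _ = x
    revert x
    decide
  have ht (w : List QGen) : socleHom 0 (a * wordA w) + socleHom 1 (a * wordA w) +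
    socleHom 2 (a * wordA w) = 0 := h _
  refine algEquiv.injective ((Prod.ext (hs 0 (by decide) fun w => ?_)
    (Prod.ext (hs 1 (by decide) fun w => ?_) (hs 2 (by decide) fun w => ?_))).trans
    (map_zero algEquiv).symm)
  · have := ht (w ++ [topOf 0])
    rwa [socleHom_of_ne (i := 0) (j := 1) (by decide) (by decide) (by decide),
      socleHom_of_ne (i := 0) (j := 2) (by decide) (by decide) (by decide), add_zero, add_zero] at this
  · have := ht (w ++ [topOf 1])
    rwa [socleHom_of_ne (i := 1) (j := 0) (by decide) (by decide) (by decide),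
      socleHom_of_ne (i := 1) (j := 2) (by decide) (by decide) (by decide), add_zero, zero_add] at this
  · have := ht (w ++ [topOf 2])
    rwa [socleHom_of_ne (i := 2) (j := 0) (by decide) (by decide) (by decide),
      socleHom_of_ne (i := 2) (j := 1) (by decide) (by decide) (by decide), add_zero, zero_add] at this

instance : Finite Alg := Finite.of_equiv _ algEquiv.symm.toEquiv

theorem traceForm_ext {a b : Alg} (h : ∀ c, traceForm (a * c) = traceForm (b * c)) : a = b :=
  sub_eq_zero.1 (eq_zero_of_traceForm fun c => by rw [sub_mul, map_sub, h, sub_self])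

theorem exists_traceForm (μ : Alg →+ ZMod 2) : ∃ a, ∀ c, traceForm (a * c) = μ c := by
  let T : Alg →+ Module.Dual (ZMod 2) Alg :=
    { toFun := fun a => (traceForm.comp (AddMonoidHom.mulLeft a)).toZModLinearMap 2
      map_zero' := LinearMap.ext fun c => (congrArg traceForm (zero_mul c)).trans (map_zero _)
      map_add' := fun a b => LinearMap.ext fun c =>
        (congrArg traceForm (add_mul a b c)).trans (map_add _ _ _) }
  have hT : Function.Injective (T.toZModLinearMap 2) := fun a b h =>
    traceForm_ext fun c => LinearMap.congr_fun h c
  have : Module.Finite (ZMod 2) Alg := Module.Finite.of_finite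
  obtain ⟨a, ha⟩ := (LinearMap.injective_iff_surjective_of_finrank_eq_finrank
    (Subspace.dual_finrank_eq (K := ZMod 2) (V := Alg)).symm).1 hT (μ.toZModLinearMap 2)
  exact ⟨a, fun c => LinearMap.congr_fun ha c⟩

theorem exists_extension_zmod {V : Type} [AddCommGroup V] (hV : ∀ v : V, v + v = 0)
    (U : AddSubgroup V) (f : U →+ ZMod 2) : ∃ f' : V →+ ZMod 2, ∀ u : U, f' u = f u := by
  let _ : Module (ZMod 2) V := AddCommGroup.zmodModule fun v => by rw [two_nsmul, hV]
  obtain ⟨g, hg⟩ := LinearMap.exists_extend (p := AddSubgroup.toZModSubmodule 2 U)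
    (AddMonoidHom.toZModLinearMap 2 f)
  exact ⟨g, fun u => LinearMap.congr_fun hg u⟩

/-! ### Injective modules over the endomorphism ring -/

section Injective

theorem injective_of_retract {R P Q : Type} [Ring R] [AddCommGroup P] [Module R P]
    [AddCommGroup Q] [Module R Q] (hP : Module.Injective R P) (i : Q →ₗ[R] P) (r : P →ₗ[R] Q)
    (h : ∀ x, r (i x) = x) : Module.Injective R Q where
  out Y Z _ _ _ _ f hf g := by
    obtain ⟨k, hk⟩ := hP.out f hf (i.comp g)
    exact ⟨r.comp k, fun x => by rw [LinearMap.comp_apply, hk, LinearMap.comp_apply, h]⟩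

theorem injective_prod {R P Q : Type} [Ring R] [AddCommGroup P] [Module R P]
    [AddCommGroup Q] [Module R Q] (hP : Module.Injective R P) (hQ : Module.Injective R Q) :
    Module.Injective R (P × Q) where
  out Y Z _ _ _ _ f hf g := by
    obtain ⟨k, hk⟩ := hP.out f hf ((LinearMap.fst R P Q).comp g)
    obtain ⟨l, hl⟩ := hQ.out f hf ((LinearMap.snd R P Q).comp g)
    exact ⟨k.prod l, fun x => Prod.ext (hk x) (hl x)⟩

theorem injective_of_subsingleton {R P : Type} [Ring R] [AddCommGroup P] [Module R P]
    [Subsingleton P] : Module.Injective R P where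
  out _ _ _ _ _ _ _ _ _ := ⟨0, fun _ => Subsingleton.elim _ _⟩

variable {M : Type} [AddCommGroup M] [Module AlgOp M]

/-- If the regular module is a direct summand of `M`, then its image under the functor represented
by `M` is injective, because the algebra is symmetric. -/
theorem injective_homFrom_alg (p : M →ₗ[AlgOp] Alg) {m₀ : M} (hm : p m₀ = 1) :
    Module.Injective (EndOp M) (HomFrom M Alg) := by
  refine Module.Baer.injective fun J g => ?_
  have hR (b : EndOp M) : b + b = 0 :=
    MulOpposite.unop_injective (LinearMap.ext fun m => add_self_eq_zero M _)
  obtain ⟨l, hl⟩ := exists_extension_zmod hR J.toAddSubgroup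
    { toFun := fun x => traceForm (g x m₀)
      map_zero' := by
        rw [show g (0 : J.toAddSubgroup) = 0 from map_zero g]
        exact map_zero traceForm
      map_add' := fun x y => by
        rw [show g (x + y : J.toAddSubgroup) = g x + g y from map_add g _ _]
        exact map_add traceForm _ _ }
  let b (m : M) : EndOp M := MulOpposite.op
    { toFun := fun x => MulOpposite.op (p x) • m
      map_add' := fun x y => by rw [map_add, MulOpposite.op_add, add_smul]
      map_smul' := fun a x => by
        rw [map_smul, RingHom.id_apply, ← mul_smul]
        rfl }
  have hb (x : EndOp M) (m : M) : b (x.unop m) = b m * x :=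
    MulOpposite.unop_injective (LinearMap.ext fun y => (map_smul x.unop _ m).symm)
  have hadd (m n : M) : b (m + n) = b m + b n :=
    MulOpposite.unop_injective (LinearMap.ext fun y => smul_add _ m n)
  have hb₀ (m : M) : (b m).unop m₀ = m := by
    change MulOpposite.op (p m₀) • m = m
    rw [hm]
    exact one_smul _ m
  let ev (m : M) : Alg →+ ZMod 2 :=
    { toFun := fun c => l (b (MulOpposite.op c • m))
      map_zero' := by
        have h0 : b 0 = 0 := by simpa using hadd 0 0
        rw [MulOpposite.op_zero, zero_smul, h0, map_zero]
      map_add' := fun c d => by rw [MulOpposite.op_add, add_smul, hadd, map_add] }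
  choose φ hφ using fun m => exists_traceForm (ev m)
  let ψ : HomFrom M Alg :=
    ({ toFun := φ
       map_add' := fun m n => traceForm_ext fun c => by
        rw [add_mul, map_add, hφ, hφ, hφ]
        change l (b (MulOpposite.op c • (m + n))) = l (b (MulOpposite.op c • m)) +
          l (b (MulOpposite.op c • n))
        rw [smul_add, hadd, map_add]
       map_smul' := fun a m => traceForm_ext fun c => by
        change _ = traceForm (φ m * a.unop * c)
        rw [mul_assoc, hφ, hφ]
        change l (b (MulOpposite.op c • a • m)) = l (b (MulOpposite.op (a.unop * c) • m))
        rw [MulOpposite.op_mul, mul_smul, MulOpposite.op_unop] } : M →ₗ[AlgOp] Alg)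
  refine ⟨LinearMap.toSpanSingleton (EndOp M) _ ψ, fun x hx => ?_⟩
  rw [LinearMap.toSpanSingleton_apply]
  refine HomFrom.ext fun m => traceForm_ext fun c => ?_
  refine (hφ (x.unop m) c).trans ?_
  change l (b (MulOpposite.op c • x.unop m)) = _
  rw [← map_smul, hb]
  refine (hl ⟨b (MulOpposite.op c • m) * x, J.mul_mem_left _ hx⟩).trans ?_
  change traceForm (g (b (MulOpposite.op c • m) • ⟨x, hx⟩) m₀) = _
  rw [map_smul]
  change traceForm (g ⟨x, hx⟩ ((b (MulOpposite.op c • m)).unop m₀)) = _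
  rw [hb₀, map_smul_apply]
  rfl

theorem exists_retract_alg (i : Fin 7) (hi : i < 3) :
    ∃ (c : X i →ₗ[AlgOp] Alg) (r : Alg →ₗ[AlgOp] X i), ∀ x, r (c x) = x := by
  have h (p : (X 0 × X 1 × X 2) →ₗ[AlgOp] X i) (j : X i →ₗ[AlgOp] X 0 × X 1 × X 2)
      (hp : ∀ x, p (j x) = x) :
      ∃ (c : X i →ₗ[AlgOp] Alg) (r : Alg →ₗ[AlgOp] X i), ∀ x, r (c x) = x :=
    ⟨algEquiv.symm.toLinearMap.comp j, p.comp algEquiv.toLinearMap, fun x =>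
      (congrArg p (algEquiv.apply_symm_apply _)).trans (hp x)⟩
  have hi' : i = 0 ∨ i = 1 ∨ i = 2 :=
    (by decide : ∀ i : Fin 7, i < 3 → i = 0 ∨ i = 1 ∨ i = 2) i hi
  rcases hi' with rfl | rfl | rfl
  · exact h (LinearMap.fst _ _ _) (LinearMap.inl _ _ _) fun _ => rfl
  · exact h ((LinearMap.fst _ _ _).comp (LinearMap.snd _ _ _))
      ((LinearMap.inr _ _ _).comp (LinearMap.inl _ _ _)) fun _ => rfl
  · exact h ((LinearMap.snd _ _ _).comp (LinearMap.snd _ _ _))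
      ((LinearMap.inr _ _ _).comp (LinearMap.inr _ _ _)) fun _ => rfl

variable (e : M ≃ₗ[AlgOp] ∀ i, X i)

include e in
theorem injective_homFrom_X (i : Fin 7) (hi : i < 3) :
    Module.Injective (EndOp M) (HomFrom M (X i)) := by
  let p : M →ₗ[AlgOp] Alg := algEquiv.symm.toLinearMap.comp
    ((prX e 0).prod ((prX e 1).prod (prX e 2)))
  let s : (X 0 × X 1 × X 2) →ₗ[AlgOp] M :=
    (inX e 0).coprod ((inX e 1).coprod (inX e 2))
  have hp (y) : p (s y) = algEquiv.symm y := by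
    refine congrArg algEquiv.symm (Prod.ext ?_ (Prod.ext ?_ ?_)) <;>
    · simp [s, prX_inX, prX_inX_of_ne]
  have := injective_homFrom_alg (M := M) p (m₀ := s (algEquiv 1))
    (by rw [hp]; exact algEquiv.symm_apply_apply 1)
  obtain ⟨c, r, h⟩ := exists_retract_alg i hi
  exact injective_of_retract this (map c) (map r) fun φ => HomFrom.ext fun m => h _

include e in
theorem injective_homFrom_Obj {l : List (Fin 7)} (hl : ∀ i ∈ l, i < 3) :
    Module.Injective (EndOp M) (HomFrom M (Obj l)) := by
  induction l with
  | nil =>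
    have := subsingleton_homFrom (M := M) (l := []) rfl
    exact injective_of_subsingleton
  | cons j l ih =>
    exact injective_of_retract (injective_prod (injective_homFrom_X e j (hl j List.mem_cons_self))
      (ih fun i hi => hl i (List.mem_cons_of_mem _ hi)))
      (prodEquiv (M := M) (Y := X j) (Z := Obj l)).toLinearMap prodEquiv.symm.toLinearMap
      fun _ => rfl

end Injective

/-! ### The dominant dimension is at least four -/

section DominantDimension

theorem coresolutionOf_lt : ∀ i : Fin 7, ∀ k < 4, ∀ j ∈ ((coresolutionOf i).getD k ([], [])).1,
    j < 3 := by decide +kernel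

theorem coresolutionOf_four :
    ∀ i : Fin 7, ((coresolutionOf i).getD 4 ([], [])).1 = [i] := by decide +kernel

theorem coresolutionOf_five :
    ∀ i : Fin 7, ((coresolutionOf i).getD 5 ([], [])).1 = [] := by decide +kernel

variable {M : Type} [AddCommGroup M] [Module AlgOp M] (e : M ≃ₗ[AlgOp] ∀ i, X i)

theorem complexOK_coresolution (i : Fin 7) {k : ℕ} (hk : k < 4) :
    complexOK (coresolutionOf i) k = true :=
  List.all_eq_true.1 (complexOK_coresolutionOf i) k (List.mem_range.2 hk)

include e in
theorem map_diff_exact (i : Fin 7) {k : ℕ} (hk : k < 4) : Function.Exact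
    (map (M := M) (diff (coresolutionOf i) (k + 1))) (map (M := M) (diff (coresolutionOf i) k)) :=
  map_exact e (diff_diff (complexOK_coresolution i hk))
    fun _ _ hy hd => exists_of_diff_eq_zero (complexOK_coresolution i hk) hy hd

variable (M) in
/-- The terms of the sum of the projective-injective coresolutions. -/
abbrev Cores (k : ℕ) : Type := ∀ i : Fin 7, HomFrom M (cObj (coresolutionOf i) k)

variable (M) in
/-- The differentials of the sum of the coresolutions. -/
noncomputable def coresDiff (k : ℕ) : Cores M (k + 1) →ₗ[EndOp M] Cores M k :=
  LinearMap.pi fun i => (map (diff (coresolutionOf i) k)).comp (LinearMap.proj i)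

include e in
theorem coresDiff_exact {k : ℕ} (hk : k < 4) :
    Function.Exact (coresDiff M (k + 1)) (coresDiff M k) := by
  intro y
  constructor
  · intro h
    choose x hx using fun i => (map_diff_exact e i hk (y i)).1 (congrFun h i)
    exact ⟨x, funext hx⟩
  · rintro ⟨x, rfl⟩
    exact funext fun i => (map_diff_exact e i hk _).2 ⟨x i, rfl⟩

include e in
theorem injective_coresDiff_three : Function.Injective (coresDiff M 3) := by
  refine (injective_iff_map_eq_zero _).2 fun y hy => ?_
  obtain ⟨x, rfl⟩ := (coresDiff_exact e (k := 3) (by norm_num) y).1 hy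
  have : x = 0 := funext fun i =>
    (subsingleton_homFrom (M := M) (coresolutionOf_five i)).elim _ _
  rw [this, map_zero]

include e in
theorem exists_equiv_cores : Nonempty (EndOp M ≃ₗ[EndOp M] Cores M 4) := by
  choose u hu using fun i => exists_equiv_Obj (coresolutionOf_four i)
  refine ⟨LinearEquiv.ofBijective ((LinearMap.pi fun i =>
    map (M := M) ((u i).toLinearMap.comp (prX e i))).comp (selfEquiv M).toLinearMap) ⟨?_, ?_⟩⟩
  · refine (injective_iff_map_eq_zero _).2 fun b hb => MulOpposite.unop_injective
      (LinearMap.ext fun m => ?_)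
    have (i : Fin 7) : prX e i (b.unop m) = 0 := (u i).injective
      ((congrArg (fun φ : HomFrom M _ => φ m) (congrFun hb i)).trans (map_zero (u i)).symm)
    rw [← sum_inX_prX e (b.unop m)]
    refine Finset.sum_eq_zero fun i _ => ?_
    rw [this, map_zero]
  · intro y
    let f (i : Fin 7) : M →ₗ[AlgOp] X i := (u i).symm.toLinearMap.comp (y i)
    refine ⟨MulOpposite.op (e.symm.toLinearMap.comp (LinearMap.pi f)), funext fun i =>
      HomFrom.ext fun m => ?_⟩
    change u i (e (e.symm (LinearMap.pi f m)) i) = _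
    rw [e.apply_symm_apply]
    exact (u i).apply_symm_apply _

include e in
theorem projective_cores (k : ℕ) : Module.Projective (EndOp M) (Cores M k) := by
  have (i : Fin 7) : Module.Projective (EndOp M) (HomFrom M (cObj (coresolutionOf i) k)) :=
    projective_homFrom_Obj e _
  exact Module.Projective.of_equiv (DirectSum.linearEquivFunOnFintype (EndOp M) (Fin 7)
    fun i => HomFrom M (cObj (coresolutionOf i) k))

include e in
theorem injective_cores {k : ℕ} (hk : k < 4) : Module.Injective (EndOp M) (Cores M k) := by
  have (i : Fin 7) : Module.Injective (EndOp M) (HomFrom M (cObj (coresolutionOf i) k)) :=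
    injective_homFrom_Obj e (coresolutionOf_lt i k hk)
  infer_instance

include e in
theorem domDimGE_four : DomDimGE (EndOp M) 4 := by
  obtain ⟨E⟩ := exists_equiv_cores e
  refine ⟨fun k => ModuleCat.of _ (Cores M (3 - k)),
    ModuleCat.ofHom ((coresDiff M 3).comp E.toLinearMap), fun
    | 0 => ModuleCat.ofHom (coresDiff M 2)
    | 1 => ModuleCat.ofHom (coresDiff M 1)
    | 2 => ModuleCat.ofHom (coresDiff M 0)
    | k + 3 => 0, fun k hk => ⟨projective_cores e _, injective_cores e (by omega)⟩,
    fun _ => (injective_coresDiff_three e).comp E.injective, fun _ => ?_, fun k hk => ?_⟩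
  · intro y
    refine (coresDiff_exact e (k := 2) (by norm_num) y).trans
      ⟨fun ⟨x, hx⟩ => ⟨E.symm x, ?_⟩, fun ⟨x, hx⟩ => ⟨E x, hx⟩⟩
    rw [← hx]
    exact congrArg (coresDiff M 3) (E.apply_symm_apply x)
  · have hk' : k = 0 ∨ k = 1 := by omega
    rcases hk' with rfl | rfl
    · exact coresDiff_exact e (k := 1) (by norm_num)
    · exact coresDiff_exact e (k := 0) (by norm_num)

end DominantDimension

/-! ### The dominant dimension is at most four -/

section Lifting

variable {R : Type} [Ring R]

theorem exists_extend {A C I : Type} [AddCommGroup A] [Module R A] [AddCommGroup C] [Module R C]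
    [AddCommGroup I] [Module R I] (hI : Module.Injective R I) (g : A →ₗ[R] C) (f : A →ₗ[R] I)
    (h : ∀ x, g x = 0 → f x = 0) : ∃ f' : C →ₗ[R] I, ∀ x, f' (g x) = f x := by
  obtain ⟨f', hf⟩ := hI.out ((LinearMap.ker g).liftQ g le_rfl)
    (LinearMap.ker_eq_bot.1 (Submodule.ker_liftQ_eq_bot _ _ _ le_rfl))
    ((LinearMap.ker g).liftQ f h)
  exact ⟨f', fun x => hf (Submodule.Quotient.mk x)⟩

theorem exists_lift {A C P : Type} [AddCommGroup A] [Module R A] [AddCommGroup C] [Module R C]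
    [AddCommGroup P] [Module R P] [Module.Projective R P] (d : A →ₗ[R] C) (f : P →ₗ[R] C)
    (h : ∀ x, ∃ y, d y = f x) : ∃ f' : P →ₗ[R] A, ∀ x, d (f' x) = f x := by
  obtain ⟨f', hf⟩ := Module.projective_lifting_property d.rangeRestrict
    (f.codRestrict (LinearMap.range d) h) d.surjective_rangeRestrict
  exact ⟨f', fun x => congrArg Subtype.val (LinearMap.congr_fun hf x)⟩

/-- Every map from the start of a projective resolution of length four whose dual is sufficiently
exact extends along the resolution, if the target has dominant dimension at least five. -/
theorem exists_extend_of_exact {B : Type} [AddCommGroup B] [Module R B]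
    {Q I : ℕ → Type} [∀ k, AddCommGroup (Q k)] [∀ k, Module R (Q k)] [∀ k, AddCommGroup (I k)]
    [∀ k, Module R (I k)] [∀ k, Module.Projective R (Q k)]
    (δ : ∀ k, Q (k + 1) →ₗ[R] Q k) (hδ : ∀ k < 3, Function.Exact (δ (k + 1)) (δ k))
    (hδ' : Function.Injective (δ 3))
    (f : B →ₗ[R] I 0) (d : ∀ k, I k →ₗ[R] I (k + 1)) (hI : ∀ k < 4, Module.Injective R (I k))
    (hf : Function.Injective f) (hfd : Function.Exact f (d 0))
    (hd : ∀ k < 3, Function.Exact (d k) (d (k + 1)))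
    (h0 : ∀ F : Q 0 →ₗ[R] I 4, (∀ x, F (δ 0 x) = 0) → ∀ x, F x = 0)
    (χ : Q 4 →ₗ[R] B) : ∃ b : Q 3 →ₗ[R] B, ∀ x, b (δ 3 x) = χ x := by
  obtain ⟨a3, ha3⟩ := exists_extend (hI 0 (by norm_num)) (δ 3) (f.comp χ) fun x hx => by
    rw [hδ' (hx.trans (map_zero (δ 3)).symm), map_zero]
  obtain ⟨a2, ha2⟩ := exists_extend (hI 1 (by norm_num)) (δ 2) ((d 0).comp a3) fun x hx => by
    obtain ⟨y, rfl⟩ := (hδ 2 (by norm_num) x).1 hx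
    rw [LinearMap.comp_apply, ha3]
    exact hfd.apply_apply_eq_zero _
  obtain ⟨a1, ha1⟩ := exists_extend (hI 2 (by norm_num)) (δ 1) ((d 1).comp a2) fun x hx => by
    obtain ⟨y, rfl⟩ := (hδ 1 (by norm_num) x).1 hx
    rw [LinearMap.comp_apply, ha2]
    exact (hd 0 (by norm_num)).apply_apply_eq_zero _
  obtain ⟨a0, ha0⟩ := exists_extend (hI 3 (by norm_num)) (δ 0) ((d 2).comp a1) fun x hx => by
    obtain ⟨y, rfl⟩ := (hδ 0 (by norm_num) x).1 hx
    rw [LinearMap.comp_apply, ha1]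
    exact (hd 1 (by norm_num)).apply_apply_eq_zero _
  have hz := h0 ((d 3).comp a0) fun x => by
    rw [LinearMap.comp_apply, ha0]
    exact (hd 2 (by norm_num)).apply_apply_eq_zero _
  obtain ⟨b0, hb0⟩ := exists_lift (d 2) a0 fun x => (hd 2 (by norm_num) _).1 (hz x)
  obtain ⟨b1, hb1⟩ := exists_lift (d 1) (a1 - b0.comp (δ 0)) fun x =>
    (hd 1 (by norm_num) _).1 (by
      rw [LinearMap.sub_apply, map_sub, LinearMap.comp_apply, hb0, ha0]
      exact sub_self _)
  obtain ⟨b2, hb2⟩ := exists_lift (d 0) (a2 - b1.comp (δ 1)) fun x =>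
    (hd 0 (by norm_num) _).1 (by
      rw [LinearMap.sub_apply, map_sub, LinearMap.comp_apply, hb1, LinearMap.sub_apply, ha1,
        LinearMap.comp_apply b0, (hδ 0 (by norm_num)).apply_apply_eq_zero, map_zero, sub_zero]
      exact sub_self _)
  obtain ⟨b3, hb3⟩ := exists_lift f (a3 - b2.comp (δ 2)) fun x =>
    (hfd _).1 (by
      rw [LinearMap.sub_apply, map_sub, LinearMap.comp_apply, hb2, LinearMap.sub_apply, ha2,
        LinearMap.comp_apply b1, (hδ 1 (by norm_num)).apply_apply_eq_zero, map_zero, sub_zero]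
      exact sub_self _)
  refine ⟨b3, fun x => hf ?_⟩
  rw [hb3, LinearMap.sub_apply, ha3, LinearMap.comp_apply b2,
    (hδ 2 (by norm_num)).apply_apply_eq_zero, map_zero, sub_zero]
  rfl

theorem eq_zero_of_projective {A I : Type} [AddCommGroup A] [Module R A] [AddCommGroup I]
    [Module R I] [hI : Module.Projective R I] (F : A →ₗ[R] I) (x : A)
    (h : ∀ c : I →ₗ[R] R, c (F x) = 0) : F x = 0 := by
  obtain ⟨s, hs⟩ := hI.out
  refine hs.injective ?_
  rw [map_zero]
  exact Finsupp.ext fun i => h ((Finsupp.lapply i).comp s)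

end Lifting

section DominantDimension

variable {M : Type} [AddCommGroup M] [Module AlgOp M] (e : M ≃ₗ[AlgOp] ∀ i, X i)

theorem resolutionOf_three_one : ((resolutionOf 3).getD 1 ([], [])).1 = [5] := rfl

theorem table_resolutionOf_three_zero : table (actL ((resolutionOf 3).getD 0 ([], [])).1)
    ((resolutionOf 3).getD 1 ([], [])).1 ((resolutionOf 3).getD 1 ([], [])).2 = [1, 0, 0] := by
  decide +kernel

include e in
theorem eq_zero_of_map_diff (G : HomFrom M (cObj (resolutionOf 3) 0) →ₗ[EndOp M] EndOp M)
    (h : ∀ ψ, G (map (diff (resolutionOf 3) 0) ψ) = 0)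
    (φ : HomFrom M (cObj (resolutionOf 3) 0)) : G φ = 0 := by
  obtain ⟨w, hw⟩ := exists_equiv_Obj resolutionOf_three_one
  let d : cObj (resolutionOf 3) 1 →ₗ[AlgOp] cObj (resolutionOf 3) 0 := diff (resolutionOf 3) 0
  let p : HomFrom M (cObj (resolutionOf 3) 0) := (startEquiv 3).toLinearMap.comp (prX e 3)
  let q : HomFrom M (cObj (resolutionOf 3) 1) := w.toLinearMap.comp (prX e 5)
  let c (ψ : HomFrom M (cObj (resolutionOf 3) 0)) : EndOp M :=
    MulOpposite.op ((inX e 3).comp ((startEquiv 3).symm.toLinearMap.comp ψ))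
  have hc (ψ) : c ψ • p = ψ := HomFrom.ext fun m => by
    have : prX e 3 (inX e 3 ((startEquiv 3).symm (ψ m))) = (startEquiv 3).symm (ψ m) := prX_inX e 3 _
    exact (congrArg (startEquiv 3) this).trans ((startEquiv 3).apply_symm_apply _)
  have hG (ψ) : G ψ = c ψ * G p := by
    rw [← smul_eq_mul, ← map_smul, hc]
  have hq : q (gM e 5) = w (gX 5) := congrArg w (prX_inX e 5 _)
  have hd : d (w (gX 5)) = startEquiv 3 (gX 3) := by
    rw [hw]
    refine Eq.trans ?_ (startEquiv_apply 3 _).symm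
    refine (diff_dec (complexOK_resolution 3 (by norm_num)) _).trans ?_
    rw [table_resolutionOf_three_zero]
    rfl
  have h1 : (G p).unop (inX e 3 ((startEquiv 3).symm (d (q (gM e 5))))) = 0 :=
    congrArg (fun t : EndOp M => t.unop (gM e 5)) ((hG (map d q)).symm.trans (h q))
  rw [hq, hd, LinearEquiv.symm_apply_apply] at h1
  have h2 : (G p).unop.comp (inX e 3) = 0 := hom_ext h1
  rw [hG]
  exact MulOpposite.unop_injective (LinearMap.ext fun m => LinearMap.congr_fun h2 _)

include e in
theorem not_domDimGE {m : ℕ} (hm : 4 < m) : ¬ DomDimGE (EndOp M) m := by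
  rintro ⟨I, f, d, hI, hf, hfd, hd⟩
  have hP (k : ℕ) : Module.Projective (EndOp M) (HomFrom M (cObj (resolutionOf 3) k)) :=
    projective_homFrom_Obj e _
  obtain ⟨u, hu⟩ := exists_equiv_Obj resolutionOf_three_four
  obtain ⟨b, hb⟩ := exists_extend_of_exact (R := EndOp M)
    (Q := fun k => HomFrom M (cObj (resolutionOf 3) k)) (I := fun k => I k)
    (fun k => map (diff (resolutionOf 3) k))
    (fun k hk => LinearMap.exact_iff.2 (ker_map_diff e 3 (by omega)))
    (injective_map_diff_three e 3) f.hom (fun k => (d k).hom) (fun k hk => (hI k (by omega)).2)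
    (hf (by omega)) (hfd (by omega)) (fun k hk => hd k (by omega))
    (fun F hF x => by
      have := (hI 4 hm).1
      exact eq_zero_of_projective F x fun c => eq_zero_of_map_diff e (c.comp F)
        (fun ψ => (congrArg c (hF ψ)).trans (map_zero c)) x)
    ((selfEquiv M).symm.toLinearMap.comp (map ((inX e 3).comp u.symm.toLinearMap)))
  refine not_exists_retraction e ((map (u.toLinearMap.comp (prX e 3))).comp
    ((selfEquiv M).toLinearMap.comp b)) fun φ => ?_
  refine (congrArg (fun t => map (u.toLinearMap.comp (prX e 3)) (selfEquiv M t)) (hb φ)).trans ?_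
  refine HomFrom.ext fun m => ?_
  have : prX e 3 (inX e 3 (u.symm (φ m))) = u.symm (φ m) := prX_inX e 3 _
  exact (congrArg u this).trans (u.apply_symm_apply _)

include e in
theorem domDim_eq_four : domDim (EndOp M) = 4 := by
  refine le_antisymm (sSup_le ?_) (le_sSup ⟨4, rfl, domDimGE_four e⟩)
  rintro _ ⟨m, rfl, hm⟩
  have : m ≤ 4 := not_lt.1 fun h => not_domDimGE e h hm
  exact_mod_cast this

end DominantDimension

end QuatCode

open QGen in
/-- Over the field `K = 𝔽₂` with two elements, the endomorphism algebra
`B = End_A(M)` of the right module `M = A ⊕ M₁ ⊕ M₂ ⊕ M₃ ⊕ M₄` over the algebra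
`A = Q(3A)₂²` of quaternion type has global dimension `4` and dominant dimension `4`
(both computed on categories of right modules). -/
theorem endQuatAlgModule_globalDim_eq_four_and_domDim_eq_four :
    globalDim (Module.End (QuatAlg (ZMod 2))ᵐᵒᵖ
        (QuatAlg (ZMod 2) ×
          ↥(cyclicQuot (ZMod 2) (qgen (ZMod 2) v3) (qgen (ZMod 2) an)) ×
          ↥(cyclicQuot (ZMod 2) (qgen (ZMod 2) v3)
            (qgen (ZMod 2) an * qgen (ZMod 2) ay * qgen (ZMod 2) ab * qgen (ZMod 2) ad *
              qgen (ZMod 2) an * qgen (ZMod 2) ay)) ×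
          ↥(cyclicQuot (ZMod 2) (qgen (ZMod 2) v3) (qgen (ZMod 2) an * qgen (ZMod 2) ay)) ×
          ↥(cyclicQuot (ZMod 2) (qgen (ZMod 2) v2) (qgen (ZMod 2) ay))))ᵐᵒᵖ = 4 ∧
    domDim (Module.End (QuatAlg (ZMod 2))ᵐᵒᵖ
        (QuatAlg (ZMod 2) ×
          ↥(cyclicQuot (ZMod 2) (qgen (ZMod 2) v3) (qgen (ZMod 2) an)) ×
          ↥(cyclicQuot (ZMod 2) (qgen (ZMod 2) v3)
            (qgen (ZMod 2) an * qgen (ZMod 2) ay * qgen (ZMod 2) ab * qgen (ZMod 2) ad *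
              qgen (ZMod 2) an * qgen (ZMod 2) ay)) ×
          ↥(cyclicQuot (ZMod 2) (qgen (ZMod 2) v3) (qgen (ZMod 2) an * qgen (ZMod 2) ay)) ×
          ↥(cyclicQuot (ZMod 2) (qgen (ZMod 2) v2) (qgen (ZMod 2) ay))))ᵐᵒᵖ = 4 := by
  exact ⟨QuatCode.globalDim_eq_four QuatCode.moduleEquiv, QuatCode.domDim_eq_four QuatCode.moduleEquiv⟩
end

section
/- Let A be a finite-dimensional algebra over a field K and let F be a field extension of K. Then the dominant dimension of A equals the dominant dimension of A_F = A ⊗_K F. -/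
open CategoryTheory

universe u

section Coresolutions

/-- `HasCoresolution R n M` says that there is an exact sequence
`0 → M → I_0 → ⋯ → I_{n-1}` of `R`-modules in which every `I_j` is projective and injective. The
sequence is built one cokernel at a time. -/
def HasCoresolution (R : Type u) [Ring R] :
    ℕ → ∀ (M : Type u) [AddCommGroup M] [Module R M], Prop
  | 0, _, _, _ => True
  | n + 1, M, _, _ => ∃ (I C : Type u) (_ : AddCommGroup I) (_ : AddCommGroup C)
      (_ : Module R I) (_ : Module R C) (f : M →ₗ[R] I) (g : I →ₗ[R] C),
      Module.Projective R I ∧ Module.Injective R I ∧ Function.Injective f ∧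
      Function.Exact f g ∧ Function.Surjective g ∧ HasCoresolution R n C

variable {R : Type u} [Ring R]

theorem injective_prod {M N : Type u} [AddCommGroup M] [Module R M] [AddCommGroup N] [Module R N]
    (hM : Module.Injective R M) (hN : Module.Injective R N) : Module.Injective R (M × N) := by
  refine ⟨fun X Y _ _ _ _ f hf g => ?_⟩
  obtain ⟨a, ha⟩ := hM.out f hf (LinearMap.fst R M N ∘ₗ g)
  obtain ⟨b, hb⟩ := hN.out f hf (LinearMap.snd R M N ∘ₗ g)
  exact ⟨a.prod b, fun x => Prod.ext (ha x) (hb x)⟩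

theorem HasCoresolution.prod {n : ℕ} {M J : Type u} [AddCommGroup M] [Module R M]
    [AddCommGroup J] [Module R J] (hM : HasCoresolution R n M) (hP : Module.Projective R J)
    (hJ : Module.Injective R J) : HasCoresolution R n (M × J) := by
  cases n with
  | zero => trivial
  | succ n =>
    obtain ⟨I, C, _, _, _, _, f, g, hIP, hI, hf, hfg, hg, hC⟩ := hM
    refine ⟨I × J, C, inferInstance, inferInstance, inferInstance, inferInstance,
      f.prodMap LinearMap.id, g ∘ₗ LinearMap.fst R I J, inferInstance, injective_prod hI hJ,
      ?_, ?_, ?_, hC⟩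
    · exact hf.prodMap Function.injective_id
    · rintro ⟨i, j⟩
      simp only [LinearMap.comp_apply, LinearMap.fst_apply, hfg i]
      constructor
      · rintro ⟨m, rfl⟩
        exact ⟨(m, j), rfl⟩
      · rintro ⟨⟨m, k⟩, h⟩
        exact ⟨m, congrArg Prod.fst h⟩
    · exact hg.comp Prod.fst_surjective

/-- Modules with a coresolution of length `n` are closed under retracts: if `X → J` is the first
map of the coresolution of `X`, with cokernel `Z`, and `M` is a retract of `X`, then the cokernel of
`M → X → J` is a retract of `Z × J`. -/
theorem HasCoresolution.of_retract {n : ℕ} {M X : Type u} [AddCommGroup M] [Module R M]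
    [AddCommGroup X] [Module R X] (i : M →ₗ[R] X) (p : X →ₗ[R] M) (hpi : ∀ m, p (i m) = m)
    (hX : HasCoresolution R n X) : HasCoresolution R n M := by
  induction n generalizing M X with
  | zero => trivial
  | succ n ih =>
    obtain ⟨J, Z, _, _, _, _, f, g, hJP, hJ, hf, hfg, hg, hZ⟩ := hX
    obtain ⟨r, hr⟩ := hJ.out f hf (f ∘ₗ i ∘ₗ p)
    have hi : Function.Injective i := Function.LeftInverse.injective hpi
    let N := LinearMap.range (f ∘ₗ i)
    have hrN : ∀ x, r (f x) ∈ N := fun x => ⟨p x, by simp [hr]⟩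
    let e := g.quotKerEquivOfSurjective hg
    have hker : g.ker ≤ (N.mkQ ∘ₗ r).ker := by
      intro j hj
      obtain ⟨x, rfl⟩ := (hfg j).1 hj
      simpa using hrN x
    let b : Z →ₗ[R] J ⧸ N := g.ker.liftQ (N.mkQ ∘ₗ r) hker ∘ₗ e.symm.toLinearMap
    have hb : ∀ j, b (g j) = N.mkQ (r j) := by
      intro j
      have : e.symm (g j) = g.ker.mkQ j := by
        rw [LinearEquiv.symm_apply_eq]
        simp [e]
      simp [b, this]
    have hN : N ≤ (g.prod (LinearMap.id - r)).ker := by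
      rintro _ ⟨m, rfl⟩
      simp [hr, hpi, hfg.apply_apply_eq_zero]
    refine ⟨J, J ⧸ N, inferInstance, inferInstance, inferInstance, inferInstance,
      f ∘ₗ i, N.mkQ, hJP, hJ, hf.comp hi, ?_, N.mkQ_surjective,
      ih (N.liftQ _ hN) (b.coprod N.mkQ) ?_ (hZ.prod hJP hJ)⟩
    · rw [LinearMap.exact_iff, Submodule.ker_mkQ]
    · intro c
      obtain ⟨j, rfl⟩ := N.mkQ_surjective c
      simp [hb]

theorem HasCoresolution.exists_sequence {n : ℕ} {M : Type u} [AddCommGroup M] [Module R M]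
    (h : HasCoresolution R n M) :
    ∃ (I : ℕ → ModuleCat.{u} R) (f : ModuleCat.of R M ⟶ I 0) (d : ∀ i, I i ⟶ I (i + 1)),
      (∀ i, i < n → Module.Projective R (I i) ∧ Module.Injective R (I i)) ∧
      (1 ≤ n → Function.Injective f) ∧
      (2 ≤ n → Function.Exact f (d 0)) ∧
      (∀ i, i + 3 ≤ n → Function.Exact (d i) (d (i + 1))) := by
  induction n generalizing M with
  | zero => exact ⟨fun _ => ModuleCat.of R M, 0, fun _ => 0, by omega, by omega, by omega, by omega⟩
  | succ n ih =>
    obtain ⟨J, C, _, _, _, _, f, g, hJP, hJ, hf, hfg, hg, hC⟩ := h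
    obtain ⟨I, f', d, hI, hf', hfd, hd⟩ := ih hC
    let I' : ℕ → ModuleCat.{u} R := fun i => Nat.casesOn i (ModuleCat.of R J) I
    let d' : ∀ i, I' i ⟶ I' (i + 1) := fun i =>
      Nat.casesOn (motive := fun i => I' i ⟶ I' (i + 1)) i (ModuleCat.ofHom g ≫ f') d
    have hd0 : ∀ j : J, (d' 0).hom j = f'.hom (g j) := fun _ => rfl
    refine ⟨I', ModuleCat.ofHom f, d', ?_, fun _ => hf, fun hn => ?_, ?_⟩
    · rintro (_ | i) hi
      · exact ⟨hJP, hJ⟩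
      · exact hI i (by omega)
    · intro j
      have := hf' (by omega)
      change (d' 0).hom j = 0 ↔ _
      rw [hd0, map_eq_zero_iff f'.hom this]
      exact hfg j
    · rintro (_ | i) hi
      · intro x
        refine (hfd (by omega) x).trans ?_
        constructor
        · rintro ⟨c, rfl⟩
          obtain ⟨j, rfl⟩ := hg c
          exact ⟨j, rfl⟩
        · rintro ⟨j, rfl⟩
          exact ⟨g j, rfl⟩
      · exact hd i (by omega)

theorem HasCoresolution.of_sequence {n : ℕ} {M : Type u} [AddCommGroup M] [Module R M]
    (I : ℕ → ModuleCat.{u} R) (f : ModuleCat.of R M ⟶ I 0) (d : ∀ i, I i ⟶ I (i + 1))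
    (hI : ∀ i, i < n → Module.Projective R (I i) ∧ Module.Injective R (I i))
    (hf : 1 ≤ n → Function.Injective f) (hfd : 2 ≤ n → Function.Exact f (d 0))
    (hd : ∀ i, i + 3 ≤ n → Function.Exact (d i) (d (i + 1))) : HasCoresolution R n M := by
  induction n generalizing M I with
  | zero => trivial
  | succ n ih =>
    let N : Submodule R (I 0) := LinearMap.range f.hom
    refine ⟨I 0, I 0 ⧸ N, inferInstance, inferInstance, inferInstance, inferInstance,
      f.hom, N.mkQ, (hI 0 (by omega)).1, (hI 0 (by omega)).2, hf (by omega), ?_,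
      N.mkQ_surjective, ?_⟩
    · rw [LinearMap.exact_iff, Submodule.ker_mkQ]
    · cases n with
      | zero => trivial
      | succ n =>
        have hex : Function.Exact f.hom (d 0).hom := hfd (by omega)
        have hN : N = (d 0).hom.ker := (LinearMap.exact_iff.1 hex).symm
        refine ih (fun i => I (i + 1)) (ModuleCat.ofHom (N.liftQ (d 0).hom hN.le))
          (fun i => d (i + 1)) (fun i hi => hI _ (by omega)) (fun _ => ?_) (fun hn => ?_)
          (fun i hi => hd _ (by omega))
        · change Function.Injective (N.liftQ (d 0).hom hN.le)
          rw [← LinearMap.ker_eq_bot]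
          exact Submodule.ker_liftQ_eq_bot _ _ _ hN.ge
        · have h := hd 0 (by omega)
          intro x
          refine (h x).trans ?_
          constructor
          · rintro ⟨y, rfl⟩
            exact ⟨N.mkQ y, rfl⟩
          · rintro ⟨y, rfl⟩
            obtain ⟨y, rfl⟩ := N.mkQ_surjective y
            exact ⟨y, rfl⟩

theorem domDimGE_iff_hasCoresolution (n : ℕ) : DomDimGE R n ↔ HasCoresolution R n R :=
  ⟨fun ⟨I, f, d, hI, hf, hfd, hd⟩ => .of_sequence I f d hI hf hfd hd, fun h => h.exists_sequence⟩

end Coresolutions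

section Restriction

variable {R S : Type u} [Ring R] [Ring S] (φ : R →+* S)

/-- An `S`-linear map, seen as an `R`-linear map along a ring homomorphism `R →+* S`. -/
def LinearMap.restrictAlong {M N : Type u} [AddCommGroup M] [AddCommGroup N] [Module S M]
    [Module S N] [Module R M] [Module R N] (hM : ∀ (r : R) (m : M), r • m = φ r • m)
    (hN : ∀ (r : R) (m : N), r • m = φ r • m) (f : M →ₗ[S] N) : M →ₗ[R] N where
  toFun := f
  map_add' := f.map_add
  map_smul' r m := by simp [hM, hN]

theorem HasCoresolution.restrict
    (hφ : ∀ (J : Type u) [AddCommGroup J] [Module S J] [Module R J],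
      (∀ (r : R) (j : J), r • j = φ r • j) → Module.Projective S J → Module.Injective S J →
      Module.Projective R J ∧ Module.Injective R J)
    {n : ℕ} {M : Type u} [AddCommGroup M] [Module S M] [Module R M]
    (hM : ∀ (r : R) (m : M), r • m = φ r • m) (h : HasCoresolution S n M) :
    HasCoresolution R n M := by
  induction n generalizing M with
  | zero => trivial
  | succ n ih =>
    obtain ⟨I, C, _, _, _, _, f, g, hIP, hI, hf, hfg, hg, hC⟩ := h
    let : Module R I := Module.compHom I φ
    let : Module R C := Module.compHom C φ
    have := hφ I (fun _ _ => rfl) hIP hI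
    exact ⟨I, C, inferInstance, inferInstance, inferInstance, inferInstance,
      f.restrictAlong φ hM (fun _ _ => rfl),
      g.restrictAlong φ (fun _ _ => rfl) (fun _ _ => rfl), this.1, this.2, hf, hfg, hg,
      ih (fun _ _ => rfl) hC⟩

theorem projective_of_projective_restrict [Module R S] (hS : ∀ (r : R) (s : S), r • s = φ r * s)
    [Module.Projective R S] {J : Type u} [AddCommGroup J] [Module S J] [Module R J]
    (hJ : ∀ (r : R) (j : J), r • j = φ r • j) (h : Module.Projective S J) :
    Module.Projective R J := by
  obtain ⟨s, hs⟩ := Module.projective_def.1 h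
  have hF : ∀ (r : R) (x : J →₀ S), r • x = φ r • x := fun r x => Finsupp.ext fun j => hS _ _
  have : Module.Projective R (J →₀ S) := by
    classical
    exact .of_equiv' (finsuppLEquivDirectSum R S J).symm
  exact .of_split (s.restrictAlong φ hJ hF)
    ((Finsupp.linearCombination S id).restrictAlong φ hF hJ) (LinearMap.ext hs)

theorem DomDimGE.of_ringEquiv (e : R ≃+* S) {n : ℕ} (h : DomDimGE S n) : DomDimGE R n := by
  rw [domDimGE_iff_hasCoresolution] at h ⊢
  let : Module R S := Module.compHom S (e : R →+* S)
  have he : ∀ (r : R) (s : S), r • s = (e : R →+* S) r * s := fun _ _ => rfl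
  let l : R ≃ₗ[R] S := { e with map_smul' := fun r s => e.map_mul r s }
  have : Module.Projective R S := .of_equiv' l
  refine .of_retract (l : R →ₗ[R] S) (l.symm : S →ₗ[R] R) (fun m => l.symm_apply_apply m)
    (h.restrict (e : R →+* S) (fun J _ _ _ hJ hP hI => ?_) he)
  refine ⟨projective_of_projective_restrict (e : R →+* S) he hJ hP, ⟨?_⟩⟩
  intro X Y _ _ _ _ f hf g
  let : Module S X := Module.compHom X (e.symm : S →+* R)
  let : Module S Y := Module.compHom Y (e.symm : S →+* R)
  have hJ' : ∀ (s : S) (j : J), s • j = (e.symm : S →+* R) s • j := fun s j => by simp [hJ]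
  have hY : ∀ (r : R) (y : Y), r • y = (e : R →+* S) r • y := fun r y =>
    congrArg (· • y) (e.symm_apply_apply r).symm
  obtain ⟨h, hh⟩ := hI.out (f.restrictAlong (e.symm : S →+* R) (fun _ _ => rfl) (fun _ _ => rfl))
    hf (g.restrictAlong (e.symm : S →+* R) (fun _ _ => rfl) hJ')
  exact ⟨h.restrictAlong (e : R →+* S) hY hJ, hh⟩

end Restriction

section BaseChange

open TensorProduct

variable (K F R : Type u) [Field K] [Field F] [Algebra K F] [Ring R] [Algebra K R]

/-- The action of `F ⊗ R` on the base change `F ⊗ M` of an `R`-module `M`. -/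
noncomputable def tensorAction (M : Type u) [AddCommGroup M] [Module K M] [Module R M]
    [IsScalarTower K R M] : F ⊗[K] R →+* Module.End F (F ⊗[K] M) :=
  ((Module.endTensorEndAlgHom (R := K) (S := K) (A := F) (M := F) (N := M)).comp
    (Algebra.TensorProduct.map (Algebra.lsmul K F F : F →ₐ[K] Module.End F F)
      (Algebra.lsmul K K M))).toRingHom

/-- The base change `F ⊗ M` of an `R`-module `M` as a module over `F ⊗ R`. -/
noncomputable abbrev tensorModule (M : Type u) [AddCommGroup M] [Module K M] [Module R M]
    [IsScalarTower K R M] : Module (F ⊗[K] R) (F ⊗[K] M) :=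
  Module.compHom (F ⊗[K] M) (tensorAction K F R M)

attribute [local instance] tensorModule

variable {K F R}

section

variable {M N : Type u} [AddCommGroup M] [Module K M] [Module R M] [IsScalarTower K R M]
  [AddCommGroup N] [Module K N] [Module R N] [IsScalarTower K R N]

theorem tensorModule_smul_tmul (a b : F) (r : R) (m : M) :
    ((a ⊗ₜ[K] r : F ⊗[K] R) • (b ⊗ₜ[K] m : F ⊗[K] M)) = (a * b) ⊗ₜ[K] (r • m) := rfl

theorem tensorModule_smul_left (a : F) (x : F ⊗[K] M) : (a ⊗ₜ[K] (1 : R)) • x = a • x := by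
  induction x with
  | zero => simp
  | tmul b m => rw [tensorModule_smul_tmul, one_smul, TensorProduct.smul_tmul', smul_eq_mul]
  | add x y hx hy => rw [smul_add, smul_add, hx, hy]

theorem tensorModule_smul_right (r : R) (x : F ⊗[K] M) :
    ((1 : F) ⊗ₜ[K] r) • x = (Algebra.lsmul K K M r).lTensor F x := by
  induction x with
  | zero => simp
  | tmul b m => rw [tensorModule_smul_tmul, one_mul]; rfl
  | add x y hx hy => rw [smul_add, map_add, hx, hy]

/-- An additive map out of an `F ⊗ R`-module is linear once it is compatible with `F` and `R`. -/
theorem map_smul_of_tmul {X Y : Type u} [AddCommGroup X] [AddCommGroup Y] [Module (F ⊗[K] R) X]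
    [Module (F ⊗[K] R) Y] (f : X →+ Y)
    (h : ∀ (a : F) (r : R) x, f ((a ⊗ₜ[K] r) • x) = (a ⊗ₜ[K] r) • f x) (t : F ⊗[K] R) (x : X) :
    f (t • x) = t • f x := by
  induction t with
  | zero => simp
  | tmul a r => exact h a r x
  | add s t hs ht => rw [add_smul, add_smul, map_add, hs, ht]

/-- The base change of an `R`-linear map. -/
noncomputable def tensorMap (f : M →ₗ[R] N) : F ⊗[K] M →ₗ[F ⊗[K] R] F ⊗[K] N where
  toFun := (f.restrictScalars K).lTensor F
  map_add' := map_add _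
  map_smul' := map_smul_of_tmul ((f.restrictScalars K).lTensor F).toAddMonoidHom fun a r x => by
    induction x with
    | zero => simp
    | tmul b m =>
      rw [tensorModule_smul_tmul]
      change (a * b) ⊗ₜ f (r • m) = (a ⊗ₜ[K] r) • (b ⊗ₜ[K] f m)
      rw [tensorModule_smul_tmul, map_smul]
    | add x y hx hy => rw [smul_add, map_add, map_add, smul_add, hx, hy]

/-- An `R`-linear map from `M` to an `F ⊗ R`-module `J` extends to `F ⊗ M`. -/
theorem exists_tensorLift {J : Type u} [AddCommGroup J] [Module (F ⊗[K] R) J] (g : M →+ J)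
    (hg : ∀ (r : R) m, g (r • m) = ((1 : F) ⊗ₜ[K] r) • g m) :
    ∃ l : F ⊗[K] M →ₗ[F ⊗[K] R] J, ∀ a m, l (a ⊗ₜ m) = (a ⊗ₜ[K] (1 : R)) • g m := by
  let l : F ⊗[K] M →+ J := TensorProduct.liftAddHom
    (AddMonoidHom.mk' (fun a => (DistribSMul.toAddMonoidHom J (a ⊗ₜ[K] (1 : R))).comp g)
      fun a b => by ext m; simp [TensorProduct.add_tmul, add_smul])
    (fun k a m => by
      have : k • m = (algebraMap K R k) • m := (algebraMap_smul R k m).symm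
      simp only [AddMonoidHom.mk'_apply, AddMonoidHom.comp_apply,
        DistribSMul.toAddMonoidHom_apply, this, hg, smul_smul,
        Algebra.TensorProduct.tmul_mul_tmul, mul_one, one_mul, Algebra.algebraMap_eq_smul_one,
        TensorProduct.smul_tmul])
  have hl : ∀ a m, l (a ⊗ₜ m) = (a ⊗ₜ[K] (1 : R)) • g m := fun _ _ => rfl
  refine ⟨{ l with map_smul' := map_smul_of_tmul l fun a r x => ?_ }, hl⟩
  induction x with
  | zero => simp
  | tmul b m =>
    rw [tensorModule_smul_tmul, hl, hl, hg, smul_smul, smul_smul,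
      Algebra.TensorProduct.tmul_mul_tmul, Algebra.TensorProduct.tmul_mul_tmul]
    simp
  | add x y hx hy => rw [smul_add, map_add, map_add, smul_add, hx, hy]

theorem projective_tensor (h : Module.Projective R M) :
    Module.Projective (F ⊗[K] R) (F ⊗[K] M) := by
  refine .of_lifting_property fun {X Y} _ _ _ _ p g hp => ?_
  let φ : R →+* F ⊗[K] R := (Algebra.TensorProduct.includeRight : R →ₐ[K] F ⊗[K] R).toRingHom
  let : Module R X := Module.compHom X φ
  let : Module R Y := Module.compHom Y φ
  let g' : M →ₗ[R] Y :=
    { toFun := fun m => g (1 ⊗ₜ m)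
      map_add' := fun m n => by rw [TensorProduct.tmul_add, map_add]
      map_smul' := fun r m => by
        have := g.map_smul ((1 : F) ⊗ₜ[K] r) (1 ⊗ₜ m)
        rwa [tensorModule_smul_tmul, mul_one] at this }
  obtain ⟨s, hs⟩ := Module.projective_lifting_property
    (p.restrictAlong φ (fun _ _ => rfl) (fun _ _ => rfl)) g' hp
  obtain ⟨l, hl⟩ := exists_tensorLift s.toAddMonoidHom s.map_smul
  refine ⟨l, LinearMap.ext fun x => ?_⟩
  induction x with
  | zero => simp
  | tmul a m =>
    have h1 : p (s m) = g (1 ⊗ₜ m) := LinearMap.congr_fun hs m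
    rw [LinearMap.comp_apply, hl, map_smul]
    change _ • p (s m) = _
    rw [h1, ← map_smul, tensorModule_smul_tmul, mul_one, one_smul]
  | add x y hx hy => rw [map_add, map_add, hx, hy]

variable (K R M) in
/-- The coinduced module `Hom_K(R, M)`, on which `R` acts through right multiplication on `R`. -/
def Coinduced : Type u := R →ₗ[K] M

instance : AddCommGroup (Coinduced K R M) := inferInstanceAs (AddCommGroup (R →ₗ[K] M))

instance : Module R (Coinduced K R M) where
  smul := fun r (φ : R →ₗ[K] M) => φ ∘ₗ LinearMap.mulRight K r
  one_smul := fun (φ : R →ₗ[K] M) => LinearMap.ext fun s => congrArg φ (mul_one s)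
  mul_smul := fun r r' (φ : R →ₗ[K] M) => LinearMap.ext fun s =>
    congrArg φ (mul_assoc s r r').symm
  smul_zero := fun _ => LinearMap.zero_comp _
  smul_add := fun _ _ _ => LinearMap.add_comp _ _ _
  add_smul := fun r r' (φ : R →ₗ[K] M) => LinearMap.ext fun s =>
    (congrArg φ (mul_add s r r')).trans (map_add φ _ _)
  zero_smul := fun (φ : R →ₗ[K] M) => LinearMap.ext fun s =>
    (congrArg φ (mul_zero s)).trans (map_zero φ)

/-- An injective `R`-module `M` is a retract of the coinduced module `Hom_K(R, M)`. -/
theorem exists_coinduced_retraction (h : Module.Injective R M) :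
    ∃ ρ : (R →ₗ[K] M) →ₗ[K] M,
      (∀ m, ρ ((LinearMap.toSpanSingleton R M m).restrictScalars K) = m) ∧
      ∀ (r : R) (φ : R →ₗ[K] M), ρ (φ ∘ₗ LinearMap.mulRight K r) = r • ρ φ := by
  let j : M →ₗ[R] Coinduced K R M :=
    { toFun := fun m => (LinearMap.toSpanSingleton R M m).restrictScalars K
      map_add' := fun m n => LinearMap.ext fun s => smul_add s m n
      map_smul' := fun r m => LinearMap.ext fun s => smul_smul s r m }
  have hj : Function.Injective j := fun m n hmn =>
    (one_smul R m).symm.trans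
      ((LinearMap.congr_fun (f := (j m : R →ₗ[K] M)) hmn 1).trans (one_smul R n))
  obtain ⟨ρ, hρ⟩ := h.out j hj LinearMap.id
  refine ⟨{ toFun := ρ, map_add' := ρ.map_add, map_smul' := fun k φ => ?_ }, hρ, ρ.map_smul⟩
  have : k • φ = φ ∘ₗ LinearMap.mulRight K (algebraMap K R k) := LinearMap.ext fun s => by
    rw [LinearMap.comp_apply, LinearMap.mulRight_apply, ← Algebra.commutes, ← Algebra.smul_def,
      map_smul, LinearMap.smul_apply]
  rw [this]
  exact (ρ.map_smul _ _).trans (algebraMap_smul R k (ρ φ))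

theorem injective_tensor [FiniteDimensional K R] (h : Module.Injective R M) :
    Module.Injective (F ⊗[K] R) (F ⊗[K] M) := by
  obtain ⟨ρ, hρ, hρR⟩ := exists_coinduced_retraction (K := K) h
  let e := lTensorHomEquivHomLTensor K R F M
  let σ : (R →ₗ[K] F ⊗[K] M) →ₗ[K] F ⊗[K] M := ρ.lTensor F ∘ₗ e.symm.toLinearMap
  have hσ : ∀ a φ, σ (e (a ⊗ₜ φ)) = a ⊗ₜ ρ φ := fun a φ => by simp [σ]
  have hσs : ∀ x : F ⊗[K] M, ∀ φ : R →ₗ[K] F ⊗[K] M,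
      (∀ s, φ s = ((1 : F) ⊗ₜ[K] s) • x) → σ φ = x := by
    intro x
    induction x with
    | zero =>
      intro φ hφ
      rw [show φ = 0 from LinearMap.ext fun s => by simp [hφ], map_zero]
    | tmul a m =>
      intro φ hφ
      have : φ = e (a ⊗ₜ (LinearMap.toSpanSingleton R M m).restrictScalars K) :=
        LinearMap.ext fun s => by
          rw [hφ, tensorModule_smul_tmul]
          simp [e]
      rw [this, hσ, hρ]
    | add x y hx hy =>
      intro φ hφ
      let ψ (z : F ⊗[K] M) : R →ₗ[K] F ⊗[K] M :=
        { toFun := fun s => ((1 : F) ⊗ₜ[K] s) • z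
          map_add' := fun s t => by rw [TensorProduct.tmul_add, add_smul]
          map_smul' := fun k s => by
            simp only [tensorModule_smul_right, map_smul, LinearMap.lTensor_smul,
              LinearMap.smul_apply, RingHom.id_apply] }
      have : φ = ψ x + ψ y := LinearMap.ext fun s => by
        rw [hφ, smul_add]
        rfl
      rw [this, map_add, hx (ψ x) fun _ => rfl, hy (ψ y) fun _ => rfl]
  have hσt : ∀ (a : F) (r : R) (φ ψ : R →ₗ[K] F ⊗[K] M), (∀ s, ψ s = a • φ (s * r)) →
      σ ψ = (a ⊗ₜ[K] r) • σ φ := by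
    intro a r φ ψ hψ
    obtain ⟨x, rfl⟩ := e.surjective φ
    induction x generalizing ψ with
    | zero =>
      rw [show ψ = 0 from LinearMap.ext fun s => by simp [hψ]]
      simp
    | tmul b φ =>
      have : ψ = e ((a * b) ⊗ₜ (φ ∘ₗ LinearMap.mulRight K r)) := LinearMap.ext fun s => by
        rw [hψ]
        simp [e, TensorProduct.smul_tmul']
      rw [this, hσ, hσ, hρR, tensorModule_smul_tmul]
    | add x y hx hy =>
      let ψ' (φ : R →ₗ[K] F ⊗[K] M) : R →ₗ[K] F ⊗[K] M := a • (φ ∘ₗ LinearMap.mulRight K r)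
      have : ψ = ψ' (e x) + ψ' (e y) := LinearMap.ext fun s => by
        rw [hψ, map_add]
        exact smul_add _ _ _
      rw [this, map_add, hx (ψ' (e x)) fun _ => rfl, hy (ψ' (e y)) fun _ => rfl, map_add, map_add,
        smul_add]
  refine ⟨fun X Y _ _ _ _ f hf g => ?_⟩
  let ι : F →+* F ⊗[K] R := (Algebra.TensorProduct.includeLeft : F →ₐ[K] F ⊗[K] R).toRingHom
  let : Module F X := Module.compHom X ι
  let : Module F Y := Module.compHom Y ι
  have hQ : ∀ (a : F) (x : F ⊗[K] M), a • x = ι a • x := fun a x =>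
    (tensorModule_smul_left a x).symm
  have hY : ∀ (a : F) (y : Y), a • y = ι a • y := fun _ _ => rfl
  let f' := f.restrictAlong ι (fun _ _ => rfl) hY
  obtain ⟨u, hu⟩ := f'.exists_leftInverse_of_injective (LinearMap.ker_eq_bot.2 hf)
  let v : Y →ₗ[F] F ⊗[K] M := g.restrictAlong ι (fun _ _ => rfl) hQ ∘ₗ u
  have hv : ∀ x, v (f x) = g x := fun x => congrArg g (LinearMap.congr_fun hu x)
  let φ (y : Y) : R →ₗ[K] F ⊗[K] M :=
    { toFun := fun s => v (((1 : F) ⊗ₜ[K] s) • y)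
      map_add' := fun s t => by rw [TensorProduct.tmul_add, add_smul, map_add]
      map_smul' := fun k s => by
        have : (1 : F) ⊗ₜ[K] (k • s) = ι (algebraMap K F k) * ((1 : F) ⊗ₜ[K] s) := by
          simp [ι, TensorProduct.smul_tmul', Algebra.algebraMap_eq_smul_one]
        rw [this, mul_smul, ← hY, map_smul, algebraMap_smul, RingHom.id_apply] }
  let E : Y →+ F ⊗[K] M := AddMonoidHom.mk' (fun y => σ (φ y)) fun y z => by
    rw [← map_add]
    exact congrArg σ (LinearMap.ext fun s => by
      change v _ = v _ + v _
      rw [smul_add, map_add])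
  refine ⟨{ E with map_smul' := map_smul_of_tmul E fun a r y => hσt a r _ _ fun s => ?_ }, fun x =>
    hσs _ _ fun s => ?_⟩
  · change v _ = a • v _
    rw [← map_smul, hY, smul_smul, smul_smul]
    simp [ι]
  · change v _ = _
    rw [← map_smul, hv, map_smul]

theorem HasCoresolution.tensor [FiniteDimensional K R] {n : ℕ} (h : HasCoresolution R n M) :
    HasCoresolution (F ⊗[K] R) n (F ⊗[K] M) := by
  induction n generalizing M with
  | zero => trivial
  | succ n ih =>
    obtain ⟨I, C, _, _, _, _, f, g, hIP, hI, hf, hfg, hg, hC⟩ := h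
    let : Module K I := Module.compHom I (algebraMap K R)
    let : Module K C := Module.compHom C (algebraMap K R)
    have : IsScalarTower K R I := .of_algebraMap_smul fun _ _ => rfl
    have : IsScalarTower K R C := .of_algebraMap_smul fun _ _ => rfl
    refine ⟨F ⊗[K] I, F ⊗[K] C, inferInstance, inferInstance, inferInstance, inferInstance,
      tensorMap f, tensorMap g, projective_tensor hIP, injective_tensor hI, ?_, ?_, ?_, ih hC⟩
    · exact Module.Flat.lTensor_preserves_injective_linearMap (f.restrictScalars K) hf
    · exact lTensor_exact F (f := f.restrictScalars K) (g := g.restrictScalars K) hfg hg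
    · exact LinearMap.lTensor_surjective F (g := g.restrictScalars K) hg

end

variable (K F R) in
theorem projective_tensor_restrict [Module R (F ⊗[K] R)]
    (h : ∀ (r : R) (t : F ⊗[K] R), r • t = ((1 : F) ⊗ₜ[K] r) * t) :
    Module.Projective R (F ⊗[K] R) := by
  let c := TensorProduct.comm K R F
  let e : R ⊗[K] F ≃ₗ[R] F ⊗[K] R :=
    { c with
      map_smul' := fun r t => by
        change c (r • t) = r • c t
        induction t with
        | zero => simp
        | tmul s a => simp [c, h, TensorProduct.smul_tmul']
        | add x y hx hy => rw [smul_add, map_add, map_add, smul_add, hx, hy] }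
  have := Module.Projective.of_basis
    (Algebra.TensorProduct.basis R (Module.Free.chooseBasis K F))
  exact .of_equiv' e

theorem injective_restrict {J : Type u} [AddCommGroup J] [Module (F ⊗[K] R) J] [Module R J]
    (hJ : ∀ (r : R) (j : J), r • j = ((1 : F) ⊗ₜ[K] r) • j)
    (h : Module.Injective (F ⊗[K] R) J) : Module.Injective R J := by
  refine ⟨fun X Y _ _ _ _ f hf g => ?_⟩
  let : Module K X := Module.compHom X (algebraMap K R)
  let : Module K Y := Module.compHom Y (algebraMap K R)
  have : IsScalarTower K R X := .of_algebraMap_smul fun _ _ => rfl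
  have : IsScalarTower K R Y := .of_algebraMap_smul fun _ _ => rfl
  obtain ⟨l, hl⟩ := exists_tensorLift g.toAddMonoidHom fun r m => (g.map_smul r m).trans (hJ _ _)
  obtain ⟨v, hv⟩ := h.out (tensorMap f)
    (Module.Flat.lTensor_preserves_injective_linearMap (f.restrictScalars K) hf) l
  refine ⟨{ toFun := fun y => v (1 ⊗ₜ y)
            map_add' := fun y z => by rw [TensorProduct.tmul_add, map_add]
            map_smul' := fun r y => ?_ }, fun x => ?_⟩
  · rw [RingHom.id_apply, hJ, ← map_smul, tensorModule_smul_tmul, mul_one]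
  · refine (hv (1 ⊗ₜ x)).trans ((hl 1 x).trans ?_)
    exact one_smul (F ⊗[K] R) (g x)

theorem HasCoresolution.of_tensor_equiv {M : Type u} [AddCommGroup M] [Module K M] [Module R M]
    [IsScalarTower K R M] (e : M ≃ₗ[R] R) {n : ℕ}
    (h : HasCoresolution (F ⊗[K] R) n (F ⊗[K] M)) :
    HasCoresolution (F ⊗[K] R) n (F ⊗[K] R) := by
  obtain ⟨p, hp⟩ := exists_tensorLift (K := K) (F := F) (R := R) (M := M) (J := F ⊗[K] R)
    (AddMonoidHom.mk' (fun m => (1 : F) ⊗ₜ[K] e m) fun m m' => by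
      rw [map_add, TensorProduct.tmul_add]) fun r m => by simp
  refine .of_retract (LinearMap.toSpanSingleton _ _ ((1 : F) ⊗ₜ[K] e.symm 1)) p (fun t => ?_) h
  rw [LinearMap.toSpanSingleton_apply, map_smul, hp, ← Algebra.TensorProduct.one_def, one_smul]
  simp [← Algebra.TensorProduct.one_def]

variable (F) in
theorem DomDimGE.tensor [FiniteDimensional K R] {n : ℕ} (h : DomDimGE R n) :
    DomDimGE (F ⊗[K] R) n := by
  rw [domDimGE_iff_hasCoresolution] at h ⊢
  exact .of_tensor_equiv (.refl R R) h.tensor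

variable (K F) in
theorem DomDimGE.of_tensor {n : ℕ} (h : DomDimGE (F ⊗[K] R) n) : DomDimGE R n := by
  rw [domDimGE_iff_hasCoresolution] at h ⊢
  let φ : R →+* F ⊗[K] R := (Algebra.TensorProduct.includeRight : R →ₐ[K] F ⊗[K] R).toRingHom
  let : Module R (F ⊗[K] R) := Module.compHom (F ⊗[K] R) φ
  have hφ : ∀ (r : R) (t : F ⊗[K] R), r • t = φ r * t := fun _ _ => rfl
  have := projective_tensor_restrict K F R hφ
  obtain ⟨u, hu⟩ := (Algebra.linearMap K F).exists_leftInverse_of_injective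
    (LinearMap.ker_eq_bot.2 (algebraMap K F).injective)
  let p := (TensorProduct.lid K R).toLinearMap ∘ₗ u.rTensor R
  refine .of_retract { toFun := φ, map_add' := map_add φ, map_smul' := map_mul φ }
    { p with
      map_smul' := fun r t => ?_ } (fun r => ?_)
    (h.restrict φ (fun J _ _ _ hJ hP hI =>
      ⟨projective_of_projective_restrict φ hφ hJ hP, injective_restrict hJ hI⟩) hφ)
  · change p (r • t) = r • p t
    induction t with
    | zero => simp
    | tmul a s => simp [p, hφ, φ]
    | add x y hx hy => rw [smul_add, map_add, map_add, smul_add, hx, hy]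
  · have : u 1 = 1 := by simpa using LinearMap.congr_fun hu 1
    change p (1 ⊗ₜ r) = r
    simp [p, this]

end BaseChange

open TensorProduct in
/-- For a finite-dimensional algebra `A` over a field `K` and a field
extension `F` of `K`, the dominant dimension of `A` (computed on right modules) equals the
dominant dimension of `A_F = A ⊗_K F`. -/
theorem domDim_eq_domDim_baseChange (K : Type u) [Field K] (A : Type u) [Ring A]
    [Algebra K A] [FiniteDimensional K A] (F : Type u) [Field F] [Algebra K F] :
    domDim Aᵐᵒᵖ = domDim (F ⊗[K] A)ᵐᵒᵖ := by
  have h : ∀ n, DomDimGE Aᵐᵒᵖ n ↔ DomDimGE (F ⊗[K] A)ᵐᵒᵖ n := fun n =>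
    let e : Fᵐᵒᵖ ⊗[K] Aᵐᵒᵖ ≃+* (F ⊗[K] A)ᵐᵒᵖ :=
      (Algebra.TensorProduct.opAlgEquiv K K F A).toRingEquiv
    ⟨fun h => (h.tensor Fᵐᵒᵖ).of_ringEquiv e.symm,
      fun h => (h.of_ringEquiv e).of_tensor K Fᵐᵒᵖ⟩
  simp only [domDim, h]
end
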